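/- arXiv:math/0306386 — 3 statements merged into one kernel-verified Lean document; each statement's English description precedes it below -/
import Mathlib

section
/- The GOE eigenvalue density integrates to one: for every t > 0, ∫_{x_1 < x_2 < ⋯ < x_N} t^{−N(N+1)/4} exp(−|x|²/(2t)) h_N(x) dx = C_2(N), where C_2(N) = 2^{N/2} ∏_{j=1}^N Γ(j/2). -/
open MeasureTheory

noncomputable def vandermonde (N : ℕ) (x : Fin N → ℝ) : ℝ :=
  ∏ p ∈ Finset.univ.filter (fun p : Fin N × Fin N => p.1 < p.2), (x p.2 - x p.1)

def Weyl (N : ℕ) : Set (Fin N → ℝ) := {x | ∀ i j : Fin N, i < j → x i < x j}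

section

open Finset

lemma vandermonde_eq_det {N : ℕ} (x : Fin N → ℝ) :
    vandermonde N x = (Matrix.vandermonde x).det := by
  rw [Matrix.det_vandermonde, vandermonde, prod_filter, Fintype.prod_prod_type]
  refine prod_congr rfl fun i _ => ?_
  rw [← prod_filter]
  refine prod_congr ?_ fun _ _ => rfl
  ext j
  simp

lemma vandermonde_pos {N : ℕ} {x : Fin N → ℝ} (hx : StrictMono x) : 0 < vandermonde N x := by
  refine prod_pos fun p hp => ?_
  simp only [mem_filter, mem_univ, true_and] at hp
  exact sub_pos.2 (hx hp)

lemma prod_prod_erase_abs_sub {N : ℕ} (x : Fin N → ℝ) :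
    ∏ i, ∏ k ∈ univ.erase i, |x i - x k| = vandermonde N x ^ 2 := by
  have key : ∀ i : Fin N, ∏ k ∈ univ.erase i, |x i - x k|
      = (∏ k, if i < k then |x k - x i| else 1) * ∏ k, if k < i then |x i - x k| else 1 := by
    intro i
    rw [← prod_mul_distrib, ← mul_prod_erase _ _ (mem_univ i)]
    simp only [lt_irrefl, if_false, one_mul]
    refine prod_congr rfl fun k hk => ?_
    rcases lt_or_gt_of_ne (ne_of_mem_erase hk) with h | h
    · simp [h, h.not_gt]
    · simp [h, h.not_gt, abs_sub_comm]
  have habs : ∏ i : Fin N, ∏ k : Fin N, (if i < k then |x k - x i| else 1)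
      = |vandermonde N x| := by
    rw [vandermonde, abs_prod, prod_filter, Fintype.prod_prod_type]
  simp_rw [key]
  rw [prod_mul_distrib, habs, prod_comm, habs, abs_mul_abs_self, sq]

/-- The Cauchy matrix of `a` and `b`, bordered by a row of ones. -/
noncomputable def borderedCauchy {N : ℕ} (a : Fin N → ℝ) (b : Fin (N + 1) → ℝ) :
    Matrix (Fin (N + 1)) (Fin (N + 1)) ℝ :=
  Matrix.of fun i j => Fin.cons (α := fun _ => ℝ) 1 (fun i => (b j - a i)⁻¹) i

/-- The absolute value of the resultant of `∏ (X - a i)` and `∏ (X - b j)`. -/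
noncomputable def crossProd {N M : ℕ} (a : Fin N → ℝ) (b : Fin M → ℝ) : ℝ :=
  ∏ i, ∏ j, |b j - a i|

open Polynomial in
/-- The polynomial `∏ (X - a k)` followed by its quotients by the factors `X - a i`. -/
noncomputable def nodalFamily {N : ℕ} (a : Fin N → ℝ) : Fin (N + 1) → ℝ[X] :=
  Fin.cons (∏ k, (X - C (a k))) fun i => ∏ k ∈ univ.erase i, (X - C (a k))

open Polynomial in
lemma natDegree_nodalFamily_lt {N : ℕ} (a : Fin N → ℝ) (i : Fin (N + 1)) :
    (nodalFamily a i).natDegree < N + 1 := by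
  refine Fin.cases ?_ (fun i => ?_) i
  · simp [nodalFamily, natDegree_finsetProd_X_sub_C_eq_card]
  · simp only [nodalFamily, Fin.cons_succ, natDegree_finsetProd_X_sub_C_eq_card]
    exact lt_of_le_of_lt (card_le_univ _) (by simp)

open Polynomial in
lemma of_eval_nodalFamily {N : ℕ} (a : Fin N → ℝ) (y : Fin (N + 1) → ℝ) :
    Matrix.of (fun i j => (nodalFamily a i).eval (y j))
      = Matrix.of (fun i l : Fin (N + 1) => (nodalFamily a i).coeff l)
        * (Matrix.vandermonde y).transpose := by
  ext i j
  simp only [Matrix.of_apply, Matrix.mul_apply, Matrix.transpose_apply, Matrix.vandermonde_apply]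
  rw [eval_eq_sum_range' (natDegree_nodalFamily_lt a i), Finset.sum_range]

open Polynomial in
lemma abs_det_nodalFamily_coeff {N : ℕ} {a : Fin N → ℝ} (ha : StrictMono a) :
    |(Matrix.of (fun i l : Fin (N + 1) => (nodalFamily a i).coeff l)).det|
      = vandermonde N a := by
  obtain ⟨z, hz⟩ := (Set.finite_range a).exists_notMem
  have hza : ∏ k, (a k - z) ≠ 0 := prod_ne_zero_iff.2 fun k _ h =>
    hz ⟨k, by linarith⟩
  have h := congrArg (fun M => |Matrix.det M|) (of_eval_nodalFamily a (Fin.cons z a))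
  simp only [Matrix.det_mul, Matrix.det_transpose, abs_mul] at h
  generalize |(Matrix.of fun i l : Fin (N + 1) => (nodalFamily a i).coeff l).det| = d at h ⊢
  rw [Matrix.det_of_isLowerTriangular, Fin.prod_univ_succ, Matrix.det_vandermonde,
    Fin.prod_univ_succ] at h
  · simp only [Fin.Ioi_zero_eq_map, ← Fin.map_succEmb_Ioi] at h
    simp only [Matrix.of_apply, Fin.cons_zero, Fin.cons_succ, prod_map, Fin.coe_succEmb,
      nodalFamily, eval_prod, eval_sub, eval_X, eval_C, abs_mul, abs_prod] at h
    rw [prod_prod_erase_abs_sub] at h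
    have hV : ∏ i, ∏ j ∈ Ioi i, |a j - a i| = vandermonde N a := by
      rw [← abs_of_pos (vandermonde_pos ha), vandermonde_eq_det, Matrix.det_vandermonde]
      simp [abs_prod]
    rw [hV] at h
    have hz' : ∏ k, |z - a k| = ∏ k, |a k - z| := by simp_rw [abs_sub_comm]
    rw [hz', sq] at h
    have h1 : ∏ k, |a k - z| ≠ 0 := by rw [← abs_prod]; exact abs_ne_zero.2 hza
    have h2 := (vandermonde_pos ha).ne'
    exact (mul_right_cancel₀ (mul_ne_zero h1 h2) (by linear_combination h)).symm
  · intro i j hij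
    simp only [OrderDual.toDual_lt_toDual] at hij
    obtain ⟨j, rfl⟩ := Fin.exists_succ_eq.2 (Fin.ne_zero_of_lt hij)
    refine Fin.cases (fun _ => ?_) (fun i hi => ?_) i hij
    · simp only [Matrix.of_apply, Fin.cons_succ, nodalFamily, Fin.cons_zero, eval_prod]
      exact prod_eq_zero (mem_univ j) (by simp)
    · simp only [Matrix.of_apply, Fin.cons_succ, nodalFamily, eval_prod]
      refine prod_eq_zero (i := j) ?_ (by simp)
      simpa using (Fin.succ_lt_succ_iff.1 hi).ne'

lemma abs_det_borderedCauchy {N : ℕ} {a : Fin N → ℝ} {b : Fin (N + 1) → ℝ} (ha : StrictMono a)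
    (hb : StrictMono b) (hab : ∀ i j, b j ≠ a i) :
    |(borderedCauchy a b).det|
      = vandermonde N a * vandermonde (N + 1) b / crossProd a b := by
  have hX : crossProd a b ≠ 0 := prod_ne_zero_iff.2 fun i _ => prod_ne_zero_iff.2 fun j _ =>
    abs_ne_zero.2 (sub_ne_zero.2 (hab i j))
  have h := congrArg (fun M => |Matrix.det M|) (of_eval_nodalFamily a b)
  have hD : Matrix.of (fun i j => (nodalFamily a i).eval (b j))
      = Matrix.of fun i j => (∏ k, (b j - a k)) * borderedCauchy a b i j := by
    ext i j
    refine Fin.cases ?_ (fun i => ?_) i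
    · simp [nodalFamily, borderedCauchy, Polynomial.eval_prod]
    · simp only [Matrix.of_apply, nodalFamily, Fin.cons_succ, Polynomial.eval_prod,
        borderedCauchy, ← mul_prod_erase univ _ (mem_univ i)]
      have := sub_ne_zero.2 (hab i j)
      simp only [Polynomial.eval_sub, Polynomial.eval_X, Polynomial.eval_C]
      field_simp
  rw [hD] at h
  simp only [Matrix.det_mul_row, Matrix.det_mul, Matrix.det_transpose, abs_mul,
    abs_det_nodalFamily_coeff ha, ← vandermonde_eq_det, abs_of_pos (vandermonde_pos hb)] at h
  rw [eq_div_iff hX, ← h, mul_comm, crossProd, prod_comm]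
  simp [abs_prod]

lemma prod_erase_castSucc_mul_prod_erase_succ_neg {n : ℕ} {y : Fin (n + 1) → ℝ}
    (hy : StrictMono y) (i : Fin n) :
    (∏ k ∈ univ.erase i.castSucc, (y i.castSucc - y k))
      * ∏ k ∈ univ.erase i.succ, (y i.succ - y k) < 0 := by
  have hlt := hy (Fin.castSucc_lt_succ (i := i))
  have hne : i.castSucc ≠ i.succ := (Fin.castSucc_lt_succ (i := i)).ne
  rw [← mul_prod_erase (univ.erase i.castSucc) _ (mem_erase.2 ⟨hne.symm, mem_univ _⟩),
    ← mul_prod_erase (univ.erase i.succ) _ (mem_erase.2 ⟨hne, mem_univ _⟩),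
    erase_right_comm (a := i.succ)]
  have hpos : 0 < ∏ k ∈ (univ.erase i.castSucc).erase i.succ,
      ((y i.castSucc - y k) * (y i.succ - y k)) := by
    refine prod_pos fun k hk => ?_
    simp only [mem_erase, mem_univ, and_true] at hk
    rcases lt_or_gt_of_ne hk.2 with h | h
    · have := hy h
      exact mul_pos (by linarith) (by linarith)
    · have := hy ((Fin.castSucc_lt_iff_succ_le.1 h).lt_of_ne' hk.1)
      exact mul_pos_of_neg_of_neg (by linarith) (by linarith)
  rw [prod_mul_distrib] at hpos
  have h2 : 0 < (y i.succ - y i.castSucc) ^ 2 := by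
    have := sub_pos.2 hlt
    positivity
  nlinarith [mul_pos h2 hpos]

/-- A continuous function whose signs at the points `y i` agree with those of the derivative of
`∏ (X - y k)` vanishes between any two consecutive points. -/
lemma exists_interlacing_zeros {n : ℕ} {y : Fin (n + 1) → ℝ} (hy : StrictMono y) {f : ℝ → ℝ}
    (hf : Continuous f) (hsign : ∀ i, 0 < f (y i) * ∏ k ∈ univ.erase i, (y i - y k)) :
    ∃ x : Fin n → ℝ, ∀ i, (y i.castSucc < x i ∧ x i < y i.succ) ∧ f (x i) = 0 := by
  have key : ∀ i : Fin n, ∃ x, (y i.castSucc < x ∧ x < y i.succ) ∧ f x = 0 := by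
    intro i
    have hlt := hy (Fin.castSucc_lt_succ (i := i))
    have hneg := prod_erase_castSucc_mul_prod_erase_succ_neg hy i
    have hmul := mul_pos (hsign i.castSucc) (hsign i.succ)
    have hff : f (y i.castSucc) * f (y i.succ) < 0 := by
      by_contra! h
      nlinarith [mul_nonpos_of_nonneg_of_nonpos h hneg.le]
    rcases mul_neg_iff.1 hff with ⟨h1, h2⟩ | ⟨h1, h2⟩
    · obtain ⟨x, hx, hx0⟩ := intermediate_value_Ioo' hlt.le hf.continuousOn ⟨h2, h1⟩
      exact ⟨x, hx, hx0⟩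
    · obtain ⟨x, hx, hx0⟩ := intermediate_value_Ioo hlt.le hf.continuousOn ⟨h1, h2⟩
      exact ⟨x, hx, hx0⟩
  choose x hx using key
  exact ⟨x, hx⟩

/-- `a` and `b` interlace strictly: `b 0 < a 0 < b 1 < a 1 < ⋯ < b N`. -/
def Interlace {N : ℕ} (a : Fin N → ℝ) (b : Fin (N + 1) → ℝ) : Prop :=
  ∀ i, b i.castSucc < a i ∧ a i < b i.succ

namespace Interlace

variable {N : ℕ} {a : Fin N → ℝ} {b : Fin (N + 1) → ℝ}

lemma strictMono_right (h : Interlace a b) : StrictMono b :=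
  Fin.strictMono_iff_lt_succ.2 fun i => (h i).1.trans (h i).2

lemma lt_of_le_castSucc (h : Interlace a b) {i : Fin N} {j : Fin (N + 1)} (hj : j ≤ i.castSucc) :
    b j < a i :=
  (h.strictMono_right.monotone hj).trans_lt (h i).1

lemma lt_of_succ_le (h : Interlace a b) {i : Fin N} {j : Fin (N + 1)} (hj : i.succ ≤ j) :
    a i < b j :=
  (h i).2.trans_le (h.strictMono_right.monotone hj)

lemma strictMono_left (h : Interlace a b) : StrictMono a := fun i j hij =>
  (h i).2.trans_le ((h.strictMono_right.monotone (Fin.succ_le_castSucc_iff.2 hij)).trans (h j).1.le)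

lemma ne (h : Interlace a b) (i : Fin N) (j : Fin (N + 1)) : b j ≠ a i := by
  rcases le_or_gt j i.castSucc with hj | hj
  · exact (h.lt_of_le_castSucc hj).ne
  · exact (h.lt_of_succ_le (Fin.castSucc_lt_iff_succ_le.1 hj)).ne'

end Interlace

namespace Polynomial

lemma degree_lt_of_coeff_eq_zero {R : Type*} [Semiring R] {p : R[X]} {n : ℕ}
    (hp : p.degree < (n + 1 : ℕ)) (hn : p.coeff n = 0) : p.degree < n := by
  rw [degree_lt_iff_coeff_zero] at hp ⊢
  intro m hm
  rcases hm.eq_or_lt with rfl | h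
  · exact hn
  · exact hp m h

lemma eq_of_prod_X_sub_C_eq {n : ℕ} {x y : Fin n → ℝ} (hx : StrictMono x) (hy : StrictMono y)
    (h : ∏ i, (X - C (x i)) = ∏ i, (X - C (y i))) : x = y := by
  have hrange : ∀ z : Fin n → ℝ, Set.range z = {r | (∏ i, (X - C (z i))).eval r = 0} := by
    intro z
    ext r
    simp only [Set.mem_range, eval_prod, eval_sub, eval_X, eval_C, Set.mem_ofPred_eq,
      prod_eq_zero_iff, mem_univ, true_and, sub_eq_zero]
    exact exists_congr fun i => eq_comm
  exact (StrictMono.range_inj hx hy).1 (by rw [hrange, hrange, h])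

/-- The numerator of the partial fraction `∑ w i / (X - a i)`. -/
noncomputable def partialFractionNum {n : ℕ} (a w : Fin n → ℝ) : ℝ[X] :=
  ∑ i, C (w i) * ∏ k ∈ univ.erase i, (X - C (a k))

variable {n : ℕ} (a w : Fin n → ℝ)

lemma eval_partialFractionNum (i : Fin n) :
    (partialFractionNum a w).eval (a i) = w i * ∏ k ∈ univ.erase i, (a i - a k) := by
  rw [partialFractionNum, eval_finsetSum, sum_eq_single i]
  · simp [eval_prod]
  · intro j _ hj
    rw [eval_mul, eval_prod, prod_eq_zero (i := i) (by simpa using hj.symm) (by simp), mul_zero]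
  · simp

lemma degree_partialFractionNum_lt : (partialFractionNum a w).degree < n := by
  rcases Nat.eq_zero_or_pos n with rfl | hn
  · simp [partialFractionNum]
  refine (degree_sum_le _ _).trans_lt ((Finset.sup_lt_iff (WithBot.bot_lt_coe n)).2 fun i _ => ?_)
  have hle : (C (w i) * ∏ k ∈ univ.erase i, (X - C (a k))).degree
      ≤ 0 + (∏ k ∈ univ.erase i, (X - C (a k))).degree := by
    rw [degree_mul]
    gcongr
    exact degree_C_le
  refine hle.trans_lt ?_
  rw [zero_add, degree_prod]
  simp only [degree_X_sub_C, sum_const, mem_univ, card_erase_of_mem, card_univ, Fintype.card_fin,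
    nsmul_eq_mul, mul_one]
  exact WithBot.coe_lt_coe.2 (Nat.sub_lt hn one_pos)

lemma coeff_partialFractionNum {m : ℕ} (a w : Fin (m + 1) → ℝ) :
    (partialFractionNum a w).coeff m = ∑ i, w i := by
  rw [partialFractionNum, finsetSum_coeff]
  refine sum_congr rfl fun i _ => ?_
  have hm : (∏ k ∈ univ.erase i, (X - C (a k))).Monic := monic_prod_X_sub_C _ _
  have hd : (∏ k ∈ univ.erase i, (X - C (a k))).natDegree = m := by
    simp [natDegree_finsetProd_X_sub_C_eq_card]
  have hc := hm.coeff_natDegree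
  rw [hd] at hc
  rw [coeff_C_mul, hc, mul_one]

end Polynomial

/-- The residue at `x i` of the rational function `∏ (X - y j) / ∏ (X - x k)`. -/
noncomputable def nodalResidue {n m : ℕ} (x : Fin n → ℝ) (y : Fin m → ℝ) (i : Fin n) : ℝ :=
  (∏ j, (x i - y j)) / ∏ k ∈ univ.erase i, (x i - x k)

lemma prod_erase_eq_prod_succAbove {n : ℕ} (i : Fin (n + 1)) (f : Fin (n + 1) → ℝ) :
    ∏ k ∈ univ.erase i, f k = ∏ j, f (i.succAbove j) := by
  rw [← compl_singleton, ← Fin.image_succAbove_univ,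
    prod_image Fin.succAbove_right_injective.injOn]

lemma prod_erase_eq_prod_ite {n : ℕ} (i : Fin n) (f : Fin n → ℝ) :
    ∏ k ∈ univ.erase i, f k = ∏ k, if k = i then 1 else f k := by
  rw [← mul_prod_erase univ _ (mem_univ i), if_pos rfl, one_mul]
  exact prod_congr rfl fun k hk => (if_neg (ne_of_mem_erase hk)).symm

lemma prod_erase_sub_ne_zero {n : ℕ} {x : Fin n → ℝ} (hx : Function.Injective x) (i : Fin n) :
    ∏ k ∈ univ.erase i, (x i - x k) ≠ 0 :=
  prod_ne_zero_iff.2 fun _ hk => sub_ne_zero.2 fun h => ne_of_mem_erase hk (hx h).symm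

lemma prod_abs_nodalResidue {n m : ℕ} (x : Fin n → ℝ) (y : Fin m → ℝ) :
    ∏ i, |nodalResidue x y i| = crossProd y x / vandermonde n x ^ 2 := by
  simp only [nodalResidue, abs_div, abs_prod, prod_div_distrib, prod_prod_erase_abs_sub, crossProd]
  rw [prod_comm]

lemma crossProd_comm {n m : ℕ} (x : Fin n → ℝ) (y : Fin m → ℝ) :
    crossProd x y = crossProd y x := by
  rw [crossProd, prod_comm, crossProd]
  simp_rw [abs_sub_comm]

namespace Interlace

variable {N : ℕ} {a : Fin N → ℝ} {b : Fin (N + 1) → ℝ}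

lemma crossProd_pos (h : Interlace a b) : 0 < crossProd a b :=
  prod_pos fun i _ => prod_pos fun j _ => abs_pos.2 (sub_ne_zero.2 (h.ne i j))

lemma nodalResidue_right_pos (h : Interlace a b) (i : Fin (N + 1)) : 0 < nodalResidue b a i := by
  rw [nodalResidue, prod_erase_eq_prod_succAbove, ← prod_div_distrib]
  refine prod_pos fun j _ => ?_
  rcases lt_or_ge j.castSucc i with hj | hj
  · rw [Fin.succAbove_of_castSucc_lt _ _ hj]
    exact div_pos (sub_pos.2 (h.lt_of_succ_le (Fin.castSucc_lt_iff_succ_le.1 hj)))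
      (sub_pos.2 (h.strictMono_right hj))
  · rw [Fin.succAbove_of_le_castSucc _ _ hj]
    exact div_pos_of_neg_of_neg (sub_neg.2 (h.lt_of_le_castSucc hj))
      (sub_neg.2 (h.strictMono_right (hj.trans_lt Fin.castSucc_lt_succ)))

lemma nodalResidue_left_neg (h : Interlace a b) (i : Fin N) : nodalResidue a b i < 0 := by
  rw [nodalResidue, Fin.prod_univ_succ, ← mul_prod_erase univ _ (mem_univ i), ← mul_assoc,
    mul_div_assoc, ← prod_div_distrib]
  refine mul_neg_of_neg_of_pos
    (mul_neg_of_pos_of_neg (sub_pos.2 (h.lt_of_le_castSucc (Fin.zero_le _)))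
      (sub_neg.2 (h i).2)) (prod_pos fun k hk => ?_)
  rcases lt_or_gt_of_ne (ne_of_mem_erase hk) with hki | hki
  · exact div_pos (sub_pos.2 (h.lt_of_le_castSucc (Fin.succ_le_castSucc_iff.2 hki)))
      (sub_pos.2 (h.strictMono_left hki))
  · exact div_pos_of_neg_of_neg (sub_neg.2 (h.lt_of_succ_le (Fin.succ_le_succ_iff.2 hki.le)))
      (sub_neg.2 (h.strictMono_left hki))

end Interlace

section Polynomial

open Polynomial

lemma Polynomial.degree_prod_X_sub_C {n : ℕ} (x : Fin n → ℝ) :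
    (∏ i, (X - C (x i))).degree = (n : WithBot ℕ) := by
  simp [degree_prod]

lemma Polynomial.coeff_prod_X_sub_C_self {n : ℕ} (x : Fin n → ℝ) :
    (∏ i, (X - C (x i))).coeff n = 1 := by
  have hm : (∏ i, (X - C (x i))).Monic := monic_prod_X_sub_C _ _
  have hc := hm.coeff_natDegree
  rwa [natDegree_eq_of_degree_eq_some (degree_prod_X_sub_C x)] at hc

lemma sum_nodalResidue {N : ℕ} (a : Fin N → ℝ) {b : Fin (N + 1) → ℝ}
    (hb : Function.Injective b) : ∑ i, nodalResidue b a i = 1 := by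
  have h := Lagrange.coeff_eq_sum (s := univ) hb.injOn (P := ∏ j, (X - C (a j))) (by
    rw [degree_prod_X_sub_C, card_univ, Fintype.card_fin]
    exact WithBot.coe_lt_coe.2 N.lt_succ_self)
  simp only [card_univ, Fintype.card_fin, Nat.add_sub_cancel,
    coeff_prod_X_sub_C_self, eval_prod, eval_sub, eval_X,
    eval_C] at h
  exact h.symm

lemma eq_of_mul_nodalResidue_eq {N : ℕ} {a a' : Fin N → ℝ} {b : Fin (N + 1) → ℝ}
    (h : Interlace a b) (h' : Interlace a' b) {W W' : ℝ} (hW : W ≠ 0)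
    (heq : ∀ i, W * nodalResidue b a i = W' * nodalResidue b a' i) : W = W' ∧ a = a' := by
  have hb := h.strictMono_right.injective
  have hWW : W = W' := by
    have := sum_congr rfl fun i (_ : i ∈ univ) => heq i
    rwa [← mul_sum, ← mul_sum, sum_nodalResidue a hb, sum_nodalResidue a' hb, mul_one,
      mul_one] at this
  subst hWW
  refine ⟨rfl, eq_of_prod_X_sub_C_eq h.strictMono_left h'.strictMono_left ?_⟩
  refine eq_of_degrees_lt_of_eval_index_eq (s := univ) (v := b) hb.injOn ?_ ?_ fun i _ => ?_
  · rw [degree_prod_X_sub_C, card_univ, Fintype.card_fin]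
    exact WithBot.coe_lt_coe.2 N.lt_succ_self
  · rw [degree_prod_X_sub_C, card_univ, Fintype.card_fin]
    exact WithBot.coe_lt_coe.2 N.lt_succ_self
  · have := mul_left_cancel₀ hW (heq i)
    rw [nodalResidue, nodalResidue, div_left_inj' (prod_erase_sub_ne_zero hb i)] at this
    simpa [eval_prod] using this

lemma exists_interlace_mul_nodalResidue_eq {N : ℕ} {b : Fin (N + 1) → ℝ} (hb : StrictMono b)
    {w : Fin (N + 1) → ℝ} (hw : ∀ i, 0 < w i) :
    ∃ a, Interlace a b ∧ ∀ i, (∑ k, w k) * nodalResidue b a i = w i := by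
  obtain ⟨a, ha⟩ := exists_interlacing_zeros hb (partialFractionNum b w).continuous fun i => by
    rw [eval_partialFractionNum, mul_assoc]
    exact mul_pos (hw i) (mul_self_pos.2 (prod_erase_sub_ne_zero hb.injective i))
  have hab : Interlace a b := fun i => (ha i).1
  refine ⟨a, hab, fun i => ?_⟩
  have hP : partialFractionNum b w - C (∑ k, w k) * ∏ j, (X - C (a j)) = 0 := by
    refine eq_zero_of_degree_lt_of_eval_index_eq_zero (s := univ) (v := a)
      hab.strictMono_left.injective.injOn ?_ fun j _ => ?_
    · rw [card_univ, Fintype.card_fin]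
      refine degree_lt_of_coeff_eq_zero ?_ ?_
      · refine (degree_sub_le _ _).trans_lt (max_lt (degree_partialFractionNum_lt b w) ?_)
        rw [degree_C_mul (sum_pos (fun k _ => hw k) univ_nonempty).ne', degree_prod_X_sub_C]
        exact WithBot.coe_lt_coe.2 N.lt_succ_self
      · rw [coeff_sub, coeff_C_mul, coeff_partialFractionNum, coeff_prod_X_sub_C_self,
          mul_one, sub_self]
    · rw [eval_sub, (ha j).2, eval_mul, eval_prod, prod_eq_zero (mem_univ j) (by simp)]
      simp
  have h := congrArg (eval (b i)) hP
  rw [eval_sub, eval_partialFractionNum, eval_zero, sub_eq_zero] at h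
  rw [nodalResidue, ← mul_div_assoc, div_eq_iff (prod_erase_sub_ne_zero hb.injective i), h,
    eval_mul, eval_C, eval_prod]
  simp

lemma exists_prod_one_sub_C_mul_X {ι : Type*} [DecidableEq ι] (s : Finset ι) (f : ι → ℝ) :
    ∃ r : ℝ[X], ∏ i ∈ s, (1 - C (f i) * X)
      = 1 - C (∑ i ∈ s, f i) * X + C (((∑ i ∈ s, f i) ^ 2 - ∑ i ∈ s, f i ^ 2) / 2) * X ^ 2
        + X ^ 3 * r := by
  induction s using Finset.induction_on with
  | empty => exact ⟨0, by simp⟩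
  | insert i s hi ih =>
    obtain ⟨r, hr⟩ := ih
    refine ⟨r - C (f i) * X * r - C (f i) * C (((∑ i ∈ s, f i) ^ 2 - ∑ i ∈ s, f i ^ 2) / 2), ?_⟩
    rw [prod_insert hi, hr, sum_insert hi, sum_insert hi]
    have hC : ((f i + ∑ i ∈ s, f i) ^ 2 - (f i ^ 2 + ∑ i ∈ s, f i ^ 2)) / 2
        = f i * ∑ i ∈ s, f i + ((∑ i ∈ s, f i) ^ 2 - ∑ i ∈ s, f i ^ 2) / 2 := by ring
    rw [hC]
    simp only [C_add, C_mul]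
    ring

/-- Comparison of the two leading subdominant coefficients in the partial fraction expansion
`∏ (X - b j) / ∏ (X - a i) = X - c - ∑ w i / (X - a i)`. -/
lemma sum_eq_of_partialFraction {N : ℕ} {a w : Fin N → ℝ} {b : Fin (N + 1) → ℝ} {c : ℝ}
    (h : ∏ j, (X - C (b j)) = (X - C c) * ∏ i, (X - C (a i)) - partialFractionNum a w) :
    c = ∑ j, b j - ∑ i, a i ∧
      ∑ j, b j ^ 2 = ∑ i, a i ^ 2 + c ^ 2 + 2 * ∑ i, w i := by
  have hrev : ∏ j, (1 - C (b j) * X) = (1 - C c * X) * ∏ i, (1 - C (a i) * X)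
      - X ^ 2 * ∑ i, C (w i) * ∏ k ∈ univ.erase i, (1 - C (a k) * X) := by
    refine eq_of_infinite_eval_eq _ _ (((Set.finite_singleton (0 : ℝ)).infinite_compl).mono ?_)
    intro u hu
    have hu : u ≠ 0 := hu
    have hz : ∀ x : ℝ, 1 - x * u = u * (u⁻¹ - x) := fun x => by field_simp
    have := congrArg (eval u⁻¹) h
    simp only [partialFractionNum, eval_prod, eval_sub, eval_mul, eval_finsetSum, eval_X,
      eval_C] at this
    simp only [Set.mem_ofPred_eq, eval_prod, eval_sub, eval_mul, eval_finsetSum, eval_X, eval_C,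
      eval_one, eval_pow, hz, prod_mul_distrib, prod_const, card_univ, Fintype.card_fin, this,
      mem_univ, card_erase_of_mem]
    have hs : ∀ i : Fin N, u ^ 2 * (w i * (u ^ (N - 1) * ∏ k ∈ univ.erase i, (u⁻¹ - a k)))
        = u ^ (N + 1) * (w i * ∏ k ∈ univ.erase i, (u⁻¹ - a k)) := by
      intro i
      have hN : N + 1 = 2 + (N - 1) := by have := i.pos; omega
      rw [hN, pow_add]
      ring
    rw [mul_sum, sum_congr rfl fun i _ => hs i, ← mul_sum]
    ring
  obtain ⟨r, hr⟩ := exists_prod_one_sub_C_mul_X univ b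
  obtain ⟨s, hs⟩ := exists_prod_one_sub_C_mul_X univ a
  have hw : ∃ t, ∑ i, C (w i) * ∏ k ∈ univ.erase i, (1 - C (a k) * X) = C (∑ i, w i) + X * t := by
    have := X_mul_divX_add (∑ i, C (w i) * ∏ k ∈ univ.erase i, (1 - C (a k) * X))
    refine ⟨divX (∑ i, C (w i) * ∏ k ∈ univ.erase i, (1 - C (a k) * X)), this.symm.trans ?_⟩
    rw [add_comm]
    congr 2
    rw [coeff_zero_eq_eval_zero]
    simp [eval_finsetSum, eval_prod]
  obtain ⟨t, ht⟩ := hw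
  rw [hr, hs, ht] at hrev
  set B := ∑ j, b j
  set A := ∑ j, a j
  set B2 := ∑ j, b j ^ 2
  set A2 := ∑ j, a j ^ 2
  set w' := ∑ i, w i
  have h1 : C (c + A - B) + X * (C ((B ^ 2 - B2) / 2) - C ((A ^ 2 - A2) / 2) - C c * C A + C w'
      + X * (r - s + C c * C ((A ^ 2 - A2) / 2) + X * C c * s + t)) = 0 := by
    refine mul_left_cancel₀ (X_ne_zero (R := ℝ)) ?_
    simp only [C_add, C_sub]
    linear_combination hrev
  have hc : c + A - B = 0 := by simpa using congrArg (eval 0) h1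
  rw [hc, C_0, zero_add] at h1
  have h2 := congrArg (eval 0) ((mul_eq_zero.1 h1).resolve_left X_ne_zero)
  simp only [eval_add, eval_sub, eval_mul, eval_C, eval_X, zero_mul, add_zero, eval_zero] at h2
  have hB : B = c + A := by linarith
  rw [hB] at h2 ⊢
  exact ⟨by ring, by linarith⟩

lemma prod_X_sub_C_eq_partialFraction {N : ℕ} {a : Fin N → ℝ} (ha : Function.Injective a)
    (b : Fin (N + 1) → ℝ) :
    ∏ j, (X - C (b j)) = (X - C (∑ j, b j - ∑ i, a i)) * ∏ i, (X - C (a i))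
      - partialFractionNum a fun i => -nodalResidue a b i := by
  set w : Fin N → ℝ := fun i => -nodalResidue a b i
  suffices h : ∃ c, ∏ j, (X - C (b j))
      = (X - C c) * ∏ i, (X - C (a i)) - partialFractionNum a w by
    obtain ⟨c, hc⟩ := h
    rw [hc, (sum_eq_of_partialFraction hc).1]
  set D := ∏ j, (X - C (b j)) + partialFractionNum a w - X * ∏ i, (X - C (a i)) with hD
  have hXA : (X * ∏ i, (X - C (a i))).degree = ((N + 1 : ℕ) : WithBot ℕ) := by
    rw [degree_mul, degree_X, degree_prod_X_sub_C, add_comm]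
    rfl
  have hcoeff : ∀ p : ℝ[X], p.degree < (N + 1 : ℕ) → p.coeff (N + 1) = 0 := fun p hp =>
    (degree_lt_iff_coeff_zero _ _).1 hp _ le_rfl
  have hlt : (N : WithBot ℕ) < (N + 1 : ℕ) := WithBot.coe_lt_coe.2 N.lt_succ_self
  have hQ := (degree_partialFractionNum_lt a w).trans hlt
  have hDdeg : D.degree < (N + 1 : ℕ) := by
    refine degree_lt_of_coeff_eq_zero ?_ ?_
    · have hlt' : ((N + 1 : ℕ) : WithBot ℕ) < (N + 1 + 1 : ℕ) :=
        WithBot.coe_lt_coe.2 (N + 1).lt_succ_self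
      refine (degree_sub_le _ _).trans_lt (max_lt ((degree_add_le _ _).trans_lt (max_lt ?_ ?_)) ?_)
      · rw [degree_prod_X_sub_C]
        exact hlt'
      · exact hQ.trans hlt'
      · rw [hXA]
        exact hlt'
    · rw [hD, coeff_sub, coeff_add, hcoeff _ hQ, coeff_prod_X_sub_C_self, coeff_X_mul,
        coeff_prod_X_sub_C_self]
      ring
  refine ⟨-D.coeff N, ?_⟩
  have hP : D - C (D.coeff N) * ∏ i, (X - C (a i)) = 0 := by
    refine eq_zero_of_degree_lt_of_eval_index_eq_zero (s := univ) (v := a) ha.injOn ?_ fun i _ => ?_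
    · rw [card_univ, Fintype.card_fin]
      refine degree_lt_of_coeff_eq_zero ?_ ?_
      · refine (degree_sub_le _ _).trans_lt (max_lt hDdeg ?_)
        rw [degree_mul, degree_prod_X_sub_C]
        refine lt_of_le_of_lt ?_ hlt
        calc (C (D.coeff N)).degree + (N : WithBot ℕ) ≤ 0 + (N : WithBot ℕ) := by
              gcongr
              exact degree_C_le
          _ = N := zero_add _
      · rw [coeff_sub, coeff_C_mul, coeff_prod_X_sub_C_self, mul_one, sub_self]
    · have h0 : (∏ k, (X - C (a k))).eval (a i) = 0 := by
        rw [eval_prod, prod_eq_zero (mem_univ i) (by simp)]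
      rw [hD, eval_sub, eval_sub, eval_add, eval_mul, eval_mul, h0, eval_partialFractionNum,
        eval_prod]
      have hne := prod_erase_sub_ne_zero ha i
      simp only [w, nodalResidue, eval_sub, eval_X, eval_C]
      field_simp
      ring
  rw [C_neg]
  linear_combination hP + hD

lemma sum_sq_eq_of_nodalResidue {N : ℕ} {a : Fin N → ℝ} (ha : Function.Injective a)
    (b : Fin (N + 1) → ℝ) :
    ∑ j, b j ^ 2 = ∑ i, a i ^ 2 + (∑ j, b j - ∑ i, a i) ^ 2 + 2 * ∑ i, -nodalResidue a b i :=
  (sum_eq_of_partialFraction (prod_X_sub_C_eq_partialFraction ha b)).2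

lemma eq_of_nodalResidue_eq {N : ℕ} {a : Fin N → ℝ} {b b' : Fin (N + 1) → ℝ}
    (h : Interlace a b) (h' : Interlace a b') (hsum : ∑ j, b j = ∑ j, b' j)
    (heq : ∀ i, nodalResidue a b i = nodalResidue a b' i) : b = b' := by
  refine eq_of_prod_X_sub_C_eq h.strictMono_right h'.strictMono_right ?_
  have ha := h.strictMono_left.injective
  rw [prod_X_sub_C_eq_partialFraction ha, prod_X_sub_C_eq_partialFraction ha, hsum, funext heq]

lemma exists_interlace_nodalResidue_eq {N : ℕ} {a : Fin N → ℝ} (ha : StrictMono a) (c : ℝ)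
    {w : Fin N → ℝ} (hw : ∀ i, 0 < w i) :
    ∃ b, Interlace a b ∧ ∑ j, b j - ∑ i, a i = c ∧ ∀ i, -nodalResidue a b i = w i := by
  set P : ℝ[X] := (X - C c) * ∏ i, (X - C (a i)) - partialFractionNum a w with hP
  have hPa : ∀ i, P.eval (a i) = -(w i * ∏ k ∈ univ.erase i, (a i - a k)) := fun i => by
    rw [hP, eval_sub, eval_partialFractionNum, eval_mul, eval_prod,
      prod_eq_zero (mem_univ i) (by simp)]
    ring
  have hPf : ∀ z, (∀ i, z ≠ a i) →
      P.eval z = (z - c - ∑ i, w i / (z - a i)) * ∏ i, (z - a i) := by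
    intro z hz
    simp only [hP, partialFractionNum, eval_sub, eval_mul, eval_X, eval_C, eval_prod,
      eval_finsetSum]
    rw [sub_mul (z - c), sum_mul]
    congr 1
    refine sum_congr rfl fun i _ => ?_
    rw [← mul_prod_erase univ _ (mem_univ i)]
    have := sub_ne_zero.2 (hz i)
    field_simp
  obtain ⟨M, hM⟩ : ∃ M : ℝ, ∀ i, |a i| ≤ M := ⟨∑ i, |a i|, fun i =>
    single_le_sum (f := fun i => |a i|) (fun _ _ => abs_nonneg _) (mem_univ i)⟩
  set S := ∑ i, w i
  have hS : 0 ≤ S := sum_nonneg fun i _ => (hw i).le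
  set T := |M| + |c| + S + 1
  have hTa : ∀ i, a i + 1 ≤ T ∧ -T ≤ a i - 1 := fun i => by
    have h1 := abs_le.1 (hM i)
    have h2 := le_abs_self M
    have h3 := abs_nonneg c
    constructor <;> simp only [T] <;> linarith
  have hR : 0 < T - c - ∑ i, w i / (T - a i) := by
    have : ∑ i, w i / (T - a i) ≤ S := sum_le_sum fun i _ =>
      div_le_self (hw i).le (by linarith [(hTa i).1])
    have := le_abs_self c
    have := abs_nonneg M
    simp only [T] at *
    linarith
  have hL : -T - c - ∑ i, w i / (-T - a i) < 0 := by
    have : -∑ i, w i / (-T - a i) ≤ S := by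
      rw [← sum_neg_distrib]
      refine sum_le_sum fun i _ => ?_
      rw [← div_neg]
      exact div_le_self (hw i).le (by linarith [(hTa i).2])
    have := neg_abs_le c
    have := abs_nonneg M
    simp only [T] at *
    linarith
  have hT : 0 < T := by positivity
  set y : Fin (N + 2) → ℝ := Fin.cons (-T) (Fin.snoc (α := fun _ => ℝ) a T) with hy
  have hymono : StrictMono y := by
    refine Fin.strictMono_iff_lt_succ.2 fun i => ?_
    refine Fin.cases ?_ (fun j => ?_) i
    · rw [Fin.castSucc_zero, hy, Fin.cons_zero, Fin.cons_succ]
      refine Fin.lastCases ?_ (fun k => ?_) (0 : Fin (N + 1))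
      · rw [Fin.snoc_last]
        linarith
      · rw [Fin.snoc_castSucc]
        linarith [(hTa k).2]
    · rw [← Fin.succ_castSucc, hy, Fin.cons_succ, Fin.cons_succ, Fin.snoc_castSucc]
      have key : ∀ k : Fin (N + 1), j.castSucc < k → a j < Fin.snoc (α := fun _ => ℝ) a T k := by
        intro k
        refine Fin.lastCases (fun _ => ?_) (fun k hk => ?_) k
        · rw [Fin.snoc_last]
          linarith [(hTa j).1]
        · rw [Fin.snoc_castSucc]
          exact ha (Fin.castSucc_lt_castSucc_iff.1 hk)
      exact key _ Fin.castSucc_lt_succ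
  obtain ⟨b, hb⟩ := exists_interlacing_zeros hymono P.continuous fun i => by
    refine Fin.cases ?_ (fun k => Fin.lastCases ?_ (fun k => ?_) k) i
    · rw [prod_erase_eq_prod_succAbove, Fin.prod_univ_castSucc]
      simp only [hy, Fin.cons_zero, Fin.zero_succAbove, Fin.cons_succ, Fin.snoc_castSucc,
        Fin.snoc_last]
      have hne : ∏ i, (-T - a i) ≠ 0 := prod_ne_zero_iff.2 fun i _ => by linarith [(hTa i).2]
      rw [hPf _ fun i => by linarith [(hTa i).2]]
      have := mul_pos (mul_self_pos.2 hne) (mul_pos_of_neg_of_neg hL (show -T - T < 0 by linarith))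
      linarith
    · have hyT : y (Fin.last N).succ = T := by rw [hy, Fin.cons_succ, Fin.snoc_last]
      rw [prod_erase_eq_prod_succAbove, Fin.prod_univ_succ, hyT]
      simp only [hy, Fin.cons_succ, Fin.succ_last, Fin.succAbove_last,
        Fin.castSucc_zero, Fin.cons_zero, ← Fin.succ_castSucc, Fin.snoc_castSucc]
      have hne : ∏ i, (T - a i) ≠ 0 := prod_ne_zero_iff.2 fun i _ => by linarith [(hTa i).1]
      rw [hPf _ fun i => by linarith [(hTa i).1]]
      have := mul_pos (mul_self_pos.2 hne) (mul_pos hR (show 0 < T - -T by linarith))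
      linarith
    · rw [prod_erase_eq_prod_ite, Fin.prod_univ_succ, Fin.prod_univ_castSucc]
      simp only [hy, Fin.cons_succ, Fin.cons_zero, Fin.snoc_castSucc, Fin.snoc_last,
        Fin.succ_inj, Fin.castSucc_inj, ← prod_erase_eq_prod_ite, (Fin.succ_ne_zero _).symm,
        (Fin.castSucc_lt_last _).ne', if_false, hPa]
      have hsq := mul_pos (hw k) (mul_self_pos.2 (prod_erase_sub_ne_zero ha.injective k))
      have hlin : 0 < (a k - -T) * (T - a k) :=
        mul_pos (by linarith [(hTa k).2]) (by linarith [(hTa k).1])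
      have := mul_pos hsq hlin
      linarith
  have hab : Interlace a b := fun i => by
    have h1 := (hb i.castSucc).1.2
    have h2 := (hb i.succ).1.1
    rw [← Fin.succ_castSucc] at h2
    simp only [hy, Fin.cons_succ, Fin.snoc_castSucc] at h1 h2
    exact ⟨h1, h2⟩
  have hPb : ∏ j, (X - C (b j)) = P := by
    have hlt : (N : WithBot ℕ) < (N + 1 : ℕ) := WithBot.coe_lt_coe.2 N.lt_succ_self
    have hA : ((X - C c) * ∏ i, (X - C (a i))).degree = ((N + 1 : ℕ) : WithBot ℕ) := by
      rw [degree_mul, degree_X_sub_C, degree_prod_X_sub_C, add_comm]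
      rfl
    have hQ : (partialFractionNum a w).degree < ((X - C c) * ∏ i, (X - C (a i))).degree := by
      rw [hA]
      exact (degree_partialFractionNum_lt a w).trans hlt
    refine eq_of_degree_le_of_eval_index_eq (s := univ) (v := b)
      hab.strictMono_right.injective.injOn ?_ ?_ ?_ fun j _ => ?_
    · rw [degree_prod_X_sub_C]
      simp
    · rw [degree_prod_X_sub_C, hP, degree_sub_eq_left_of_degree_lt hQ, hA]
    · rw [hP, leadingCoeff_sub_of_degree_lt hQ, leadingCoeff_mul, leadingCoeff_X_sub_C, one_mul]
      exact (monic_prod_X_sub_C _ _).leadingCoeff.trans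
        (monic_prod_X_sub_C _ _).leadingCoeff.symm
    · rw [(hb j).2, eval_prod, prod_eq_zero (mem_univ j) (by simp)]
  refine ⟨b, hab, (sum_eq_of_partialFraction hPb).1.symm, fun i => ?_⟩
  have h := congrArg (eval (a i)) hPb
  rw [hPa, eval_prod] at h
  simp only [eval_sub, eval_X, eval_C] at h
  rw [nodalResidue, h, neg_div, neg_neg,
    mul_div_cancel_right₀ _ (prod_erase_sub_ne_zero ha.injective i)]

end Polynomial

lemma hasFDerivAt_prod_sub {ι : Type*} [Fintype ι] (r : ℝ) (y : ι → ℝ)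
    (h : ∀ j, y j ≠ r) :
    HasFDerivAt (fun y : ι → ℝ => ∏ j, (r - y j))
      (∑ j, ((∏ k, (r - y k)) * -(r - y j)⁻¹) • ContinuousLinearMap.proj (R := ℝ)
        (φ := fun _ : ι => ℝ) j) y := by
  classical
  have hd := HasFDerivAt.finsetProd (u := univ) (x := y) (g := fun j (y : ι → ℝ) => r - y j)
    fun j _ => (hasFDerivAt_apply (𝕜 := ℝ) j y).const_sub r
  convert! hd using 1
  refine sum_congr rfl fun j _ => ?_
  rw [← mul_prod_erase univ _ (mem_univ j), smul_neg, ← neg_smul]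
  congr 1
  have := sub_ne_zero.2 (h j).symm
  field_simp

lemma hasFDerivAt_nodalResidue {n m : ℕ} (x : Fin n → ℝ) (y : Fin m → ℝ) (i : Fin n)
    (h : ∀ j, y j ≠ x i) :
    HasFDerivAt (fun y : Fin m → ℝ => nodalResidue x y i)
      (∑ j, (nodalResidue x y i * -(x i - y j)⁻¹) • ContinuousLinearMap.proj (R := ℝ)
        (φ := fun _ : Fin m => ℝ) j) y := by
  have hd := (hasFDerivAt_prod_sub (x i) y h).mul_const (∏ k ∈ univ.erase i, (x i - x k))⁻¹
  simp only [← div_eq_mul_inv] at hd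
  convert! hd using 1
  rw [smul_sum]
  refine sum_congr rfl fun j _ => ?_
  rw [smul_smul, nodalResidue]
  congr 1
  ring

lemma hasFDerivAt_toLin' {n : ℕ} {F : (Fin n → ℝ) → Fin n → ℝ} {M : Matrix (Fin n) (Fin n) ℝ}
    {x : Fin n → ℝ}
    (h : ∀ i, HasFDerivAt (fun x => F x i)
      (∑ j, M i j • ContinuousLinearMap.proj (R := ℝ) (φ := fun _ : Fin n => ℝ) j) x) :
    HasFDerivAt F (LinearMap.toContinuousLinearMap (Matrix.toLin' M)) x := by
  refine hasFDerivAt_pi'.2 fun i => ?_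
  convert! h i using 1
  ext v
  simp [Matrix.mulVec, dotProduct]

/-- The coefficients of `∏ (X - b j) / ∏ (X - a i) = X - c - ∑ w i / (X - a i)` as a function of
`b`. -/
noncomputable def partialFractionMap {N : ℕ} (a : Fin N → ℝ) (b : Fin (N + 1) → ℝ) :
    Fin (N + 1) → ℝ :=
  Fin.cons (∑ j, b j - ∑ i, a i) fun i => -nodalResidue a b i

noncomputable def partialFractionJacobian {N : ℕ} (a : Fin N → ℝ) (b : Fin (N + 1) → ℝ) :
    Matrix (Fin (N + 1)) (Fin (N + 1)) ℝ :=
  Matrix.diagonal (Fin.cons 1 fun i => -nodalResidue a b i) * borderedCauchy a b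

lemma Interlace.hasFDerivAt_partialFractionMap {N : ℕ} {a : Fin N → ℝ} {b : Fin (N + 1) → ℝ}
    (h : Interlace a b) :
    HasFDerivAt (partialFractionMap a)
      (LinearMap.toContinuousLinearMap (Matrix.toLin' (partialFractionJacobian a b))) b := by
  refine hasFDerivAt_toLin' fun i => ?_
  refine Fin.cases ?_ (fun i => ?_) i
  · simp only [partialFractionMap, Fin.cons_zero, partialFractionJacobian, Matrix.diagonal_mul,
      borderedCauchy, Matrix.of_apply, mul_one, one_smul]
    exact (HasFDerivAt.fun_sum fun j _ => hasFDerivAt_apply (𝕜 := ℝ) j b).sub_const _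
  · simp only [partialFractionMap, Fin.cons_succ, partialFractionJacobian, Matrix.diagonal_mul,
      borderedCauchy, Matrix.of_apply]
    convert! (hasFDerivAt_nodalResidue a b i (h.ne i)).neg using 1
    rw [← sum_neg_distrib]
    refine sum_congr rfl fun j _ => ?_
    rw [← neg_smul, ← neg_sub (a i) (b j), inv_neg, neg_mul]

lemma Interlace.abs_det_partialFractionJacobian {N : ℕ} {a : Fin N → ℝ} {b : Fin (N + 1) → ℝ}
    (h : Interlace a b) :
    |(partialFractionJacobian a b).det|
      = (∏ i, -nodalResidue a b i)
        * (vandermonde N a * vandermonde (N + 1) b / crossProd a b) := by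
  rw [partialFractionJacobian, Matrix.det_mul, Matrix.det_diagonal, Fin.prod_univ_succ, abs_mul,
    abs_det_borderedCauchy h.strictMono_left h.strictMono_right h.ne]
  simp only [Fin.cons_zero, Fin.cons_succ, one_mul]
  rw [abs_of_pos (prod_pos fun i _ => neg_pos.2 (h.nodalResidue_left_neg i))]

/-- The residues of `W * ∏ (X - a j) / ∏ (X - b i)` as a function of `u = (W, a)`. -/
noncomputable def residueMap {N : ℕ} (b : Fin (N + 1) → ℝ) (u : Fin (N + 1) → ℝ) :
    Fin (N + 1) → ℝ :=
  fun i => u 0 * nodalResidue b (Fin.tail u) i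

noncomputable def residueJacobian {N : ℕ} (b : Fin (N + 1) → ℝ) (u : Fin (N + 1) → ℝ) :
    Matrix (Fin (N + 1)) (Fin (N + 1)) ℝ :=
  Matrix.diagonal (residueMap b u) * (borderedCauchy (Fin.tail u) b).transpose
    * Matrix.diagonal (Fin.cons (u 0)⁻¹ fun _ => -1)

lemma Interlace.hasFDerivAt_residueMap {N : ℕ} {b u : Fin (N + 1) → ℝ}
    (h : Interlace (Fin.tail u) b) (hu : u 0 ≠ 0) :
    HasFDerivAt (residueMap b)
      (LinearMap.toContinuousLinearMap (Matrix.toLin' (residueJacobian b u))) u := by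
  refine hasFDerivAt_toLin' fun i => ?_
  have htail : HasFDerivAt (fun u : Fin (N + 1) → ℝ => Fin.tail u)
      (ContinuousLinearMap.pi fun j : Fin N => ContinuousLinearMap.proj (R := ℝ)
        (φ := fun _ : Fin (N + 1) => ℝ) j.succ) u :=
    hasFDerivAt_pi.2 fun j => hasFDerivAt_apply (𝕜 := ℝ) j.succ u
  have hd := (hasFDerivAt_apply (𝕜 := ℝ) (0 : Fin (N + 1)) u).mul
    ((hasFDerivAt_nodalResidue b (Fin.tail u) i fun j => (h.ne j i).symm).comp u htail)
  convert! hd using 1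
  ext v
  simp only [residueJacobian, residueMap, Matrix.mul_diagonal, Matrix.diagonal_mul,
    borderedCauchy, Matrix.transpose_apply, Matrix.of_apply, Fin.sum_univ_succ, Fin.cons_zero,
    Fin.cons_succ, mul_one, Function.comp_apply]
  simp only [mul_neg, mul_one]
  simp [mul_sum]
  rw [add_comm, mul_right_comm (u 0), mul_inv_cancel₀ hu, one_mul]
  simp only [mul_assoc]

lemma Interlace.abs_det_residueJacobian {N : ℕ} {b u : Fin (N + 1) → ℝ}
    (h : Interlace (Fin.tail u) b) (hu : 0 < u 0) :
    |(residueJacobian b u).det|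
      = (∏ i, residueMap b u i)
        * (vandermonde N (Fin.tail u) * vandermonde (N + 1) b / crossProd (Fin.tail u) b)
        / u 0 := by
  rw [residueJacobian, Matrix.det_mul, Matrix.det_mul, Matrix.det_diagonal, Matrix.det_diagonal,
    Fin.prod_univ_succ (n := N) (f := Fin.cons (u 0)⁻¹ fun _ => -1), abs_mul, abs_mul,
    Matrix.det_transpose, abs_det_borderedCauchy h.strictMono_left h.strictMono_right h.ne]
  simp only [Fin.cons_zero, Fin.cons_succ, abs_mul, prod_const, abs_pow, abs_neg, abs_one, one_pow,
    mul_one]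
  rw [abs_of_pos (show 0 < ∏ i, residueMap b u i from
      prod_pos fun i _ => mul_pos hu (h.nodalResidue_right_pos i)),
    abs_of_pos (inv_pos.2 hu), div_eq_mul_inv _ (u 0)]

open ENNReal in
lemma lintegral_fin_succ_mul {n : ℕ} {p : ℝ → ℝ≥0∞} {q : (Fin n → ℝ) → ℝ≥0∞} (hp : Measurable p)
    (hq : Measurable q) :
    ∫⁻ u : Fin (n + 1) → ℝ, p (u 0) * q (Fin.tail u) = (∫⁻ x, p x) * ∫⁻ y, q y := by
  rw [← lintegral_prod_mul hp.aemeasurable hq.aemeasurable]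
  exact (volume_preserving_piFinSuccAbove (fun _ => ℝ) 0).lintegral_comp
    (f := fun z => p z.1 * q z.2) ((hp.comp measurable_fst).mul (hq.comp measurable_snd))

open ENNReal in
lemma lintegral_fin_prod {f : ℝ → ℝ≥0∞} (hf : Measurable f) (n : ℕ) :
    ∫⁻ w : Fin n → ℝ, ∏ i, f (w i) = (∫⁻ x, f x) ^ n := by
  induction n with
  | zero => simp [lintegral_unique, volume_pi]
  | succ n ih =>
    simp_rw [Fin.prod_univ_succ]
    rw [pow_succ', ← ih]
    exact lintegral_fin_succ_mul (q := fun y => ∏ i, f (y i)) hf (by fun_prop)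

/-- The unnormalized density of the Gamma distribution with shape `s` and rate `r`. -/
noncomputable def gammaWeight (s r : ℝ) : ℝ → ENNReal :=
  (Set.Ioi 0).indicator fun x => ENNReal.ofReal (x ^ (s - 1) * Real.exp (-(r * x)))

lemma measurable_gammaWeight (s r : ℝ) : Measurable (gammaWeight s r) :=
  Measurable.indicator (by fun_prop) measurableSet_Ioi

lemma gammaWeight_of_pos (s r : ℝ) {x : ℝ} (hx : 0 < x) :
    gammaWeight s r x = ENNReal.ofReal (x ^ (s - 1) * Real.exp (-(r * x))) :=
  Set.indicator_of_mem hx _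

lemma lintegral_gammaWeight {s r : ℝ} (hs : 0 < s) (hr : 0 < r) :
    ∫⁻ x, gammaWeight s r x = ENNReal.ofReal ((1 / r) ^ s * Real.Gamma s) := by
  have h := Real.integral_rpow_mul_exp_neg_mul_Ioi hs hr
  rw [gammaWeight, lintegral_indicator measurableSet_Ioi, ← h,
    ofReal_integral_eq_lintegral_ofReal]
  · refine Integrable.of_integral_ne_zero (h.trans_ne ?_)
    have := Real.Gamma_pos_of_pos hs
    positivity
  · filter_upwards [ae_restrict_mem measurableSet_Ioi] with x hx
    exact mul_nonneg (Real.rpow_nonneg (le_of_lt hx) _) (Real.exp_pos _).le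

lemma lintegral_gammaWeight_half {r : ℝ} (hr : 0 < r) :
    ∫⁻ x, gammaWeight (1 / 2) r x = ENNReal.ofReal (√(Real.pi / r)) := by
  rw [lintegral_gammaWeight one_half_pos hr, Real.Gamma_one_half_eq, ← Real.sqrt_eq_rpow,
    ← Real.sqrt_mul (by positivity), one_div_mul_eq_div]

lemma prod_gammaWeight {n : ℕ} (s r : ℝ) {w : Fin n → ℝ} (hw : ∀ i, 0 < w i) :
    ∏ i, gammaWeight s r (w i)
      = ENNReal.ofReal ((∏ i, w i) ^ (s - 1) * Real.exp (-(r * ∑ i, w i))) := by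
  simp_rw [gammaWeight_of_pos s r (hw _)]
  rw [← ENNReal.ofReal_prod_of_nonneg fun i _ =>
      mul_nonneg (Real.rpow_nonneg (hw i).le _) (Real.exp_pos _).le, prod_mul_distrib,
    Real.finsetProd_rpow _ _ fun i _ => (hw i).le, ← Real.exp_sum, sum_neg_distrib, mul_sum]

lemma pos_of_prod_gammaWeight_ne_zero {n : ℕ} {s r : ℝ} {w : Fin n → ℝ}
    (h : ∏ i, gammaWeight s r (w i) ≠ 0) (i : Fin n) : 0 < w i :=
  Set.mem_of_indicator_ne_zero (prod_ne_zero_iff.1 h i (mem_univ i))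

lemma lintegral_exp_neg_sq_div {t : ℝ} (ht : 0 < t) :
    ∫⁻ x : ℝ, ENNReal.ofReal (Real.exp (-x ^ 2 / (2 * t)))
      = ENNReal.ofReal (√(2 * Real.pi * t)) := by
  have h := integral_gaussian (1 / (2 * t))
  have hi := integrable_exp_neg_mul_sq (b := 1 / (2 * t)) (by positivity)
  have e : ∀ x : ℝ, -x ^ 2 / (2 * t) = -(1 / (2 * t)) * x ^ 2 := fun x => by ring
  simp_rw [e]
  rw [← ofReal_integral_eq_lintegral_ofReal hi (Filter.Eventually.of_forall fun _ =>
    (Real.exp_pos _).le), h]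
  congr 2
  field_simp

open ENNReal in
lemma setLIntegral_eq_lintegral_of_ne_zero {α : Type*} [MeasurableSpace α] {μ : Measure α}
    {s : Set α} (hs : MeasurableSet s) {f : α → ℝ≥0∞} (hf : ∀ x, f x ≠ 0 → x ∈ s) :
    ∫⁻ x in s, f x ∂μ = ∫⁻ x, f x ∂μ := by
  rw [← lintegral_indicator hs, Set.indicator_eq_self.2 fun x hx => hf x hx]

lemma measurable_vandermonde (N : ℕ) : Measurable (vandermonde N) := by
  unfold vandermonde
  fun_prop

lemma measurable_crossProd {N M : ℕ} :
    Measurable fun z : (Fin N → ℝ) × (Fin M → ℝ) => crossProd z.1 z.2 := by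
  unfold crossProd
  fun_prop

lemma measurableSet_interlace {N : ℕ} :
    MeasurableSet {z : (Fin N → ℝ) × (Fin (N + 1) → ℝ) | Interlace z.1 z.2} := by
  unfold Interlace
  refine MeasurableSet.congr (s := ⋂ i : Fin N, {z : (Fin N → ℝ) × (Fin (N + 1) → ℝ) |
    z.2 i.castSucc < z.1 i} ∩ {z | z.1 i < z.2 i.succ}) ?_ (by ext; simp)
  exact MeasurableSet.iInter fun i => (measurableSet_lt (by fun_prop) (by fun_prop)).inter
    (measurableSet_lt (by fun_prop) (by fun_prop))

lemma measurableSet_interlace_right {N : ℕ} (a : Fin N → ℝ) :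
    MeasurableSet {b | Interlace a b} :=
  measurable_prodMk_left measurableSet_interlace

lemma measurableSet_interlace_left {N : ℕ} (b : Fin (N + 1) → ℝ) :
    MeasurableSet {a | Interlace a b} :=
  measurable_prodMk_right measurableSet_interlace

lemma rpow_half_sub_one_mul_self {x : ℝ} (hx : 0 < x) : x ^ ((1 : ℝ) / 2 - 1) * x = √x := by
  rw [← Real.rpow_add_one hx.ne', Real.sqrt_eq_rpow]
  norm_num

namespace Interlace

variable {N : ℕ} {a : Fin N → ℝ} {b : Fin (N + 1) → ℝ}

lemma vandermonde_left_pos (h : Interlace a b) : 0 < vandermonde N a :=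
  vandermonde_pos h.strictMono_left

lemma vandermonde_right_pos (h : Interlace a b) : 0 < vandermonde (N + 1) b :=
  vandermonde_pos h.strictMono_right

lemma prod_neg_nodalResidue_left (h : Interlace a b) :
    ∏ i, -nodalResidue a b i = crossProd a b / vandermonde N a ^ 2 := by
  rw [crossProd_comm, ← prod_abs_nodalResidue]
  exact prod_congr rfl fun i _ => (abs_of_neg (h.nodalResidue_left_neg i)).symm

lemma prod_nodalResidue_right (h : Interlace a b) :
    ∏ i, nodalResidue b a i = crossProd a b / vandermonde (N + 1) b ^ 2 := by
  rw [← prod_abs_nodalResidue]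
  exact prod_congr rfl fun i _ => (abs_of_pos (h.nodalResidue_right_pos i)).symm

end Interlace

lemma injOn_partialFractionMap {N : ℕ} (a : Fin N → ℝ) :
    Set.InjOn (partialFractionMap a) {b | Interlace a b} := by
  intro b hb b' hb' h
  refine eq_of_nodalResidue_eq hb hb' ?_ fun i => ?_
  · exact sub_left_injective (congrFun h 0)
  · exact neg_injective (congrFun h i.succ)

lemma image_partialFractionMap {N : ℕ} {a : Fin N → ℝ} (ha : StrictMono a) :
    partialFractionMap a '' {b | Interlace a b} = {v | ∀ i, 0 < Fin.tail v i} := by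
  ext v
  refine ⟨?_, fun hv => ?_⟩
  · rintro ⟨b, hb, rfl⟩ i
    exact neg_pos.2 (hb.nodalResidue_left_neg i)
  · obtain ⟨b, hb, h0, hs⟩ := exists_interlace_nodalResidue_eq ha (v 0) hv
    refine ⟨b, hb, funext fun i => ?_⟩
    exact Fin.cases h0 hs i

lemma injOn_residueMap {N : ℕ} (b : Fin (N + 1) → ℝ) :
    Set.InjOn (residueMap b) {u | 0 < u 0 ∧ Interlace (Fin.tail u) b} := by
  intro u hu u' hu' h
  obtain ⟨h0, hs⟩ := eq_of_mul_nodalResidue_eq hu.2 hu'.2 hu.1.ne' (congrFun h)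
  rw [← Fin.cons_self_tail u, ← Fin.cons_self_tail u', h0, hs]

lemma image_residueMap {N : ℕ} {b : Fin (N + 1) → ℝ} (hb : StrictMono b) :
    residueMap b '' {u | 0 < u 0 ∧ Interlace (Fin.tail u) b} = {w | ∀ i, 0 < w i} := by
  ext w
  refine ⟨?_, fun hw => ?_⟩
  · rintro ⟨u, hu, rfl⟩ i
    exact mul_pos hu.1 (hu.2.nodalResidue_right_pos i)
  · obtain ⟨a, ha, h⟩ := exists_interlace_mul_nodalResidue_eq hb hw
    refine ⟨Fin.cons (∑ k, w k) a, ⟨sum_pos (fun k _ => hw k) univ_nonempty, ?_⟩, funext h⟩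
    simpa using ha

open ENNReal in
/-- The Dixon–Anderson type integral over the larger interlacing configuration. -/
lemma lintegral_interlace_right {N : ℕ} {a : Fin N → ℝ} (ha : StrictMono a) {t : ℝ} (ht : 0 < t) :
    ∫⁻ b in {b | Interlace a b}, ENNReal.ofReal
        (vandermonde (N + 1) b / √(crossProd a b) * Real.exp (-(∑ j, b j ^ 2) / (2 * t)))
      = ENNReal.ofReal (Real.exp (-(∑ i, a i ^ 2) / (2 * t)))
        * (ENNReal.ofReal (√(2 * Real.pi * t)) * ENNReal.ofReal (√(Real.pi * t)) ^ N) := by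
  have hs := measurableSet_interlace_right a
  have hcov := lintegral_image_eq_lintegral_abs_det_fderiv_mul volume hs
    (fun b hb => (Interlace.hasFDerivAt_partialFractionMap hb).hasFDerivWithinAt)
    (injOn_partialFractionMap a) fun v => ENNReal.ofReal (Real.exp (-v 0 ^ 2 / (2 * t)))
      * ∏ i, gammaWeight (1 / 2) (1 / t) (Fin.tail v i)
  have hm : Measurable fun y : Fin N → ℝ => ∏ i, gammaWeight (1 / 2) (1 / t) (y i) :=
    Finset.measurable_fun_prod _ fun i _ =>
      (measurable_gammaWeight (1 / 2) (1 / t)).comp (measurable_pi_apply i)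
  rw [image_partialFractionMap ha, setLIntegral_eq_lintegral_of_ne_zero
      (s := {v : Fin (N + 1) → ℝ | ∀ i, 0 < Fin.tail v i}) ?_ ?_,
    lintegral_fin_succ_mul (p := fun x => ENNReal.ofReal (Real.exp (-x ^ 2 / (2 * t))))
      (by fun_prop) hm, lintegral_exp_neg_sq_div ht,
    lintegral_fin_prod (measurable_gammaWeight _ _), lintegral_gammaWeight_half (by positivity),
    div_div_eq_mul_div, div_one] at hcov
  · rw [hcov, ← lintegral_const_mul' _ _ ENNReal.ofReal_ne_top]
    refine setLIntegral_congr_fun hs fun b hb => ?_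
    have hb : Interlace a b := hb
    have hV := hb.vandermonde_left_pos
    have hX := hb.crossProd_pos
    have hw : ∀ i, 0 < -nodalResidue a b i := fun i => neg_pos.2 (hb.nodalResidue_left_neg i)
    have hP : 0 < ∏ i, -nodalResidue a b i := prod_pos fun i _ => hw i
    have htail : Fin.tail (partialFractionMap a b) = fun i => -nodalResidue a b i := rfl
    have h0 : partialFractionMap a b 0 = ∑ j, b j - ∑ i, a i := rfl
    rw [htail, h0, prod_gammaWeight _ _ hw, ContinuousLinearMap.det,
      LinearMap.coe_toContinuousLinearMap, LinearMap.det_toLin',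
      hb.abs_det_partialFractionJacobian,
      ← ENNReal.ofReal_mul (Real.exp_pos _).le, ← ENNReal.ofReal_mul,
      ← ENNReal.ofReal_mul (Real.exp_pos _).le]
    · congr 1
      have he : Real.exp (-(∑ j, b j ^ 2) / (2 * t)) = Real.exp (-(∑ i, a i ^ 2) / (2 * t))
          * Real.exp (-(∑ j, b j - ∑ i, a i) ^ 2 / (2 * t))
          * Real.exp (-(1 / t * ∑ i, -nodalResidue a b i)) := by
        rw [← Real.exp_add, ← Real.exp_add,
          sum_sq_eq_of_nodalResidue hb.strictMono_left.injective b]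
        congr 1
        field_simp
        ring
      have hr : (∏ i, -nodalResidue a b i) ^ ((1 : ℝ) / 2 - 1) * (∏ i, -nodalResidue a b i)
          = √(crossProd a b) / vandermonde N a := by
        rw [rpow_half_sub_one_mul_self hP, hb.prod_neg_nodalResidue_left, Real.sqrt_div hX.le,
          Real.sqrt_sq hV.le]
      have hq : vandermonde (N + 1) b / √(crossProd a b) = √(crossProd a b) / vandermonde N a
          * (vandermonde N a * vandermonde (N + 1) b / crossProd a b) := by
        have := Real.sqrt_pos.2 hX
        nth_rw 3 [← Real.mul_self_sqrt hX.le]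
        field_simp
      rw [he, hq, ← hr]
      ring
    · rw [← hb.abs_det_partialFractionJacobian]
      exact abs_nonneg _
  · exact MeasurableSet.congr (s := ⋂ i : Fin N, {v : Fin (N + 1) → ℝ | 0 < v i.succ})
      (MeasurableSet.iInter fun i => measurableSet_lt measurable_const (measurable_pi_apply _))
      (by ext; simp [Fin.tail])
  · exact fun v hv => pos_of_prod_gammaWeight_ne_zero (right_ne_zero_of_mul hv)

/-- The Dixon–Anderson integral over the smaller interlacing configuration. -/
lemma lintegral_interlace_left {N : ℕ} {b : Fin (N + 1) → ℝ} (hb : StrictMono b) :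
    ENNReal.ofReal (Real.Gamma ((N + 1) / 2)) * ∫⁻ a in {a | Interlace a b},
        ENNReal.ofReal (vandermonde N a / √(crossProd a b))
      = ENNReal.ofReal (√Real.pi) ^ (N + 1) := by
  have hI := measurableSet_interlace_left b
  have htail : Measurable fun u : Fin (N + 1) → ℝ => Fin.tail u :=
    measurable_pi_iff.2 fun i => measurable_pi_apply i.succ
  have hs : MeasurableSet {u : Fin (N + 1) → ℝ | 0 < u 0 ∧ Interlace (Fin.tail u) b} :=
    (measurableSet_lt measurable_const (measurable_pi_apply 0)).inter (htail hI)
  have hcov := lintegral_image_eq_lintegral_abs_det_fderiv_mul volume hs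
    (fun u hu => (hu.2.hasFDerivAt_residueMap hu.1.ne').hasFDerivWithinAt)
    (injOn_residueMap b) fun w => ∏ i, gammaWeight (1 / 2) 1 (w i)
  have hq : Measurable ({a | Interlace a b}.indicator fun a =>
      ENNReal.ofReal (vandermonde N a / √(crossProd a b))) := by
    refine Measurable.indicator (ENNReal.measurable_ofReal.comp ?_) hI
    exact (measurable_vandermonde N).div
      (measurable_crossProd.comp measurable_prodMk_right).sqrt
  have hΓ := lintegral_gammaWeight (s := (N + 1) / 2) (r := 1) (by positivity) one_pos
  rw [div_one, Real.one_rpow, one_mul] at hΓ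
  rw [image_residueMap hb, setLIntegral_eq_lintegral_of_ne_zero
      (s := {w : Fin (N + 1) → ℝ | ∀ i, 0 < w i}) ?_ ?_,
    lintegral_fin_prod (measurable_gammaWeight _ _), lintegral_gammaWeight_half one_pos,
    div_one] at hcov
  · rw [hcov, ← hΓ, ← lintegral_indicator hI,
      ← lintegral_fin_succ_mul (measurable_gammaWeight _ _) hq,
      ← setLIntegral_eq_lintegral_of_ne_zero hs]
    · refine setLIntegral_congr_fun hs fun u hu => ?_
      obtain ⟨hW, h⟩ : 0 < u 0 ∧ Interlace (Fin.tail u) b := hu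
      have hV := h.vandermonde_right_pos
      have hX := h.crossProd_pos
      have hw : ∀ i, 0 < residueMap b u i := fun i => mul_pos hW (h.nodalResidue_right_pos i)
      have hP : 0 < ∏ i, residueMap b u i := prod_pos fun i _ => hw i
      have hsum : ∑ i, residueMap b u i = u 0 := by
        simp only [residueMap]
        rw [← mul_sum, sum_nodalResidue _ hb.injective, mul_one]
      have hprod : ∏ i, residueMap b u i
          = u 0 ^ (N + 1) * (crossProd (Fin.tail u) b / vandermonde (N + 1) b ^ 2) := by
        simp only [residueMap]
        rw [prod_mul_distrib, h.prod_nodalResidue_right, prod_const, card_univ, Fintype.card_fin]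
      rw [gammaWeight_of_pos _ _ hW,
        Set.indicator_of_mem (show Fin.tail u ∈ {a | Interlace a b} from h),
        prod_gammaWeight _ _ hw, ContinuousLinearMap.det,
        LinearMap.coe_toContinuousLinearMap, LinearMap.det_toLin', ← ENNReal.ofReal_mul,
        ← ENNReal.ofReal_mul (abs_nonneg _), h.abs_det_residueJacobian hW, hsum]
      · congr 1
        have hr : (∏ i, residueMap b u i) ^ ((1 : ℝ) / 2 - 1) * (∏ i, residueMap b u i)
            = u 0 ^ (((N : ℝ) + 1) / 2 - 1) * u 0
              * (√(crossProd (Fin.tail u) b) / vandermonde (N + 1) b) := by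
          rw [rpow_half_sub_one_mul_self hP, hprod, Real.sqrt_mul (by positivity),
            Real.sqrt_div hX.le, Real.sqrt_sq hV.le, ← Real.rpow_add_one hW.ne', sub_add_cancel,
            Real.sqrt_eq_rpow, ← Real.rpow_natCast_mul hW.le]
          push_cast
          ring_nf
        have hq : vandermonde N (Fin.tail u) / √(crossProd (Fin.tail u) b)
            = √(crossProd (Fin.tail u) b) / vandermonde (N + 1) b
            * (vandermonde N (Fin.tail u) * vandermonde (N + 1) b / crossProd (Fin.tail u) b) := by
          have := Real.sqrt_pos.2 hX
          nth_rw 3 [← Real.mul_self_sqrt hX.le]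
          field_simp
        rw [mul_right_comm, ← div_eq_iff hW.ne'] at hr
        rw [hq]
        linear_combination -Real.exp (-(1 * u 0)) * (vandermonde N (Fin.tail u)
          * vandermonde (N + 1) b / crossProd (Fin.tail u) b) * hr
      · exact mul_nonneg (Real.rpow_nonneg hW.le _) (Real.exp_pos _).le
    · exact fun u hu => ⟨Set.mem_of_indicator_ne_zero (left_ne_zero_of_mul hu),
        Set.mem_of_indicator_ne_zero (right_ne_zero_of_mul hu)⟩
  · exact MeasurableSet.congr (s := ⋂ i : Fin (N + 1), {v : Fin (N + 1) → ℝ | 0 < v i})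
      (MeasurableSet.iInter fun i => measurableSet_lt measurable_const (measurable_pi_apply _))
      (by ext; simp)
  · exact fun w hw => pos_of_prod_gammaWeight_ne_zero hw

lemma mem_weyl_iff {N : ℕ} {x : Fin N → ℝ} : x ∈ Weyl N ↔ StrictMono x :=
  ⟨fun h _ _ hij => h _ _ hij, fun h _ _ hij => h hij⟩

lemma measurableSet_weyl (N : ℕ) : MeasurableSet (Weyl N) := by
  have : Weyl N = ⋂ i : Fin N, ⋂ j : Fin N, ⋂ _ : i < j, {x : Fin N → ℝ | x i < x j} := by
    ext x
    simp [Weyl]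
  rw [this]
  exact MeasurableSet.iInter fun i => MeasurableSet.iInter fun j => MeasurableSet.iInter fun _ =>
    measurableSet_lt (measurable_pi_apply i) (measurable_pi_apply j)

/-- The Gaussian weight times the Vandermonde product. -/
noncomputable def goeWeight (t : ℝ) {N : ℕ} (x : Fin N → ℝ) : ℝ :=
  vandermonde N x * Real.exp (-(∑ i, x i ^ 2) / (2 * t))

lemma measurable_goeWeight (t : ℝ) (N : ℕ) : Measurable fun x : Fin N → ℝ => goeWeight t x :=
  (measurable_vandermonde N).mul (by fun_prop)

lemma goeWeight_nonneg (t : ℝ) {N : ℕ} {x : Fin N → ℝ} (hx : x ∈ Weyl N) : 0 ≤ goeWeight t x :=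
  mul_nonneg (vandermonde_pos (mem_weyl_iff.1 hx)).le (Real.exp_pos _).le

lemma lintegral_goeWeight_succ (N : ℕ) {t : ℝ} (ht : 0 < t) :
    (∫⁻ x in Weyl (N + 1), ENNReal.ofReal (goeWeight t x)) * ENNReal.ofReal (√Real.pi) ^ (N + 1)
      = ENNReal.ofReal (Real.Gamma ((N + 1) / 2))
        * ((∫⁻ x in Weyl N, ENNReal.ofReal (goeWeight t x))
          * (ENNReal.ofReal (√(2 * Real.pi * t)) * ENNReal.ofReal (√(Real.pi * t)) ^ N)) := by
  set K : (Fin N → ℝ) → (Fin (N + 1) → ℝ) → ENNReal := fun a b =>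
    {z : (Fin N → ℝ) × (Fin (N + 1) → ℝ) | Interlace z.1 z.2}.indicator (fun z =>
      ENNReal.ofReal (goeWeight t z.2) * ENNReal.ofReal (vandermonde N z.1 / √(crossProd z.1 z.2)))
      (a, b) with hK
  have hKm : Measurable (Function.uncurry K) := by
    have h1 := ((measurable_goeWeight t (N + 1)).comp
      (measurable_snd : Measurable fun z : (Fin N → ℝ) × (Fin (N + 1) → ℝ) => z.2)).ennreal_ofReal
    have h2 := (((measurable_vandermonde N).comp measurable_fst).div
      (measurable_crossProd (N := N) (M := N + 1)).sqrt).ennreal_ofReal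
    exact (h1.mul h2).indicator measurableSet_interlace
  have hK1 : ∀ b, ∫⁻ a, K a b = ENNReal.ofReal (goeWeight t b)
      * ∫⁻ a in {a | Interlace a b}, ENNReal.ofReal (vandermonde N a / √(crossProd a b)) := by
    intro b
    rw [← lintegral_const_mul' _ _ ENNReal.ofReal_ne_top,
      ← lintegral_indicator (measurableSet_interlace_left b)]
    rfl
  have hK2 : ∀ a, ∫⁻ b, K a b = ∫⁻ b in {b | Interlace a b}, ENNReal.ofReal (goeWeight t b)
      * ENNReal.ofReal (vandermonde N a / √(crossProd a b)) := by
    intro a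
    rw [← lintegral_indicator (measurableSet_interlace_right a)]
    rfl
  have hswap := lintegral_lintegral_swap (μ := volume) (ν := volume) hKm.aemeasurable
  have hleft : ∫⁻ a, ∫⁻ b, K a b = (∫⁻ x in Weyl N, ENNReal.ofReal (goeWeight t x))
      * (ENNReal.ofReal (√(2 * Real.pi * t)) * ENNReal.ofReal (√(Real.pi * t)) ^ N) := by
    rw [← setLIntegral_eq_lintegral_of_ne_zero (measurableSet_weyl N),
      ← lintegral_mul_const _ (measurable_goeWeight t N).ennreal_ofReal]
    · refine setLIntegral_congr_fun (measurableSet_weyl N) fun a ha => ?_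
      have ha := mem_weyl_iff.1 ha
      have hV := vandermonde_pos ha
      rw [hK2, goeWeight, ENNReal.ofReal_mul hV.le, mul_assoc, ← lintegral_interlace_right ha ht,
        ← lintegral_const_mul' _ _ ENNReal.ofReal_ne_top]
      refine setLIntegral_congr_fun (measurableSet_interlace_right a) fun b hb => ?_
      have hb : Interlace a b := hb
      have hVb := hb.vandermonde_right_pos
      rw [← ENNReal.ofReal_mul hV.le,
        ← ENNReal.ofReal_mul (goeWeight_nonneg t (mem_weyl_iff.2 hb.strictMono_right)), goeWeight]
      congr 1
      ring
    · intro a ha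
      by_contra hna
      refine ha ((lintegral_congr fun b => ?_).trans lintegral_zero)
      exact Set.indicator_of_notMem
        (fun h : Interlace a b => hna (mem_weyl_iff.2 h.strictMono_left)) _
  have hright : ENNReal.ofReal (Real.Gamma ((N + 1) / 2)) * ∫⁻ b, ∫⁻ a, K a b
      = (∫⁻ x in Weyl (N + 1), ENNReal.ofReal (goeWeight t x))
        * ENNReal.ofReal (√Real.pi) ^ (N + 1) := by
    rw [← setLIntegral_eq_lintegral_of_ne_zero (measurableSet_weyl (N + 1)),
      ← lintegral_mul_const _ (measurable_goeWeight t _).ennreal_ofReal,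
      ← lintegral_const_mul' _ _ ENNReal.ofReal_ne_top]
    · refine setLIntegral_congr_fun (measurableSet_weyl (N + 1)) fun b hb => ?_
      rw [hK1, ← lintegral_interlace_left (mem_weyl_iff.1 hb), mul_left_comm]
    · intro b hb
      by_contra hnb
      refine hb ((lintegral_congr fun a => ?_).trans lintegral_zero)
      exact Set.indicator_of_notMem
        (fun h : Interlace a b => hnb (mem_weyl_iff.2 h.strictMono_right)) _
  rw [← hright, ← hleft, hswap]

lemma lintegral_goeWeight (N : ℕ) {t : ℝ} (ht : 0 < t) :
    ∫⁻ x in Weyl N, ENNReal.ofReal (goeWeight t x)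
      = ENNReal.ofReal (t ^ ((N : ℝ) * (N + 1) / 4)
        * ((2 : ℝ) ^ ((N : ℝ) / 2) * ∏ j ∈ range N, Real.Gamma ((j + 1) / 2))) := by
  induction N with
  | zero =>
    have : Weyl 0 = Set.univ := Set.eq_univ_of_forall fun x i => i.elim0
    simp [this, lintegral_unique, volume_pi, goeWeight, vandermonde]
  | succ N ih =>
    have hG : ∀ n : ℕ, 0 < Real.Gamma (((n : ℝ) + 1) / 2) := fun n =>
      Real.Gamma_pos_of_pos (by positivity)
    have hπ : ENNReal.ofReal (√Real.pi) ^ (N + 1) ≠ 0 :=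
      pow_ne_zero _ (ENNReal.ofReal_pos.2 (by positivity)).ne'
    refine (ENNReal.mul_left_inj hπ (ENNReal.pow_ne_top ENNReal.ofReal_ne_top)).1 ?_
    have hprod : 0 ≤ ∏ j ∈ range N, Real.Gamma (((j : ℝ) + 1) / 2) :=
      prod_nonneg fun j _ => (hG j).le
    have hprod' : 0 ≤ ∏ j ∈ range (N + 1), Real.Gamma (((j : ℝ) + 1) / 2) :=
      prod_nonneg fun j _ => (hG j).le
    rw [lintegral_goeWeight_succ N ht, ih, ← ENNReal.ofReal_pow (by positivity),
      ← ENNReal.ofReal_pow (by positivity), ← ENNReal.ofReal_mul (by positivity),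
      ← ENNReal.ofReal_mul (by positivity), ← ENNReal.ofReal_mul (hG N).le,
      ← ENNReal.ofReal_mul (by positivity), prod_range_succ]
    congr 1
    have ht' : t ^ (((N + 1 : ℕ) : ℝ) * ((N + 1 : ℕ) + 1) / 4)
        = t ^ ((N : ℝ) * (N + 1) / 4) * √t ^ (N + 1) := by
      rw [Real.sqrt_eq_rpow, ← Real.rpow_mul_natCast ht.le, ← Real.rpow_add ht]
      push_cast
      ring_nf
    have h2 : (2 : ℝ) ^ (((N + 1 : ℕ) : ℝ) / 2) = (2 : ℝ) ^ ((N : ℝ) / 2) * √2 := by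
      rw [Real.sqrt_eq_rpow, ← Real.rpow_add two_pos]
      push_cast
      ring_nf
    rw [ht', h2, Real.sqrt_mul (by positivity), Real.sqrt_mul (by positivity),
      Real.sqrt_mul (by positivity)]
    ring

end

/-- Normalization of the GOE eigenvalue density:
`∫_{x₁<⋯<x_N} t^{-N(N+1)/4} exp(-|x|²/(2t)) h_N(x) dx = 2^{N/2} ∏_{j=1}^N Γ(j/2)`. -/
theorem goe_eigenvalue_density_normalization (N : ℕ) (t : ℝ) (ht : 0 < t) :
    ∫ x in Weyl N,
        t ^ (-((N:ℝ) * (N + 1)) / 4) * Real.exp (-(∑ i, (x i)^2) / (2 * t)) * vandermonde N x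
      = (2:ℝ) ^ ((N:ℝ)/2) * ∏ j ∈ Finset.range N, Real.Gamma ((j + 1) / 2) := by
  have hG : 0 ≤ ∏ j ∈ Finset.range N, Real.Gamma (((j : ℝ) + 1) / 2) :=
    Finset.prod_nonneg fun j _ => (Real.Gamma_pos_of_pos (by positivity)).le
  have h : ∫ x in Weyl N, goeWeight t x = t ^ ((N : ℝ) * (N + 1) / 4)
      * ((2 : ℝ) ^ ((N : ℝ) / 2) * ∏ j ∈ Finset.range N, Real.Gamma ((j + 1) / 2)) := by
    rw [integral_eq_lintegral_of_nonneg_ae _ (measurable_goeWeight t N).aestronglyMeasurable,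
      lintegral_goeWeight N ht, ENNReal.toReal_ofReal (by positivity)]
    filter_upwards [ae_restrict_mem (measurableSet_weyl N)] with x hx using goeWeight_nonneg t hx
  calc
    _ = ∫ x in Weyl N, t ^ (-((N:ℝ) * (N + 1)) / 4) * goeWeight t x := by
      congr 1
      ext x
      rw [goeWeight]
      ring
    _ = _ := by
      rw [integral_const_mul, h, ← mul_assoc, ← Real.rpow_add ht, neg_div, neg_add_cancel,
        Real.rpow_zero, one_mul]
end

section
/- Harish-Chandra/Itzykson–Zuber formula for N = 2: for x_1 < x_2, y_1 < y_2 and σ > 0, ∫_{U(2)} exp(−(1/(2σ²)) Tr(Λ_x − U*Λ_y U)²) dU = (2πσ⁴/((x_2−x_1)(y_2−y_1))) · det_{1≤i,j≤2}[(2πσ²)^{-1/2} exp(−(x_i−y_j)²/(2σ²))], where dU is the normalized Haar measure on the unitary group U(2) and Λ_x = diag(x_1, x_2), Λ_y = diag(y_1, y_2). -/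
open MeasureTheory Matrix

noncomputable instance : MeasurableSpace (Matrix.unitaryGroup (Fin 2) ℂ) := borel _

open ProbabilityTheory

instance : BorelSpace (Matrix.unitaryGroup (Fin 2) ℂ) := ⟨rfl⟩

lemma exp_mul_le_of_abs_le {u r : ℝ} (c : ℝ) (hu : |u| ≤ r) :
    Real.exp (c * u) ≤ Real.exp (|c| * r) := by
  refine Real.exp_le_exp.2 ((le_abs_self _).trans ?_)
  rw [abs_mul]
  gcongr

/-- If the law of the planar vector `(h, w)` is invariant under rotations, then testing the
infinitesimal invariance against `w * exp (c * h)` gives a first-order identity. -/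
lemma integral_eq_zero_of_rotation_invariant {Ω : Type*} [MeasurableSpace Ω] {μ : Measure Ω}
    [IsProbabilityMeasure μ] {h w : Ω → ℝ} (hm : Measurable h) (wm : Measurable w)
    (hb : ∀ a, |h a| ≤ 1) (wb : ∀ a, |w a| ≤ 1) (c : ℝ)
    (hrot : ∀ θ : ℝ, ∫ a, (Real.cos θ * w a - Real.sin θ * h a) *
      Real.exp (c * (Real.cos θ * h a + Real.sin θ * w a)) ∂μ =
        ∫ a, w a * Real.exp (c * h a) ∂μ) :
    ∫ a, (c * w a ^ 2 - h a) * Real.exp (c * h a) ∂μ = 0 := by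
  have lin : ∀ (θ : ℝ) (p q : ℝ), |p| ≤ 1 → |q| ≤ 1 →
      |Real.cos θ * p + Real.sin θ * q| ≤ 2 := by
    intro θ p q hp hq
    calc _ ≤ |Real.cos θ * p| + |Real.sin θ * q| := abs_add_le _ _
      _ = |Real.cos θ| * |p| + |Real.sin θ| * |q| := by rw [abs_mul, abs_mul]
      _ ≤ 1 * 1 + 1 * 1 := by
        gcongr <;> first | exact Real.abs_cos_le_one θ | exact Real.abs_sin_le_one θ
      _ = 2 := by norm_num
  have key := hasDerivAt_integral_of_dominated_loc_of_deriv_le (μ := μ) (𝕜 := ℝ) (x₀ := 0)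
    (s := Set.univ) Filter.univ_mem
    (F := fun θ a => (Real.cos θ * w a - Real.sin θ * h a) *
      Real.exp (c * (Real.cos θ * h a + Real.sin θ * w a)))
    (F' := fun θ a => (-(Real.cos θ * h a + Real.sin θ * w a) +
      c * (Real.cos θ * w a - Real.sin θ * h a) ^ 2) *
      Real.exp (c * (Real.cos θ * h a + Real.sin θ * w a)))
    (bound := fun _ => (2 + |c| * 2 ^ 2) * Real.exp (|c| * 2))
    (Filter.Eventually.of_forall fun θ => by fun_prop)
    (by
      refine Integrable.of_bound (C := Real.exp |c|) (by fun_prop) (ae_of_all _ fun a => ?_)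
      simp only [Real.cos_zero, Real.sin_zero, one_mul, zero_mul, sub_zero, add_zero, norm_mul,
        Real.norm_eq_abs, Real.abs_exp]
      simpa using mul_le_mul (wb a) (exp_mul_le_of_abs_le c (hb a)) (Real.exp_pos _).le zero_le_one)
    (by fun_prop)
    (ae_of_all _ fun a θ _ => by
      have h1 := lin θ _ _ (hb a) (wb a)
      have h2 : |Real.cos θ * w a - Real.sin θ * h a| ≤ 2 := by
        simpa [sub_eq_add_neg] using lin θ (w a) (-h a) (wb a) (by simpa using hb a)
      rw [norm_mul, Real.norm_eq_abs, Real.norm_eq_abs, Real.abs_exp]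
      refine mul_le_mul ((abs_add_le _ _).trans ?_) (exp_mul_le_of_abs_le c h1)
        (Real.exp_pos _).le (by positivity)
      rw [abs_neg, abs_mul, abs_pow]
      gcongr)
    (integrable_const _)
    (ae_of_all _ fun a θ _ => by
      have hc := Real.hasDerivAt_cos θ
      have hs := Real.hasDerivAt_sin θ
      convert! ((hc.mul_const (w a)).sub (hs.mul_const (h a))).mul
        ((((hc.mul_const (h a)).add (hs.mul_const (w a))).const_mul c).exp) using 1
      simp only [Pi.add_apply, Pi.sub_apply]
      ring)
  have hd := key.2
  simp only [hrot] at hd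
  have := hd.unique (hasDerivAt_const _ _)
  rw [← this]
  refine integral_congr_ae (ae_of_all _ fun a => ?_)
  simp only [Real.cos_zero, Real.sin_zero]
  ring_nf

/-- A twice differentiable solution of `ψ'' = ψ` with `ψ 0 = 0` and `ψ' 0 = 1` is `sinh`. -/
lemma eq_sinh_of_hasDerivAt {f g : ℝ → ℝ} (hf : ∀ t, HasDerivAt f (g t) t)
    (hg : ∀ t, HasDerivAt g (f t) t) (f0 : f 0 = 0) (g0 : g 0 = 1) (t : ℝ) :
    f t = Real.sinh t := by
  have h1 : ∀ s, (f s + g s) * Real.exp (-s) = 1 := by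
    intro s
    have := is_const_of_deriv_eq_zero (f := fun s => (f s + g s) * Real.exp (-s))
      (fun s => (((hf s).add (hg s)).mul (hasDerivAt_neg s).exp).differentiableAt)
      (fun s => (((hf s).add (hg s)).mul (hasDerivAt_neg s).exp).deriv.trans (by simp; ring)) s 0
    simpa [f0, g0] using this
  have h2 : ∀ s, (f s - g s) * Real.exp s = -1 := by
    intro s
    have := is_const_of_deriv_eq_zero (f := fun s => (f s - g s) * Real.exp s)
      (fun s => (((hf s).sub (hg s)).mul (Real.hasDerivAt_exp s)).differentiableAt)
      (fun s => (((hf s).sub (hg s)).mul (Real.hasDerivAt_exp s)).deriv.trans (by simp; ring)) s 0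
    simpa [f0, g0] using this
  have e : Real.exp t * Real.exp (-t) = 1 := by rw [← Real.exp_add]; simp
  rw [Real.sinh_eq]
  linear_combination (Real.exp t / 2) * h1 t + Real.exp (-t) / 2 * h2 t - f t * e

/-- Archimedes' theorem for moment generating functions. -/
lemma mul_mgf_eq_sinh {Ω : Type*} [MeasurableSpace Ω] {μ : Measure Ω}
    [IsProbabilityMeasure μ] {h : Ω → ℝ} (hm : Measurable h) (hb : ∀ a, |h a| ≤ 1)
    (hstein : ∀ c : ℝ, ∫ a, (c * (1 - h a ^ 2) - 2 * h a) * Real.exp (c * h a) ∂μ = 0) (c : ℝ) :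
    c * mgf h μ c = Real.sinh c := by
  have hexp : ∀ t, Integrable (fun a => Real.exp (t * h a)) μ := fun t =>
    integrable_exp_mul_of_mem_Icc hm.aemeasurable
      (ae_of_all _ fun a => Set.mem_Icc.2 (abs_le.1 (hb a)))
  have hmem : ∀ t, t ∈ interior (integrableExpSet h μ) := by
    simp [integrableExpSet, hexp]
  have hint : ∀ (n : ℕ) t, Integrable (fun a => h a ^ n * Real.exp (t * h a)) μ := fun n t =>
    integrable_pow_mul_exp_of_mem_interior_integrableExpSet (hmem t) n
  set m : ℕ → ℝ → ℝ := fun n t => ∫ a, h a ^ n * Real.exp (t * h a) ∂μ with m_def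
  have hder : ∀ n t, HasDerivAt (m n) (m (n + 1) t) t := fun n t =>
    hasDerivAt_integral_pow_mul_exp_real (hmem t) n
  have hode : ∀ t, t * (m 0 t - m 2 t) - 2 * m 1 t = 0 := by
    intro t
    rw [← hstein t, m_def]
    simp only
    have hi := ((hint 0 t).sub (hint 2 t)).const_mul t
    simp only [Pi.sub_apply] at hi
    rw [← integral_sub (hint _ _) (hint _ _), ← integral_const_mul, ← integral_const_mul,
      ← integral_sub hi ((hint _ _).const_mul _)]
    congr 1 with a
    ring
  have m0 : m 0 0 = 1 := by simp [m_def]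
  have := eq_sinh_of_hasDerivAt (f := fun t => t * m 0 t) (g := fun t => m 0 t + t * m 1 t)
    (fun t => by convert! (hasDerivAt_id t).mul (hder 0 t) using 1; simp)
    (fun t => by
      convert! (hder 0 t).add ((hasDerivAt_id t).mul (hder 1 t)) using 1
      simp only [id]
      linear_combination hode t)
    (by simp) (by simp [m0]) c
  simpa [m_def, mgf] using this

/-- The height on the Bloch sphere of the first column of a unitary matrix. -/
noncomputable def blochZ (U : Matrix.unitaryGroup (Fin 2) ℂ) : ℝ :=
  Complex.normSq (U.1 0 0) - Complex.normSq (U.1 1 0)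

/-- The first equatorial coordinate on the Bloch sphere of the first column of a unitary matrix. -/
noncomputable def blochX (U : Matrix.unitaryGroup (Fin 2) ℂ) : ℝ :=
  2 * (U.1 0 0 * star (U.1 1 0)).re

/-- The second equatorial coordinate on the Bloch sphere of the first column of a unitary matrix. -/
noncomputable def blochY (U : Matrix.unitaryGroup (Fin 2) ℂ) : ℝ :=
  2 * (U.1 0 0 * star (U.1 1 0)).im

lemma continuous_unitary_entry (i j : Fin 2) :
    Continuous fun U : Matrix.unitaryGroup (Fin 2) ℂ => U.1 i j :=
  continuous_subtype_val.matrix_elem i j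

lemma continuous_blochZ : Continuous blochZ :=
  (Complex.continuous_normSq.comp (continuous_unitary_entry 0 0)).sub
    (Complex.continuous_normSq.comp (continuous_unitary_entry 1 0))

lemma continuous_blochX : Continuous blochX :=
  continuous_const.mul (Complex.continuous_re.comp
    ((continuous_unitary_entry 0 0).mul (continuous_unitary_entry 1 0).star))

lemma normSq_col_add (U : Matrix.unitaryGroup (Fin 2) ℂ) (j : Fin 2) :
    Complex.normSq (U.1 0 j) + Complex.normSq (U.1 1 j) = 1 := by
  have h := congrFun (congrFun (Matrix.mem_unitaryGroup_iff'.1 U.2) j) j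
  simp only [Matrix.mul_apply, Fin.sum_univ_two, Matrix.star_apply, Complex.star_def,
    ← Complex.normSq_eq_conj_mul_self, Matrix.one_apply_eq] at h
  exact_mod_cast h

lemma normSq_row_add (U : Matrix.unitaryGroup (Fin 2) ℂ) (i : Fin 2) :
    Complex.normSq (U.1 i 0) + Complex.normSq (U.1 i 1) = 1 := by
  have h := congrFun (congrFun (Matrix.mem_unitaryGroup_iff.1 U.2) i) i
  simp only [Matrix.mul_apply, Fin.sum_univ_two, Matrix.star_apply, Complex.star_def,
    Complex.mul_conj, Matrix.one_apply_eq] at h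
  exact_mod_cast h

lemma bloch_sq_sum (U : Matrix.unitaryGroup (Fin 2) ℂ) :
    blochX U ^ 2 + blochY U ^ 2 + blochZ U ^ 2 = 1 := by
  have h := normSq_col_add U 0
  simp only [blochX, blochY, blochZ, Complex.normSq_apply, Complex.mul_re, Complex.mul_im,
    Complex.star_def, Complex.conj_re, Complex.conj_im] at h ⊢
  linear_combination (1 + ((U.1 0 0).re * (U.1 0 0).re + (U.1 0 0).im * (U.1 0 0).im +
    ((U.1 1 0).re * (U.1 1 0).re + (U.1 1 0).im * (U.1 1 0).im))) * h

lemma abs_blochZ_le (U : Matrix.unitaryGroup (Fin 2) ℂ) : |blochZ U| ≤ 1 :=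
  abs_le_one_iff_mul_self_le_one.2
    (by nlinarith [bloch_sq_sum U, sq_nonneg (blochX U), sq_nonneg (blochY U)])

lemma abs_blochX_le (U : Matrix.unitaryGroup (Fin 2) ℂ) : |blochX U| ≤ 1 :=
  abs_le_one_iff_mul_self_le_one.2
    (by nlinarith [bloch_sq_sum U, sq_nonneg (blochZ U), sq_nonneg (blochY U)])

/-- The real rotation matrix of angle `θ / 2`, which rotates the Bloch sphere by `θ`. -/
noncomputable def blochRotation (θ : ℝ) : Matrix.unitaryGroup (Fin 2) ℂ :=
  ⟨!![(Real.cos (θ / 2) : ℂ), (Real.sin (θ / 2) : ℂ);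
      -(Real.sin (θ / 2) : ℂ), (Real.cos (θ / 2) : ℂ)], by
    have h : (Real.cos (θ / 2) : ℂ) ^ 2 + (Real.sin (θ / 2) : ℂ) ^ 2 = 1 := by
      exact_mod_cast Real.cos_sq_add_sin_sq (θ / 2)
    rw [Matrix.mem_unitaryGroup_iff]
    ext i j
    fin_cases i <;> fin_cases j <;>
      simp [Matrix.mul_apply, Fin.sum_univ_two, Matrix.star_apply, -Complex.ofReal_cos,
        -Complex.ofReal_sin] <;>
      first | ring1 | linear_combination h⟩

/-- The diagonal matrix with entries `I` and `1`. -/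
noncomputable def blochPhase : Matrix.unitaryGroup (Fin 2) ℂ :=
  ⟨!![Complex.I, 0; 0, 1], by
    rw [Matrix.mem_unitaryGroup_iff]
    ext i j
    fin_cases i <;> fin_cases j <;>
      simp [Matrix.mul_apply, Fin.sum_univ_two, Matrix.star_apply]⟩

lemma blochZ_rotation (θ : ℝ) (U : Matrix.unitaryGroup (Fin 2) ℂ) :
    blochZ (blochRotation θ * U) = Real.cos θ * blochZ U + Real.sin θ * blochX U := by
  obtain ⟨φ, rfl⟩ : ∃ φ, θ = 2 * φ := ⟨θ / 2, by ring⟩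
  rw [Real.cos_two_mul', Real.sin_two_mul]
  simp [blochZ, blochX, blochRotation, Matrix.mul_apply, Fin.sum_univ_two, Complex.normSq_apply,
    -Complex.ofReal_cos, -Complex.ofReal_sin]
  ring

lemma blochX_rotation (θ : ℝ) (U : Matrix.unitaryGroup (Fin 2) ℂ) :
    blochX (blochRotation θ * U) = Real.cos θ * blochX U - Real.sin θ * blochZ U := by
  obtain ⟨φ, rfl⟩ : ∃ φ, θ = 2 * φ := ⟨θ / 2, by ring⟩
  rw [Real.cos_two_mul', Real.sin_two_mul]
  simp [blochZ, blochX, blochRotation, Matrix.mul_apply, Fin.sum_univ_two, Complex.normSq_apply,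
    -Complex.ofReal_cos, -Complex.ofReal_sin]
  ring

lemma blochZ_phase (U : Matrix.unitaryGroup (Fin 2) ℂ) :
    blochZ (blochPhase * U) = blochZ U := by
  simp [blochZ, blochPhase, Matrix.mul_apply, Fin.sum_univ_two, Complex.normSq_apply]
  ring

lemma blochX_phase (U : Matrix.unitaryGroup (Fin 2) ℂ) :
    blochX (blochPhase * U) = -blochY U := by
  simp [blochX, blochY, blochPhase, Matrix.mul_apply, Fin.sum_univ_two]
  ring

lemma integral_unitary_mul_left {μ : Measure (Matrix.unitaryGroup (Fin 2) ℂ)}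
    (hinv : ∀ V : Matrix.unitaryGroup (Fin 2) ℂ, Measure.map (fun U => V * U) μ = μ)
    (V : Matrix.unitaryGroup (Fin 2) ℂ) {f : Matrix.unitaryGroup (Fin 2) ℂ → ℝ}
    (hf : Continuous f) : ∫ U, f (V * U) ∂μ = ∫ U, f U ∂μ := by
  have hV : Continuous fun U : Matrix.unitaryGroup (Fin 2) ℂ => V * U := by fun_prop
  conv_rhs => rw [← hinv V]
  exact (integral_map hV.aemeasurable (hinv V ▸ hf.aestronglyMeasurable)).symm

lemma mul_mgf_blochZ {μ : Measure (Matrix.unitaryGroup (Fin 2) ℂ)} [IsProbabilityMeasure μ]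
    (hinv : ∀ V : Matrix.unitaryGroup (Fin 2) ℂ, Measure.map (fun U => V * U) μ = μ) (c : ℝ) :
    c * mgf blochZ μ c = Real.sinh c := by
  have hZ := continuous_blochZ
  have hX := continuous_blochX
  refine mul_mgf_eq_sinh hZ.measurable abs_blochZ_le (fun c => ?_) c
  have hrot := integral_eq_zero_of_rotation_invariant (μ := μ) hZ.measurable hX.measurable
    abs_blochZ_le abs_blochX_le c fun θ => by
      rw [← integral_unitary_mul_left hinv (blochRotation θ)
        (f := fun U => blochX U * Real.exp (c * blochZ U)) (by fun_prop)]
      simp only [blochX_rotation, blochZ_rotation]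
  have hcont : Continuous fun U => (c * blochX U ^ 2 - blochZ U) * Real.exp (c * blochZ U) := by
    fun_prop
  have hphase := integral_unitary_mul_left hinv blochPhase hcont
  have bound : ∀ U, ‖(c * blochX U ^ 2 - blochZ U) * Real.exp (c * blochZ U)‖ ≤
      (|c| * 1 ^ 2 + 1) * Real.exp (|c| * 1) := by
    intro U
    rw [norm_mul, Real.norm_eq_abs, Real.norm_eq_abs, Real.abs_exp]
    refine mul_le_mul ((abs_sub _ _).trans ?_) (exp_mul_le_of_abs_le c (abs_blochZ_le U))
      (Real.exp_pos _).le (by positivity)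
    rw [abs_mul, abs_pow]
    gcongr
    · exact abs_blochX_le U
    · exact abs_blochZ_le U
  have hi : Integrable (fun U => (c * blochX U ^ 2 - blochZ U) * Real.exp (c * blochZ U)) μ :=
    Integrable.of_bound hcont.aestronglyMeasurable _ (ae_of_all _ bound)
  have hi' : Integrable (fun U => (c * blochX (blochPhase * U) ^ 2 - blochZ (blochPhase * U)) *
      Real.exp (c * blochZ (blochPhase * U))) μ :=
    Integrable.of_bound (hcont.comp (continuous_const.mul continuous_id)).aestronglyMeasurable _
      (ae_of_all _ fun U => bound _)
  rw [hrot] at hphase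
  have hsum := integral_add hi hi'
  rw [hrot, hphase, add_zero] at hsum
  rw [← hsum]
  congr 1 with U
  rw [blochX_phase, blochZ_phase]
  linear_combination (-c * Real.exp (c * blochZ U)) * bloch_sq_sum U

lemma trace_sub_conj_sq (x y : Fin 2 → ℝ) (U : Matrix.unitaryGroup (Fin 2) ℂ) :
    (((Matrix.diagonal (fun i => (x i : ℂ)) -
        (U : Matrix (Fin 2) (Fin 2) ℂ)ᴴ * Matrix.diagonal (fun i => (y i : ℂ)) *
          (U : Matrix (Fin 2) (Fin 2) ℂ))^2).trace).re =
      x 0 ^ 2 + x 1 ^ 2 + y 0 ^ 2 + y 1 ^ 2 - (x 0 + x 1) * (y 0 + y 1)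
        - (x 1 - x 0) * (y 1 - y 0) * blochZ U := by
  set A := Matrix.diagonal (fun i => (x i : ℂ))
  set D := Matrix.diagonal (fun i => (y i : ℂ))
  have hU : (U : Matrix (Fin 2) (Fin 2) ℂ) * (U : Matrix (Fin 2) (Fin 2) ℂ)ᴴ = 1 :=
    Matrix.mem_unitaryGroup_iff.1 U.2
  have htr : ((A - U.1ᴴ * D * U.1) ^ 2).trace =
      (A * A).trace - 2 * (A * (U.1ᴴ * D * U.1)).trace + (D * D).trace := by
    have hsq : (U.1ᴴ * D * U.1) * (U.1ᴴ * D * U.1) = U.1ᴴ * (D * D) * U.1 := by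
      calc _ = U.1ᴴ * D * (U.1 * U.1ᴴ) * D * U.1 := by simp only [Matrix.mul_assoc]
        _ = _ := by rw [hU]; simp only [Matrix.mul_assoc, Matrix.one_mul]
    have hcyc : (U.1ᴴ * (D * D) * U.1).trace = (D * D).trace := by
      rw [Matrix.trace_mul_cycle, hU, Matrix.one_mul]
    rw [sq, sub_mul, mul_sub, mul_sub, hsq, Matrix.trace_sub, Matrix.trace_sub, Matrix.trace_sub,
      hcyc, Matrix.trace_mul_comm (U.1ᴴ * D * U.1) A]
    ring
  have h0 := normSq_col_add U 0
  have h1 := normSq_row_add U 0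
  have h2 := normSq_row_add U 1
  rw [htr]
  simp [A, D, blochZ, Matrix.trace_fin_two, Matrix.mul_apply, Fin.sum_univ_two,
    Complex.normSq_apply, Matrix.diagonal_apply] at h0 h1 h2 ⊢
  linear_combination (-(x 0 + x 1) * (y 0 + y 1) + 2 * x 1 * (y 0 + y 1)) * h0
    - 2 * x 1 * y 0 * h1 - 2 * x 1 * y 1 * h2

/-- Harish-Chandra/Itzykson–Zuber formula for `N = 2`, with `dU` the normalized
(left-invariant) Haar probability measure on `U(2)`. -/
theorem harish_chandra_N2
    (μ : Measure (Matrix.unitaryGroup (Fin 2) ℂ)) [IsProbabilityMeasure μ]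
    (hinv : ∀ V : Matrix.unitaryGroup (Fin 2) ℂ, Measure.map (fun U => V * U) μ = μ)
    (x y : Fin 2 → ℝ) (hx : x 0 < x 1) (hy : y 0 < y 1) (σ : ℝ) (hσ : 0 < σ) :
    (∫ U : Matrix.unitaryGroup (Fin 2) ℂ,
        Real.exp (-(1 / (2 * σ^2)) *
          (((Matrix.diagonal (fun i => (x i : ℂ)) -
              (U : Matrix (Fin 2) (Fin 2) ℂ)ᴴ * Matrix.diagonal (fun i => (y i : ℂ)) *
                (U : Matrix (Fin 2) (Fin 2) ℂ))^2).trace).re) ∂μ)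
      = (2 * Real.pi * σ^4 / ((x 1 - x 0) * (y 1 - y 0))) *
          Matrix.det (Matrix.of fun i j : Fin 2 =>
            (2 * Real.pi * σ^2) ^ (-(1:ℝ)/2) * Real.exp (-(x i - y j)^2 / (2 * σ^2))) := by
  have hx' : x 1 - x 0 ≠ 0 := (sub_pos.2 hx).ne'
  have hy' : y 1 - y 0 ≠ 0 := (sub_pos.2 hy).ne'
  set c : ℝ := (x 1 - x 0) * (y 1 - y 0) / (2 * σ ^ 2) with c_def
  have hc : c ≠ 0 := by positivity
  set K : ℝ := -(1 / (2 * σ ^ 2)) *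
    (x 0 ^ 2 + x 1 ^ 2 + y 0 ^ 2 + y 1 ^ 2 - (x 0 + x 1) * (y 0 + y 1)) with K_def
  have hint : ∀ U : Matrix.unitaryGroup (Fin 2) ℂ, Real.exp (-(1 / (2 * σ^2)) *
      (((Matrix.diagonal (fun i => (x i : ℂ)) -
        (U : Matrix (Fin 2) (Fin 2) ℂ)ᴴ * Matrix.diagonal (fun i => (y i : ℂ)) *
          (U : Matrix (Fin 2) (Fin 2) ℂ))^2).trace).re) =
      Real.exp K * Real.exp (c * blochZ U) := by
    intro U
    rw [trace_sub_conj_sq, ← Real.exp_add, K_def, c_def]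
    ring_nf
  simp only [hint]
  rw [integral_const_mul]
  change Real.exp K * mgf blochZ μ c = _
  rw [eq_div_of_mul_eq hc ((mul_comm _ _).trans (mul_mgf_blochZ hinv c)), Real.sinh_eq]
  have hpos : 0 < 2 * Real.pi * σ ^ 2 := by positivity
  have hsqrt : (2 * Real.pi * σ ^ 2) ^ (-(1:ℝ)/2) * (2 * Real.pi * σ ^ 2) ^ (-(1:ℝ)/2) =
      (2 * Real.pi * σ ^ 2)⁻¹ := by
    rw [← Real.rpow_add hpos, ← Real.rpow_neg_one]
    norm_num
  have e1 : Real.exp (-(x 0 - y 0)^2 / (2 * σ^2)) * Real.exp (-(x 1 - y 1)^2 / (2 * σ^2)) =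
      Real.exp K * Real.exp c := by
    rw [← Real.exp_add, ← Real.exp_add, K_def, c_def]
    congr 1
    field_simp
    ring
  have e2 : Real.exp (-(x 0 - y 1)^2 / (2 * σ^2)) * Real.exp (-(x 1 - y 0)^2 / (2 * σ^2)) =
      Real.exp K * Real.exp (-c) := by
    rw [← Real.exp_add, ← Real.exp_add, K_def, c_def]
    congr 1
    field_simp
    ring
  rw [Matrix.det_fin_two]
  simp only [Matrix.of_apply]
  set s := (2 * Real.pi * σ ^ 2) ^ (-(1:ℝ)/2)
  have hdet : s * Real.exp (-(x 0 - y 0)^2 / (2 * σ^2)) *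
        (s * Real.exp (-(x 1 - y 1)^2 / (2 * σ^2))) -
      s * Real.exp (-(x 0 - y 1)^2 / (2 * σ^2)) * (s * Real.exp (-(x 1 - y 0)^2 / (2 * σ^2))) =
      (2 * Real.pi * σ ^ 2)⁻¹ * (Real.exp K * (Real.exp c - Real.exp (-c))) := by
    rw [← hsqrt]
    linear_combination s * s * (e1 - e2)
  rw [hdet]
  have hcinv : c⁻¹ = 2 * σ ^ 2 / ((x 1 - x 0) * (y 1 - y 0)) := by rw [c_def, inv_div]
  rw [div_eq_mul_inv _ c, hcinv]
  field_simp
end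

section
/- The Harish-Chandra integral formula: for x, y ∈ ℝ^N with x_1 < ⋯ < x_N, y_1 < ⋯ < y_N, and σ > 0, ∫_{U(N)} exp(−(1/(2σ²)) Tr(Λ_x − U*Λ_y U)²) dU = (C_1(N) σ^{N²} / (h_N(x) h_N(y))) · det_{1≤i,j≤N}[(2πσ²)^{-1/2} exp(−(x_i − y_j)²/(2σ²))], where C_1(N) = (2π)^{N/2} ∏_{j=1}^N Γ(j). -/
open MeasureTheory Matrix

noncomputable instance (N : ℕ) : MeasurableSpace (Matrix.unitaryGroup (Fin N) ℂ) := borel _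

namespace HarishChandra

open MvPolynomial

section Laplacian

variable {ι R : Type*} [CommRing R]

lemma pderiv_pderiv_comm (i j : ι) (p : MvPolynomial ι R) :
    pderiv i (pderiv j p) = pderiv j (pderiv i p) := by
  classical
  induction p using MvPolynomial.induction_on with
  | C r => simp
  | add p q hp hq => simp only [map_add, hp, hq]
  | mul_X p k hp =>
    simp only [Derivation.leibniz, map_add, smul_eq_mul, pderiv_X, hp]
    have h : ∀ a b : ι, pderiv a (Pi.single (M := fun _ => MvPolynomial ι R) b 1 k) = 0 := by
      intro a b
      rcases eq_or_ne k b with h | h <;> simp [h]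
    rw [h, h]
    ring

variable [Fintype ι]

/-- The second order operator `∑ s, ∂_s ∂_{τ s}`; with `τ = id` this is the Laplacian. -/
noncomputable def lap (τ : ι → ι) : Module.End R (MvPolynomial ι R) :=
  ∑ s, (pderiv s).toLinearMap ∘ₗ (pderiv (τ s)).toLinearMap

lemma lap_apply (τ : ι → ι) (p : MvPolynomial ι R) :
    lap τ p = ∑ s, pderiv s (pderiv (τ s) p) := by
  simp [lap]

lemma lap_X_mul {τ : ι → ι} (hτ : Function.Involutive τ) (s : ι) (p : MvPolynomial ι R) :
    lap τ (X s * p) = X s * lap τ p + 2 * pderiv (τ s) p := by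
  classical
  simp only [lap_apply, Derivation.leibniz, smul_eq_mul, map_add, pderiv_X, Finset.sum_add_distrib,
    Finset.mul_sum]
  have h1 : ∀ t, pderiv (τ t) p * Pi.single (M := fun _ => MvPolynomial ι R) t 1 s =
      if t = s then pderiv (τ s) p else 0 := by
    intro t
    by_cases h : t = s
    · subst h; simp
    · simp [h, Ne.symm h]
  have h2 : ∀ t, Pi.single (M := fun _ => MvPolynomial ι R) (τ t) 1 s * pderiv t p =
      if t = τ s then pderiv (τ s) p else 0 := by
    intro t
    by_cases h : t = τ s
    · subst h; simp [hτ s]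
    · have : s ≠ τ t := fun h' => h (by rw [h', hτ])
      simp [h, this]
  have h3 : ∀ t, p * pderiv t (Pi.single (M := fun _ => MvPolynomial ι R) (τ t) 1 s) = 0 := by
    intro t
    by_cases h : s = τ t <;> simp [h]
  simp only [h1, h2, h3]
  simp
  ring

lemma lap_pderiv (τ : ι → ι) (s : ι) (p : MvPolynomial ι R) :
    lap τ (pderiv s p) = pderiv s (lap τ p) := by
  simp only [lap_apply, map_sum]
  refine Finset.sum_congr rfl fun t _ => ?_
  rw [pderiv_pderiv_comm (τ t) s, pderiv_pderiv_comm t s]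

/-- The graded Helmholtz operator, sending `(W_n)` to `(Δ W_n - c W_{n-2})`. -/
noncomputable def helm (τ : ι → ι) (c : R) : Module.End R (ℤ → MvPolynomial ι R) where
  toFun W n := lap τ (W n) - c • W (n - 2)
  map_add' V W := by ext1 n; simp only [Pi.add_apply, map_add, smul_add]; abel
  map_smul' r W := by
    ext1 n
    simp only [Pi.smul_apply, map_smul, RingHom.id_apply, smul_sub, smul_comm c r]

lemma helm_apply (τ : ι → ι) (c : R) (W : ℤ → MvPolynomial ι R) (n : ℤ) :
    helm τ c W n = lap τ (W n) - c • W (n - 2) := rfl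

lemma helm_X_mul {τ : ι → ι} (hτ : Function.Involutive τ) (c : R) (s : ι)
    (W : ℤ → MvPolynomial ι R) :
    helm τ c (fun n => X s * W n) =
      (fun n => X s * helm τ c W n) + (2 : R) • fun n => pderiv (τ s) (W n) := by
  ext1 n
  rw [Pi.add_apply, Pi.smul_apply]
  simp only [helm_apply, lap_X_mul hτ, mul_sub, Algebra.smul_def, map_ofNat]
  ring

lemma helm_pderiv (τ : ι → ι) (c : R) (s : ι) (W : ℤ → MvPolynomial ι R) :
    helm τ c (fun n => pderiv s (W n)) = fun n => pderiv s (helm τ c W n) := by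
  ext1 n
  simp only [helm_apply, lap_pderiv, map_sub, Derivation.map_smul]

lemma helm_pow_X_mul {τ : ι → ι} (hτ : Function.Involutive τ) (c : R) (s : ι) (k : ℕ)
    (W : ℤ → MvPolynomial ι R) :
    (helm τ c ^ (k + 1)) (fun n => X s * W n) =
      (fun n => X s * (helm τ c ^ (k + 1)) W n) +
        (2 * (k + 1) : R) • fun n => pderiv (τ s) ((helm τ c ^ k) W n) := by
  induction k with
  | zero => simpa using helm_X_mul hτ c s W
  | succ k ih =>
    rw [pow_succ', Module.End.mul_apply, ih, map_add, map_smul, helm_X_mul hτ, helm_pderiv,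
      ← Module.End.mul_apply, ← pow_succ', add_assoc]
    congr 1
    ext1 n
    simp only [← Module.End.mul_apply, ← pow_succ', Pi.add_apply, Pi.smul_apply, ← add_smul]
    congr 1
    push_cast
    ring

/-- If `W` is a null vector of `helm`, iterating `helm` on a product of `W` with a power of a
matrix of variables only sees the corresponding product of derivatives. -/
lemma helm_pow_X_pow {c : R} {W : ℤ → MvPolynomial ι R}
    (hW : helm id c W = 0) (s : ι) (k : ℕ) :
    (helm id c ^ (k + 1)) (fun n => X s ^ k * W n) = 0 ∧
    (helm id c ^ k) (fun n => X s ^ k * W n) =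
      (2 ^ k * k.factorial : R) • fun n => (pderiv s)^[k] (W n) := by
  have hid : Function.Involutive (id : ι → ι) := fun _ => rfl
  induction k with
  | zero => simpa using hW
  | succ k ih =>
    have e : (fun n => X s ^ (k + 1) * W n) = fun n => X s * (X s ^ k * W n) := by
      ext1 n; ring
    have key : (helm id c ^ (k + 1)) (fun n => X s ^ (k + 1) * W n) =
      (2 ^ (k + 1) * (k + 1).factorial : R) • fun n => (pderiv s)^[k + 1] (W n) := by
      rw [e, helm_pow_X_mul hid, ih.1, ih.2]
      ext1 n
      simp only [Pi.add_apply, Pi.zero_apply, mul_zero, zero_add, Pi.smul_apply,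
        Derivation.map_smul, smul_smul, Function.iterate_succ_apply', id]
      congr 1
      rw [Nat.factorial_succ]; push_cast; ring
    refine ⟨?_, key⟩
    rw [pow_succ', Module.End.mul_apply, key, map_smul]
    have : ∀ j, helm id c (fun n => (pderiv s)^[j] (W n)) = 0 := by
      intro j
      induction j with
      | zero => exact hW
      | succ j ihj =>
        simp only [Function.iterate_succ_apply']
        rw [helm_pderiv, ihj]
        ext1 n; simp
    rw [this, smul_zero]

end Laplacian

section ExponentialTerms

variable {ι R : Type*} [CommRing R] [Algebra ℂ R]

/-- The terms `L ^ n / n!` of the exponential series, extended by zero to negative `n`. -/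
noncomputable def expTerm (L : MvPolynomial ι R) : ℤ → MvPolynomial ι R
  | Int.ofNat n => ((n.factorial : ℂ)⁻¹) • L ^ n
  | Int.negSucc _ => 0

lemma expTerm_natCast (L : MvPolynomial ι R) (n : ℕ) :
    expTerm L (n : ℤ) = ((n.factorial : ℂ)⁻¹) • L ^ n := rfl

lemma expTerm_of_neg (L : MvPolynomial ι R) {n : ℤ} (hn : n < 0) : expTerm L n = 0 := by
  obtain ⟨m, rfl⟩ := Int.eq_negSucc_of_lt_zero hn
  rfl

lemma pderiv_expTerm {L : MvPolynomial ι R} {s : ι} {v : R} (hL : pderiv s L = C v) (n : ℤ) :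
    pderiv s (expTerm L n) = C v * expTerm L (n - 1) := by
  have hsmul : ∀ (c : ℂ) (p : MvPolynomial ι R), pderiv s (c • p) = c • pderiv s p := by
    intro c p
    rw [← algebraMap_smul R c p, Derivation.map_smul, algebraMap_smul]
  rcases lt_or_ge n 0 with hn | hn
  · rw [expTerm_of_neg L hn, expTerm_of_neg L (by omega)]; simp
  obtain ⟨m, rfl⟩ := Int.eq_ofNat_of_zero_le hn
  cases m with
  | zero =>
    rw [expTerm_natCast, expTerm_of_neg L (by simp), hsmul]
    simp
  | succ m =>
    have e : ((m + 1 : ℕ) : ℤ) - 1 = (m : ℤ) := by push_cast; ring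
    rw [e, expTerm_natCast, expTerm_natCast, hsmul, Derivation.leibniz_pow, hL]
    have h1 : ((m + 1).factorial : ℂ)⁻¹ * (m + 1 : ℂ) = (m.factorial : ℂ)⁻¹ := by
      rw [Nat.factorial_succ]; push_cast
      have : (m : ℂ) + 1 ≠ 0 := by exact_mod_cast m.succ_ne_zero
      field_simp
    rw [← h1, Nat.add_sub_cancel, smul_eq_mul, ← Nat.cast_smul_eq_nsmul ℂ, smul_smul,
      mul_smul_comm, mul_comm (C v)]
    push_cast
    rfl

end ExponentialTerms

section MatrixVariables

variable {n R : Type*} [Fintype n] [DecidableEq n] [CommRing R]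

omit [DecidableEq n] in
lemma helm_exp {B : Matrix n n R} {c : R} (hc : (B * B).trace = c)
    {P : ℤ → MvPolynomial (n × n) R}
    (hP : ∀ i j m, pderiv (i, j) (P m) = C (B j i) * P (m - 1)) :
    helm Prod.swap c P = 0 := by
  ext1 m
  rw [helm_apply, lap_apply, Fintype.sum_prod_type, Pi.zero_apply, sub_eq_zero, ← hc,
    Matrix.trace, Finset.sum_smul]
  refine Finset.sum_congr rfl fun i _ => ?_
  rw [Matrix.diag_apply, Matrix.mul_apply, Finset.sum_smul]
  refine Finset.sum_congr rfl fun j _ => ?_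
  rw [Prod.swap_prod_mk, hP, pderiv_C_mul, hP, MvPolynomial.smul_eq_C_mul, C_mul, mul_assoc]
  congr 3
  ring

lemma helm_pow_genericMatrix_pow {B : Matrix n n R} {c : R} (hc : (B * B).trace = c)
    {P : ℤ → MvPolynomial (n × n) R}
    (hP : ∀ i j m, pderiv (i, j) (P m) = C (B j i) * P (m - 1)) (k : ℕ) (i l : n) :
    (helm Prod.swap c ^ (k + 1)) (fun m => (mvPolynomialX n n R ^ k) i l * P m) = 0 ∧
    (helm Prod.swap c ^ k) (fun m => (mvPolynomialX n n R ^ k) i l * P m) =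
      (2 ^ k * k.factorial : R) • fun m => C ((B ^ k) i l) * P (m - k) := by
  have hshift : ∀ (b : R) (j : ℤ), helm Prod.swap c (fun m => C b * P (m - j)) = 0 := by
    intro b j
    ext1 m
    have := congrFun (helm_exp hc hP) (m - j)
    rw [helm_apply, Pi.zero_apply] at this
    rw [helm_apply, ← MvPolynomial.smul_eq_C_mul, ← MvPolynomial.smul_eq_C_mul, map_smul,
      smul_comm c b, ← smul_sub, show m - 2 - j = m - j - 2 by ring, this, smul_zero,
      Pi.zero_apply]
  suffices h : (helm Prod.swap c ^ k) (fun m => (mvPolynomialX n n R ^ k) i l * P m) =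
      (2 ^ k * k.factorial : R) • fun m => C ((B ^ k) i l) * P (m - k) by
    refine ⟨?_, h⟩
    rw [pow_succ', Module.End.mul_apply, h, map_smul, hshift, smul_zero]
  induction k generalizing i with
  | zero =>
    ext1 m
    rw [Pi.smul_apply]
    rcases eq_or_ne i l with rfl | h
    · simp
    · simp [h]
  | succ k ih =>
    have ih0 : ∀ j, (helm Prod.swap c ^ (k + 1))
        (fun m => (mvPolynomialX n n R ^ k) j l * P m) = 0 := by
      intro j
      rw [pow_succ', Module.End.mul_apply, ih, map_smul, hshift, smul_zero]
    have e : (fun m => (mvPolynomialX n n R ^ (k + 1)) i l * P m) =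
        ∑ j, fun m => X (i, j) * ((mvPolynomialX n n R ^ k) j l * P m) := by
      ext1 m
      rw [Finset.sum_apply, pow_succ', Matrix.mul_apply, Finset.sum_mul]
      simp [mul_assoc]
    rw [e, map_sum]
    ext1 m
    rw [Finset.sum_apply, Pi.smul_apply, pow_succ' B, Matrix.mul_apply, map_sum, Finset.sum_mul,
      Finset.smul_sum]
    refine Finset.sum_congr rfl fun j _ => ?_
    rw [helm_pow_X_mul Prod.swap_swap, ih0, ih]
    simp only [Pi.add_apply, Pi.smul_apply, Pi.zero_apply, mul_zero, zero_add, Prod.swap_prod_mk,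
      Derivation.map_smul, pderiv_C_mul, hP, smul_smul, C_mul]
    rw [show m - (k : ℤ) - 1 = m - ((k + 1 : ℕ) : ℤ) by push_cast; ring, Nat.factorial_succ,
      mul_left_comm, mul_assoc]
    congr 1
    · push_cast; ring
    · ring

lemma helm_pow_trace {B : Matrix n n R} {c : R} (hc : (B * B).trace = c)
    {P : ℤ → MvPolynomial (n × n) R}
    (hP : ∀ i j m, pderiv (i, j) (P m) = C (B j i) * P (m - 1)) (k : ℕ) :
    (helm Prod.swap c ^ k) (fun m => (mvPolynomialX n n R ^ k).trace * P m) =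
      (2 ^ k * k.factorial : R) • fun m => C ((B ^ k).trace) * P (m - k) := by
  have e : (fun m => (mvPolynomialX n n R ^ k).trace * P m) =
      ∑ i, fun m => (mvPolynomialX n n R ^ k) i i * P m := by
    ext1 m
    rw [Finset.sum_apply, Matrix.trace, Finset.sum_mul]
    rfl
  rw [e, map_sum, Finset.sum_congr rfl fun i _ => (helm_pow_genericMatrix_pow hc hP k i i).2,
    ← Finset.smul_sum]
  congr 1
  ext1 m
  rw [Finset.sum_apply, Matrix.trace, map_sum, Finset.sum_mul]
  rfl

end MatrixVariables

section CoefficientMap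

variable {ι R : Type*} [CommRing R] [Algebra ℂ R]

/-- Apply a linear functional to all coefficients of a polynomial. -/
noncomputable def coeffMap (φ : R →ₗ[ℂ] ℂ) : MvPolynomial ι R →ₗ[ℂ] MvPolynomial ι ℂ where
  toFun := AddMonoidAlgebra.map φ.toAddMonoidHom
  map_add' p q := by
    ext m
    exact map_add φ (coeff m p) (coeff m q)
  map_smul' c p := by
    ext m
    exact map_smul φ c (coeff m p)

lemma coeff_coeffMap (φ : R →ₗ[ℂ] ℂ) (p : MvPolynomial ι R) (m : ι →₀ ℕ) :
    coeff m (coeffMap φ p) = φ (coeff m p) := rfl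

lemma coeffMap_monomial (φ : R →ₗ[ℂ] ℂ) (m : ι →₀ ℕ) (r : R) :
    coeffMap φ (monomial m r) = monomial m (φ r) := by
  classical
  ext m'
  rw [coeff_coeffMap, coeff_monomial, coeff_monomial, apply_ite φ, map_zero]

lemma coeffMap_pderiv (φ : R →ₗ[ℂ] ℂ) (s : ι) (p : MvPolynomial ι R) :
    coeffMap φ (pderiv s p) = pderiv s (coeffMap φ p) := by
  ext m
  rw [coeff_coeffMap, MvPolynomial.coeff_pderiv, MvPolynomial.coeff_pderiv, coeff_coeffMap]
  simp only [← Nat.cast_succ, mul_comm _ ((Nat.cast _ : R)), mul_comm _ ((Nat.cast _ : ℂ)),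
    ← nsmul_eq_mul, map_nsmul]

lemma coeffMap_map_mul (φ : R →ₗ[ℂ] ℂ) (f : MvPolynomial ι ℂ) (p : MvPolynomial ι R) :
    coeffMap φ (map (algebraMap ℂ R) f * p) = f * coeffMap φ p := by
  induction f using MvPolynomial.induction_on' with
  | add f g hf hg => simp only [map_add, add_mul, hf, hg]
  | monomial m c =>
    induction p using MvPolynomial.induction_on' with
    | add p q hp hq => simp only [map_add, mul_add, hp, hq]
    | monomial m' r =>
      rw [map_monomial, monomial_mul, coeffMap_monomial, coeffMap_monomial, monomial_mul,
        ← Algebra.smul_def, map_smul, smul_eq_mul]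

lemma coeffMap_C_algebraMap_mul (φ : R →ₗ[ℂ] ℂ) (c : ℂ) (p : MvPolynomial ι R) :
    coeffMap φ (C (algebraMap ℂ R c) * p) = C c * coeffMap φ p := by
  rw [← coeffMap_map_mul, map_C]

variable [Fintype ι]

lemma coeffMap_helm (φ : R →ₗ[ℂ] ℂ) (τ : ι → ι) (c : ℂ) (W : ℤ → MvPolynomial ι R) (m : ℤ) :
    coeffMap φ (helm τ (algebraMap ℂ R c) W m) = helm τ c (fun m => coeffMap φ (W m)) m := by
  simp only [helm_apply, lap_apply, map_sub, map_sum, coeffMap_pderiv, algebraMap_smul, map_smul]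

lemma coeffMap_helm_pow (φ : R →ₗ[ℂ] ℂ) (τ : ι → ι) (c : ℂ) (k : ℕ)
    (W : ℤ → MvPolynomial ι R) (m : ℤ) :
    coeffMap φ ((helm τ (algebraMap ℂ R c) ^ k) W m) =
      (helm τ c ^ k) (fun m => coeffMap φ (W m)) m := by
  induction k generalizing m with
  | zero => rfl
  | succ k ih =>
    rw [pow_succ', Module.End.mul_apply, coeffMap_helm, pow_succ', Module.End.mul_apply]
    exact congrFun (congrArg (helm τ c) (funext ih)) m

end CoefficientMap

section Invariants

variable {n R : Type*} [Fintype n] [DecidableEq n] [CommRing R]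

/-- The derivation of the polynomial functions of a matrix `A` with `A ↦ [A, E_ij]`. -/
noncomputable def adDer (i j : n) :
    Derivation R (MvPolynomial (n × n) R) (MvPolynomial (n × n) R) :=
  ∑ k, (X (k, i) : MvPolynomial (n × n) R) • pderiv (k, j) -
    ∑ l, (X (j, l) : MvPolynomial (n × n) R) • pderiv (i, l)

omit [DecidableEq n] in
lemma adDer_apply (i j : n) (f : MvPolynomial (n × n) R) :
    adDer i j f = ∑ k, X (k, i) * pderiv (k, j) f - ∑ l, X (j, l) * pderiv (i, l) f := by
  have h : ∀ D : n → Derivation R (MvPolynomial (n × n) R) (MvPolynomial (n × n) R),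
      (∑ k, D k) f = ∑ k, D k f := by
    intro D
    rw [← Derivation.coeFnAddMonoidHom_apply, map_sum, Finset.sum_apply]
    rfl
  simp only [adDer, Derivation.sub_apply, h, Derivation.smul_apply, smul_eq_mul]

lemma adDer_X (i j p q : n) :
    adDer i j (X (p, q) : MvPolynomial (n × n) R) =
      (if q = j then X (p, i) else 0) - (if p = i then X (j, q) else 0) := by
  simp [adDer_apply, pderiv_X, Pi.single_apply, Prod.ext_iff, ite_and, eq_comm]

lemma adDer_genericMatrix_pow (i j : n) (k : ℕ) :
    (mvPolynomialX n n R ^ k).map (adDer i j) =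
      mvPolynomialX n n R ^ k * Matrix.single i j 1 -
        Matrix.single i j 1 * mvPolynomialX n n R ^ k := by
  have h1 : (mvPolynomialX n n R).map (adDer i j) =
      mvPolynomialX n n R * Matrix.single i j 1 -
        Matrix.single i j 1 * mvPolynomialX n n R := by
    ext1 p q
    rw [Matrix.map_apply, mvPolynomialX_apply, adDer_X, Matrix.sub_apply]
    congr 1
    · simp [Matrix.mul_apply, Matrix.single_apply, ite_and, eq_comm]
    · simp [Matrix.mul_apply, Matrix.single_apply, ite_and, eq_comm]
  induction k with
  | zero =>
    ext1 p q
    rcases eq_or_ne p q with rfl | h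
    · simp
    · simp [h]
  | succ k ih =>
    have h2 : (mvPolynomialX n n R ^ (k + 1)).map (adDer i j) =
        (mvPolynomialX n n R ^ k).map (adDer i j) * mvPolynomialX n n R +
          mvPolynomialX n n R ^ k * (mvPolynomialX n n R).map (adDer i j) := by
      ext1 p q
      simp only [pow_succ, Matrix.map_apply, Matrix.add_apply, Matrix.mul_apply, map_sum,
        Derivation.leibniz, smul_eq_mul, Finset.sum_add_distrib]
      rw [add_comm]
      congr 1
      exact Finset.sum_congr rfl fun _ _ => mul_comm _ _
    rw [h2, ih, h1, pow_succ]
    noncomm_ring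

lemma adDer_trace_pow (i j : n) (k : ℕ) :
    adDer i j (mvPolynomialX n n R ^ k).trace = 0 := by
  have : adDer i j (mvPolynomialX n n R ^ k).trace =
      ((mvPolynomialX n n R ^ k).map (adDer i j)).trace := by
    simp [Matrix.trace]
  rw [this, adDer_genericMatrix_pow, Matrix.trace_sub, Matrix.trace_mul_comm, sub_self]

lemma pderiv_adDer (i j p q : n) (f : MvPolynomial (n × n) R) :
    pderiv (p, q) (adDer i j f) = adDer i j (pderiv (p, q) f) +
      (if q = i then pderiv (p, j) f else 0) - (if p = j then pderiv (i, q) f else 0) := by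
  simp only [adDer_apply, map_sub, map_sum, Derivation.leibniz, smul_eq_mul, pderiv_X,
    Finset.sum_add_distrib]
  have h1 : ∑ x, pderiv (x, j) f *
      (Pi.single (p, q) 1 : n × n → MvPolynomial (n × n) R) (x, i) =
      if q = i then pderiv (p, j) f else 0 := by
    simp [Pi.single_apply, Prod.ext_iff, ite_and, eq_comm]
  have h2 : ∑ x, pderiv (i, x) f *
      (Pi.single (p, q) 1 : n × n → MvPolynomial (n × n) R) (j, x) =
      if p = j then pderiv (i, q) f else 0 := by
    simp [Pi.single_apply, Prod.ext_iff, ite_and, eq_comm]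
  have h3 : ∀ x, pderiv (p, q) (pderiv (x, j) f) = pderiv (x, j) (pderiv (p, q) f) :=
    fun x => pderiv_pderiv_comm _ _ _
  have h4 : ∀ x, pderiv (p, q) (pderiv (i, x) f) = pderiv (i, x) (pderiv (p, q) f) :=
    fun x => pderiv_pderiv_comm _ _ _
  simp only [h3, h4]
  rw [← h1, ← h2]
  ring

lemma adDer_lap {i j : n} {f : MvPolynomial (n × n) R} (hf : adDer i j f = 0) :
    adDer i j (lap Prod.swap f) = 0 := by
  have h : ∀ p q, adDer i j (pderiv (p, q) (pderiv (q, p) f)) =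
      (if p = j then pderiv (i, q) (pderiv (q, p) f) else 0)
      - (if q = i then pderiv (p, j) (pderiv (q, p) f) else 0)
      + (if q = j then pderiv (p, q) (pderiv (i, p) f) else 0)
      - (if p = i then pderiv (p, q) (pderiv (q, j) f) else 0) := by
    intro p q
    have h1 := pderiv_adDer i j p q (pderiv (q, p) f)
    have h2 := congrArg (pderiv (p, q)) (pderiv_adDer i j q p f)
    rw [hf, map_zero] at h2
    simp only [map_add, map_sub, apply_ite (pderiv (p, q)), map_zero] at h2
    linear_combination -h2 - h1
  rw [lap_apply, Fintype.sum_prod_type, map_sum]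
  simp only [map_sum, Prod.swap_prod_mk, h, Finset.sum_add_distrib, Finset.sum_sub_distrib]
  rw [Finset.sum_comm (f := fun p q => if p = j then pderiv (i, q) (pderiv (q, p) f) else 0),
    Finset.sum_comm (f := fun p q => if p = i then pderiv (p, q) (pderiv (q, j) f) else 0)]
  simp only [Finset.sum_ite_eq', Finset.mem_univ, if_true]
  simp only [pderiv_pderiv_comm (_, j) (i, _)]
  ring

/-- Restriction of polynomial functions on matrices to diagonal matrices. -/
noncomputable def diagRes : MvPolynomial (n × n) R →ₐ[R] MvPolynomial n R :=
  aeval fun p => if p.1 = p.2 then X p.1 else 0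

omit [Fintype n] in
lemma diagRes_X (i j : n) :
    diagRes (X (i, j) : MvPolynomial (n × n) R) = if i = j then X i else 0 := by
  simp [diagRes]

omit [Fintype n] in
lemma pderiv_diagRes (k : n) (f : MvPolynomial (n × n) R) :
    pderiv k (diagRes f) = diagRes (pderiv (k, k) f) := by
  induction f using MvPolynomial.induction_on with
  | C r => simp [diagRes]
  | add p q hp hq => simp only [map_add, hp, hq]
  | mul_X p s hp =>
    obtain ⟨i, j⟩ := s
    simp only [map_mul, Derivation.leibniz, smul_eq_mul, hp, map_add, pderiv_X, diagRes_X]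
    congr 1
    congr 1
    by_cases hij : i = j
    · subst hij
      by_cases hik : i = k
      · subst hik; simp
      · simp [hik, Prod.ext_iff]
    · have : ¬ (i = k ∧ j = k) := fun h => hij (h.1.trans h.2.symm)
      simp [hij, Prod.ext_iff, this]

lemma sub_mul_diagRes_pderiv {f : MvPolynomial (n × n) R} (i j : n)
    (hf : adDer i j f = 0) :
    (X i - X j) * diagRes (pderiv (i, j) (pderiv (j, i) f)) =
      pderiv i (diagRes f) - pderiv j (diagRes f) := by
  have h := congrArg diagRes (pderiv_adDer i j j i f)
  simp only [hf, map_zero, map_add, map_sub, if_true, adDer_apply, map_sum, map_mul, diagRes_X,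
    ite_mul, zero_mul, Finset.sum_ite_eq, Finset.sum_ite_eq', Finset.mem_univ] at h
  rw [pderiv_diagRes, pderiv_diagRes]
  rw [pderiv_pderiv_comm (i, j)] at h ⊢
  linear_combination -h

end Invariants

section Antisymmetric

variable {N : ℕ}

/-- A polynomial is antisymmetric if permuting its variables multiplies it by the sign. -/
def IsAntisymm (G : MvPolynomial (Fin N) ℂ) : Prop :=
  ∀ w : Equiv.Perm (Fin N), rename w G = (Equiv.Perm.sign w : ℤ) • G

lemma IsAntisymm.sub {F G : MvPolynomial (Fin N) ℂ} (hF : IsAntisymm F) (hG : IsAntisymm G) :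
    IsAntisymm (F - G) := fun w => by rw [map_sub, hF, hG, smul_sub]

lemma IsAntisymm.C_mul {G : MvPolynomial (Fin N) ℂ} (hG : IsAntisymm G) (c : ℂ) :
    IsAntisymm (C c * G) := fun w => by rw [map_mul, rename_C, hG, mul_smul_comm]

lemma IsAntisymm.mul {F G : MvPolynomial (Fin N) ℂ} (hF : IsAntisymm F)
    (hG : ∀ w : Equiv.Perm (Fin N), rename w G = G) : IsAntisymm (F * G) :=
  fun w => by rw [map_mul, hF, hG, smul_mul_assoc]

lemma pderiv_rename_perm (w : Equiv.Perm (Fin N)) (i : Fin N) (G : MvPolynomial (Fin N) ℂ) :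
    pderiv (w i) (rename w G) = rename w (pderiv i G) :=
  pderiv_rename w.injective i G

lemma IsAntisymm.lap {G : MvPolynomial (Fin N) ℂ} (hG : IsAntisymm G) :
    IsAntisymm (lap id G) := fun w => by
  have h : rename w (HarishChandra.lap id G) = HarishChandra.lap id (rename w G) := by
    rw [lap_apply, lap_apply, map_sum]
    refine Fintype.sum_equiv w _ _ fun i => ?_
    rw [id, id, pderiv_rename_perm, pderiv_rename_perm]
  rw [h, hG, map_zsmul]

lemma IsAntisymm.coeff_mapDomain {G : MvPolynomial (Fin N) ℂ} (hG : IsAntisymm G)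
    (w : Equiv.Perm (Fin N)) (d : Fin N →₀ ℕ) :
    (Equiv.Perm.sign w : ℤ) • coeff (d.mapDomain w) G = coeff d G := by
  rw [← coeff_rename_mapDomain w w.injective G d, hG, coeff_smul]

lemma IsAntisymm.coeff_eq_zero {G : MvPolynomial (Fin N) ℂ} (hG : IsAntisymm G)
    {d : Fin N →₀ ℕ} {i j : Fin N} (hij : i ≠ j) (hd : d i = d j) : coeff d G = 0 := by
  have h := hG.coeff_mapDomain (Equiv.swap i j) d
  have hd' : d.mapDomain (Equiv.swap i j) = d := by
    ext k
    have := Finsupp.mapDomain_apply (Equiv.swap i j).injective d (Equiv.swap i j k)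
    rw [Equiv.swap_apply_self] at this
    rw [this]
    rcases eq_or_ne k i with rfl | hki
    · rw [Equiv.swap_apply_left, hd]
    rcases eq_or_ne k j with rfl | hkj
    · rw [Equiv.swap_apply_right, hd]
    rw [Equiv.swap_apply_of_ne_of_ne hki hkj]
  rw [hd', Equiv.Perm.sign_swap hij] at h
  simpa [neg_eq_self] using h

/-- The exponent `(0, 1, …, N - 1)`. -/
noncomputable def stair (N : ℕ) : Fin N →₀ ℕ := Finsupp.equivFunOnFinite.symm fun i => (i : ℕ)

lemma stair_apply (i : Fin N) : stair N i = i := rfl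

/-- An antisymmetric polynomial of degree less than `N` in each variable is determined by its
coefficient at the staircase exponent. -/
lemma IsAntisymm.eq_zero {G : MvPolynomial (Fin N) ℂ} (hG : IsAntisymm G)
    (hdeg : ∀ d i, N ≤ d i → coeff d G = 0) (hstair : coeff (stair N) G = 0) : G = 0 := by
  ext d
  rw [coeff_zero]
  by_contra hd
  have hlt : ∀ i, d i < N := fun i => by
    by_contra h
    exact hd (hdeg d i (not_lt.mp h))
  have hinj : Function.Injective fun i => (⟨d i, hlt i⟩ : Fin N) := by
    intro i j hij
    by_contra hne
    exact hd (hG.coeff_eq_zero hne (by simpa using hij))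
  have h := hG.coeff_mapDomain (Equiv.ofBijective _ (Finite.injective_iff_bijective.mp hinj)) d
  have : d.mapDomain (Equiv.ofBijective _ (Finite.injective_iff_bijective.mp hinj)) = stair N := by
    ext k
    obtain ⟨i, rfl⟩ := (Equiv.ofBijective _ (Finite.injective_iff_bijective.mp hinj)).surjective k
    rw [Finsupp.mapDomain_apply (Equiv.injective _)]
    rfl
  rw [this, hstair, smul_zero] at h
  exact hd h.symm

end Antisymmetric

section Vandermonde

variable {N : ℕ}

lemma prod_lt_sub_eq_det {R : Type*} [CommRing R] (v : Fin N → R) :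
    ∏ p ∈ Finset.univ.filter (fun p : Fin N × Fin N => p.1 < p.2), (v p.2 - v p.1) =
      (Matrix.vandermonde v).det := by
  rw [Matrix.det_vandermonde, Finset.prod_filter, Fintype.prod_prod_type]
  refine Finset.prod_congr rfl fun i _ => ?_
  rw [← Finset.prod_filter]
  refine Finset.prod_congr ?_ fun _ _ => rfl
  ext j; simp

/-- The Vandermonde determinant as a polynomial. -/
noncomputable def vandPoly (N : ℕ) : MvPolynomial (Fin N) ℂ := (Matrix.vandermonde X).det

lemma isAntisymm_vandPoly : IsAntisymm (vandPoly N) := fun w => by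
  rw [vandPoly, AlgHom.map_det]
  have : (rename w).mapMatrix (Matrix.vandermonde (X : Fin N → MvPolynomial (Fin N) ℂ)) =
      (Matrix.vandermonde X).submatrix w id := by
    ext1 i j; simp [Matrix.vandermonde_apply]
  rw [this, Matrix.det_permute, zsmul_eq_mul]

lemma vandPoly_eq_sum : vandPoly N = ∑ w : Equiv.Perm (Fin N),
    (Equiv.Perm.sign w : ℤ) • monomial ((stair N).mapDomain w) (1 : ℂ) := by
  rw [vandPoly, Matrix.det_apply]
  refine Finset.sum_congr rfl fun w _ => ?_
  rw [Units.smul_def]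
  congr 1
  rw [monomial_eq, C_1, one_mul, Finsupp.prod_fintype _ _ (by simp)]
  refine Fintype.prod_equiv w _ _ fun i => ?_
  rw [Finsupp.mapDomain_apply w.injective, Matrix.vandermonde_apply, stair_apply]

lemma coeff_vandPoly_of_le {d : Fin N →₀ ℕ} {i : Fin N} (hd : N ≤ d i) :
    coeff d (vandPoly N) = 0 := by
  rw [vandPoly_eq_sum, coeff_sum]
  refine Finset.sum_eq_zero fun w _ => ?_
  rw [coeff_smul, coeff_monomial, if_neg, smul_zero]
  rintro rfl
  obtain ⟨j, rfl⟩ := w.surjective i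
  rw [Finsupp.mapDomain_apply w.injective, stair_apply] at hd
  exact absurd j.2 (not_lt.mpr hd)

lemma coeff_stair_vandPoly : coeff (stair N) (vandPoly N) = 1 := by
  rw [vandPoly_eq_sum, coeff_sum, Finset.sum_eq_single 1]
  · simp [coeff_monomial]
  · intro w _ hw
    rw [coeff_smul, coeff_monomial, if_neg, smul_zero]
    intro h
    apply hw
    ext i
    have := DFunLike.congr_fun h (w i)
    rw [Finsupp.mapDomain_apply w.injective, stair_apply, stair_apply] at this
    simp [← this]
  · simp

lemma lap_vandPoly : lap id (vandPoly N) = 0 := by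
  have hc : ∀ d, (∀ s, coeff (d + Finsupp.single s 1 + Finsupp.single s 1) (vandPoly N) = 0) →
      coeff d (lap id (vandPoly N)) = 0 := by
    intro d h
    simp only [lap_apply, coeff_sum, coeff_pderiv, id, h, zero_mul, Finset.sum_const_zero]
  refine isAntisymm_vandPoly.lap.eq_zero (fun d i hd => hc d fun s => ?_) (hc _ fun s => ?_)
  · refine coeff_vandPoly_of_le (i := i) ?_
    simp only [Finsupp.add_apply]
    omega
  · by_cases hs : (s : ℕ) + 2 < N
    · refine isAntisymm_vandPoly.coeff_eq_zero (i := s) (j := ⟨s + 2, hs⟩) ?_ ?_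
      · simp [Fin.ext_iff]
      · have : s ≠ ⟨s + 2, hs⟩ := by simp [Fin.ext_iff]
        simp [stair_apply, this]
    · refine coeff_vandPoly_of_le (i := s) ?_
      simp [stair_apply]
      omega

lemma derivation_prod {A : Type*} [CommRing A] [Algebra ℂ A] (D : Derivation ℂ A A)
    {κ : Type*} [DecidableEq κ] (s : Finset κ) (f : κ → A) :
    D (∏ p ∈ s, f p) = ∑ p ∈ s, (∏ q ∈ s.erase p, f q) * D (f p) := by
  induction s using Finset.induction_on with
  | empty => simp
  | insert a s ha ih =>
    rw [Finset.prod_insert ha, D.leibniz, Finset.sum_insert ha, Finset.erase_insert ha, ih,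
      smul_eq_mul, smul_eq_mul, add_comm, Finset.mul_sum]
    congr 1
    refine Finset.sum_congr rfl fun p hp => ?_
    have hpa : a ≠ p := fun h => ha (h ▸ hp)
    rw [Finset.erase_insert_of_ne hpa, Finset.prod_insert (by simp [ha]), mul_assoc]

lemma sum_sum_eq_diag_add_two_mul {A : Type*} [CommRing A] (D : Fin N → Fin N → A)
    (hD : ∀ i j, D i j = D j i) :
    ∑ i, ∑ j, D i j = ∑ i, D i i +
      2 * ∑ p ∈ Finset.univ.filter (fun p : Fin N × Fin N => p.1 < p.2), D p.2 p.1 := by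
  have h1 : ∀ i j, D i j = (if i = j then D i i else 0) + ((if i < j then D j i else 0) +
      (if j < i then D i j else 0)) := by
    intro i j
    rcases lt_trichotomy i j with h | rfl | h
    · simp [h, h.ne, h.asymm, hD i j]
    · simp
    · simp [h, h.ne', h.asymm]
  have h2 : ∑ i, ∑ j, (if j < i then D i j else 0) = ∑ i, ∑ j, (if i < j then D j i else 0) :=
    Finset.sum_comm
  rw [Finset.sum_congr rfl fun i _ => Finset.sum_congr rfl fun j _ => h1 i j]
  simp only [Finset.sum_add_distrib, Finset.sum_ite_eq, Finset.mem_univ, if_true, h2,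
    Finset.sum_filter, Fintype.sum_prod_type]
  ring

/-- The radial part of the matrix Laplacian: conjugating by the Vandermonde determinant turns it
into the Laplacian in the eigenvalues. -/
lemma vandPoly_mul_diagRes_lap {f : MvPolynomial (Fin N × Fin N) ℂ}
    (hf : ∀ i j, adDer i j f = 0) :
    vandPoly N * diagRes (lap Prod.swap f) = lap id (vandPoly N * diagRes f) := by
  have hvand : vandPoly N = ∏ p ∈ Finset.univ.filter (fun p : Fin N × Fin N => p.1 < p.2),
      (X p.2 - X p.1) := (prod_lt_sub_eq_det _).symm
  have hlap : lap id (vandPoly N * diagRes f) = lap id (vandPoly N) * diagRes f +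
      2 * ∑ k, pderiv k (vandPoly N) * pderiv k (diagRes f) +
      vandPoly N * ∑ k, pderiv k (pderiv k (diagRes f)) := by
    simp only [lap_apply, id, Derivation.leibniz, smul_eq_mul, map_add, Finset.sum_add_distrib,
      Finset.mul_sum, Finset.sum_mul, two_mul]
    simp only [mul_comm]
    ring
  have hcross : ∑ k, pderiv k (vandPoly N) * pderiv k (diagRes f) =
      ∑ p ∈ Finset.univ.filter (fun p : Fin N × Fin N => p.1 < p.2),
        vandPoly N * diagRes (pderiv (p.2, p.1) (pderiv (p.1, p.2) f)) := by
    have h1 : ∀ k, pderiv k (vandPoly N) * pderiv k (diagRes f) =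
        ∑ p ∈ Finset.univ.filter (fun p : Fin N × Fin N => p.1 < p.2),
          (∏ q ∈ (Finset.univ.filter (fun p : Fin N × Fin N => p.1 < p.2)).erase p,
            (X q.2 - X q.1)) * (pderiv k (X p.2 - X p.1) * pderiv k (diagRes f)) := by
      intro k
      rw [hvand, derivation_prod, Finset.sum_mul]
      simp only [mul_assoc]
    rw [Finset.sum_congr rfl fun k _ => h1 k, Finset.sum_comm]
    refine Finset.sum_congr rfl fun p hp => ?_
    have h2 : ∑ k, pderiv k (X p.2 - X p.1) * pderiv k (diagRes f) =
        (X p.2 - X p.1) * diagRes (pderiv (p.2, p.1) (pderiv (p.1, p.2) f)) := by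
      rw [sub_mul_diagRes_pderiv _ _ (hf _ _)]
      simp [pderiv_X, Pi.single_apply, sub_mul, Finset.sum_sub_distrib]
    rw [← Finset.mul_sum, h2, hvand, ← Finset.prod_erase_mul _ _ hp, mul_assoc]
  have hsplit : diagRes (lap Prod.swap f) = ∑ k, pderiv k (pderiv k (diagRes f)) +
      2 * ∑ p ∈ Finset.univ.filter (fun p : Fin N × Fin N => p.1 < p.2),
        diagRes (pderiv (p.2, p.1) (pderiv (p.1, p.2) f)) := by
    rw [lap_apply, Fintype.sum_prod_type, map_sum]
    simp only [map_sum, Prod.swap_prod_mk]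
    rw [sum_sum_eq_diag_add_two_mul (fun i j => diagRes (pderiv (i, j) (pderiv (j, i) f)))
      fun i j => by rw [pderiv_pderiv_comm]]
    simp only [pderiv_diagRes]
  rw [hlap, lap_vandPoly, hcross, hsplit, ← Finset.mul_sum]
  ring

end Vandermonde

section DerivativePairing

variable {ι : Type*} [Fintype ι]

/-- The pairing of `f` with `G` for which multiplication by `X i` is adjoint to `∂_i`. -/
noncomputable def pairing (G : MvPolynomial ι ℂ) : MvPolynomial ι ℂ →ₗ[ℂ] ℂ :=
  (basisMonomials ι ℂ).constr ℂ fun d => (∏ i, ((d i).factorial : ℂ)) * coeff d G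

lemma pairing_monomial (G : MvPolynomial ι ℂ) (d : ι →₀ ℕ) (c : ℂ) :
    pairing G (monomial d c) = c * ((∏ i, ((d i).factorial : ℂ)) * coeff d G) := by
  have h : monomial d c = c • basisMonomials ι ℂ d := by
    rw [coe_basisMonomials, smul_monomial, smul_eq_mul, mul_one]
  rw [h, map_smul, pairing, Module.Basis.constr_basis, smul_eq_mul]

lemma pairing_zero (f : MvPolynomial ι ℂ) : pairing 0 f = 0 := by
  induction f using MvPolynomial.induction_on' with
  | monomial d c => simp [pairing_monomial]
  | add p q hp hq => rw [map_add, hp, hq, add_zero]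

lemma pairing_add (F G f : MvPolynomial ι ℂ) : pairing (F + G) f = pairing F f + pairing G f := by
  induction f using MvPolynomial.induction_on' with
  | monomial d c => simp only [pairing_monomial, coeff_add]; ring
  | add p q hp hq => rw [map_add, map_add, map_add, hp, hq]; ring

lemma pairing_sum {κ : Type*} (s : Finset κ) (F : κ → MvPolynomial ι ℂ) (f : MvPolynomial ι ℂ) :
    pairing (∑ i ∈ s, F i) f = ∑ i ∈ s, pairing (F i) f := by
  classical
  induction s using Finset.induction_on with
  | empty => simp [pairing_zero]
  | insert a s ha ih => rw [Finset.sum_insert ha, Finset.sum_insert ha, pairing_add, ih]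

lemma prod_factorial_mul_coeff_pderiv (G : MvPolynomial ι ℂ) (i : ι) (d : ι →₀ ℕ) :
    (∏ j, ((d j).factorial : ℂ)) * coeff d (pderiv i G) =
      (∏ j, (((d + Finsupp.single i 1 : ι →₀ ℕ) j).factorial : ℂ)) *
        coeff (d + Finsupp.single i 1) G := by
  classical
  rw [coeff_pderiv, ← Finset.mul_prod_erase _ _ (Finset.mem_univ i),
    ← Finset.mul_prod_erase _ _ (Finset.mem_univ i)]
  have h : ∏ j ∈ Finset.univ.erase i, (((d + Finsupp.single i 1 : ι →₀ ℕ) j).factorial : ℂ) =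
      ∏ j ∈ Finset.univ.erase i, ((d j).factorial : ℂ) := by
    refine Finset.prod_congr rfl fun j hj => ?_
    simp [(Finset.ne_of_mem_erase hj).symm]
  rw [h, Finsupp.add_apply, Finsupp.single_eq_same, Nat.factorial_succ]
  push_cast
  ring

lemma pairing_X_mul (G f : MvPolynomial ι ℂ) (i : ι) :
    pairing G (X i * f) = pairing (pderiv i G) f := by
  induction f using MvPolynomial.induction_on' with
  | monomial d c =>
    rw [X, monomial_mul, one_mul, pairing_monomial, pairing_monomial,
      prod_factorial_mul_coeff_pderiv, add_comm d]
  | add p q hp hq => rw [mul_add, map_add, map_add, hp, hq]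

lemma pairing_X_pow_mul (G f : MvPolynomial ι ℂ) (i : ι) (k : ℕ) :
    pairing G (X i ^ k * f) = pairing ((pderiv i)^[k] G) f := by
  induction k generalizing G with
  | zero => simp
  | succ k ih => rw [pow_succ', mul_assoc, pairing_X_mul, ih, Function.iterate_succ_apply]

/-- The annihilator of `G` under the pairing. -/
noncomputable def annihilator (G : MvPolynomial ι ℂ) : Ideal (MvPolynomial ι ℂ) where
  carrier := {f | ∀ g, pairing G (f * g) = 0}
  add_mem' hf hg q := by rw [add_mul, map_add, hf, hg, add_zero]
  zero_mem' q := by rw [zero_mul, map_zero]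
  smul_mem' c f hf q := by rw [smul_eq_mul, mul_comm c f, mul_assoc, hf]

/-- A polynomial killed by all power sums of partial derivatives has degree less than the number
of variables in each variable. -/
lemma coeff_eq_zero_of_sum_pderiv_eq_zero {G : MvPolynomial ι ℂ}
    (hG : ∀ k, 1 ≤ k → ∑ i, (pderiv i)^[k] G = 0) {d : ι →₀ ℕ} {i : ι}
    (hd : Fintype.card ι ≤ d i) : coeff d G = 0 := by
  classical
  have hpsum : ∀ k, 1 ≤ k → psum ι ℂ k ∈ annihilator G := by
    intro k hk g
    rw [psum, Finset.sum_mul, map_sum, Finset.sum_congr rfl fun i _ => pairing_X_pow_mul G g i k,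
      ← pairing_sum, hG k hk, pairing_zero]
  have hesymm : ∀ k, 1 ≤ k → esymm ι ℂ k ∈ annihilator G := by
    intro k hk
    have h : (k : MvPolynomial ι ℂ) * esymm ι ℂ k ∈ annihilator G := by
      rw [mul_esymm_eq_sum]
      refine Ideal.mul_mem_left _ _ (Ideal.sum_mem _ fun a ha => Ideal.mul_mem_left _ _ ?_)
      refine hpsum _ ?_
      obtain ⟨ha, hlt⟩ := Finset.mem_filter.mp ha
      have := Finset.HasAntidiagonal.mem_antidiagonal.mp ha
      omega
    have hk0 : (k : ℂ) ≠ 0 := by exact_mod_cast (by omega : k ≠ 0)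
    have h2 := Ideal.mul_mem_left _ (C (k : ℂ)⁻¹) h
    rwa [← mul_assoc, ← map_natCast (C (σ := ι) (R := ℂ)), ← C_mul, inv_mul_cancel₀ hk0, C_1,
      one_mul] at h2
  have hX : (X i : MvPolynomial ι ℂ) ^ Fintype.card ι ∈ annihilator G := by
    have h := congrArg (Polynomial.eval (-X i)) (prod_C_add_X_eq_sum_esymm (σ := ι) ℂ)
    rw [Polynomial.eval_prod, Finset.prod_eq_zero (Finset.mem_univ i) (by simp),
      Polynomial.eval_finsetSum, Finset.sum_range_succ'] at h
    simp only [Polynomial.eval_mul, Polynomial.eval_C, Polynomial.eval_pow, Polynomial.eval_X,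
      esymm_zero, one_mul, Nat.sub_zero] at h
    have h2 : (-X i : MvPolynomial ι ℂ) ^ Fintype.card ι ∈ annihilator G := by
      rw [eq_neg_of_add_eq_zero_right h.symm]
      exact neg_mem (Ideal.sum_mem _ fun k _ => Ideal.mul_mem_right _ _ (hesymm _ (by omega)))
    have h3 := Ideal.mul_mem_left _ ((-1) ^ Fintype.card ι) h2
    rwa [← mul_pow, neg_one_mul, neg_neg] at h3
  have hmon : monomial d (1 : ℂ) = X i ^ Fintype.card ι *
      monomial (d - Finsupp.single i (Fintype.card ι)) 1 := by
    rw [X_pow_eq_monomial, monomial_mul, one_mul, add_tsub_cancel_of_le]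
    rwa [Finsupp.single_le_iff]
  have h := hX (monomial (d - Finsupp.single i (Fintype.card ι)) 1)
  rw [← hmon, pairing_monomial, one_mul] at h
  refine (mul_eq_zero.mp h).resolve_left (Finset.prod_ne_zero_iff.mpr fun j _ => ?_)
  exact_mod_cast Nat.factorial_ne_zero _

lemma prod_factorial_mul_coeff_expTerm (x : ι → ℂ) (d : ι →₀ ℕ) (n : ℤ) :
    (∏ i, ((d i).factorial : ℂ)) * coeff d (expTerm (∑ i, C (x i) * X i) n) =
      if (d.degree : ℤ) = n then ∏ i, x i ^ d i else 0 := by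
  classical
  have hL : ∀ s, pderiv s (∑ i, C (x i) * X i) = C (x s) := by
    intro s
    simp [pderiv_X, Pi.single_apply]
  induction hd : d.degree generalizing d n with
  | zero =>
    rw [Finsupp.degree_eq_zero_iff] at hd
    subst hd
    rcases lt_or_ge n 0 with hn | hn
    · rw [expTerm_of_neg _ hn, if_neg (by simpa using hn.ne')]
      simp
    obtain ⟨m, rfl⟩ := Int.eq_ofNat_of_zero_le hn
    rw [expTerm_natCast, coeff_smul, ← constantCoeff_eq, map_pow]
    cases m with
    | zero => simp
    | succ m =>
      rw [if_neg (by push_cast; omega)]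
      simp
  | succ k ih =>
    obtain ⟨i, hi⟩ : ∃ i, d i ≠ 0 := by
      by_contra! h
      have : d = 0 := Finsupp.ext h
      simp [this] at hd
    obtain ⟨d', rfl⟩ : ∃ d', d = d' + Finsupp.single i 1 :=
      ⟨d - Finsupp.single i 1, by
        rw [tsub_add_cancel_of_le]
        rw [Finsupp.single_le_iff]; omega⟩
    have hd' : d'.degree = k := by
      rw [map_add, Finsupp.degree_single] at hd
      omega
    rw [← prod_factorial_mul_coeff_pderiv, pderiv_expTerm (hL i), coeff_C_mul, mul_left_comm,
      ih d' _ hd', mul_ite, mul_zero]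
    have hp : ∏ j, x j ^ (d' + Finsupp.single i 1 : ι →₀ ℕ) j = x i * ∏ j, x j ^ d' j := by
      simp only [Finsupp.add_apply, pow_add, Finset.prod_mul_distrib]
      rw [mul_comm]
      congr 1
      rw [Finset.prod_eq_single i]
      · simp
      · intro j _ hj; simp [hj.symm]
      · simp
    rw [hp]
    congr 1
    rw [eq_iff_iff]
    push_cast
    omega

end DerivativePairing

section Alternant

variable {N : ℕ}

/-- A graded sequence of antisymmetric polynomials solving `∑ ∂_i^k F_d = p_k(x) F_{d-k}` is
determined by its coefficients at the staircase exponent. -/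
lemma eq_zero_of_sum_pderiv {x : Fin N → ℂ} {F : ℤ → MvPolynomial (Fin N) ℂ}
    (hanti : ∀ d, IsAntisymm (F d)) (hneg : ∀ d < 0, F d = 0)
    (hF : ∀ d (k : ℕ), 1 ≤ k → ∑ i, (pderiv i)^[k] (F d) = C (∑ i, x i ^ k) * F (d - k))
    (hstair : ∀ d, coeff (stair N) (F d) = 0) (d : ℤ) : F d = 0 := by
  have h : ∀ n : ℕ, ∀ d < (n : ℤ), F d = 0 := by
    intro n
    induction n with
    | zero => simpa using hneg
    | succ n ih =>
      intro d hd
      refine (hanti d).eq_zero (fun e i he => ?_) (hstair d)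
      refine coeff_eq_zero_of_sum_pderiv_eq_zero (i := i) (fun k hk => ?_) (by simpa using he)
      rw [hF d k hk, ih _ (by push_cast at hd; omega), mul_zero]
  exact h (d.toNat + 1) d (by push_cast; omega)

/-- The degree `d` part of the determinant of `exp (x_i X_j)`. -/
noncomputable def alternant (x : Fin N → ℂ) (d : ℤ) : MvPolynomial (Fin N) ℂ :=
  ∑ w : Equiv.Perm (Fin N), (Equiv.Perm.sign w : ℤ) • expTerm (∑ i, C (x (w i)) * X i) d

lemma alternant_of_neg (x : Fin N → ℂ) {d : ℤ} (hd : d < 0) : alternant x d = 0 := by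
  simp [alternant, expTerm_of_neg _ hd]

lemma rename_expTerm {ι : Type*} (f : ι → ι) (L : MvPolynomial ι ℂ) (d : ℤ) :
    rename f (expTerm L d) = expTerm (rename f L) d := by
  rcases lt_or_ge d 0 with hd | hd
  · rw [expTerm_of_neg _ hd, expTerm_of_neg _ hd, map_zero]
  · obtain ⟨m, rfl⟩ := Int.eq_ofNat_of_zero_le hd
    rw [expTerm_natCast, expTerm_natCast, map_smul, map_pow]

lemma isAntisymm_alternant (x : Fin N → ℂ) (d : ℤ) : IsAntisymm (alternant x d) := fun v => by
  rw [alternant, map_sum, Finset.smul_sum]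
  refine Fintype.sum_equiv (Equiv.mulRight v⁻¹) _ _ fun w => ?_
  rw [map_zsmul, rename_expTerm, smul_smul, Equiv.coe_mulRight, Equiv.Perm.sign_mul,
    Equiv.Perm.sign_inv]
  congr 1
  · rw [Units.val_mul, mul_left_comm, ← Units.val_mul, Int.units_mul_self, Units.val_one, mul_one]
  · congr 1
    rw [map_sum]
    refine Fintype.sum_equiv v _ _ fun i => ?_
    simp

lemma sum_pderiv_alternant (x : Fin N → ℂ) (d : ℤ) (k : ℕ) :
    ∑ i, (pderiv i)^[k] (alternant x d) = C (∑ i, x i ^ k) * alternant x (d - k) := by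
  have hL : ∀ (w : Equiv.Perm (Fin N)) s,
      pderiv s (∑ i, C (x (w i)) * X i : MvPolynomial (Fin N) ℂ) = C (x (w s)) := by
    intro w s
    simp [pderiv_X, Pi.single_apply]
  have h1 : ∀ i, (pderiv i)^[k] (alternant x d) = ∑ w : Equiv.Perm (Fin N),
      (Equiv.Perm.sign w : ℤ) • (C (x (w i) ^ k) * expTerm (∑ i, C (x (w i)) * X i) (d - k)) := by
    intro i
    induction k with
    | zero => simp [alternant]
    | succ k ih =>
      rw [Function.iterate_succ_apply', ih, map_sum]
      refine Finset.sum_congr rfl fun w _ => ?_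
      rw [map_zsmul, pderiv_C_mul, pderiv_expTerm (hL w i), ← mul_assoc, ← C_mul, ← pow_succ]
      congr 3
      push_cast
      ring
  rw [Finset.sum_congr rfl fun i _ => h1 i, Finset.sum_comm, alternant, Finset.mul_sum]
  refine Finset.sum_congr rfl fun w _ => ?_
  rw [← Finset.smul_sum, ← Finset.sum_mul, mul_smul_comm, map_sum]
  congr 2
  exact Equiv.sum_comp w fun i => C (x i ^ k)

lemma coeff_stair_alternant (x : Fin N → ℂ) (d : ℤ) :
    (∏ i : Fin N, ((i : ℕ).factorial : ℂ)) * coeff (stair N) (alternant x d) =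
      if ((stair N).degree : ℤ) = d then (Matrix.vandermonde x).det else 0 := by
  rw [alternant, coeff_sum, Finset.mul_sum]
  have h : ∀ w : Equiv.Perm (Fin N), (∏ i : Fin N, ((i : ℕ).factorial : ℂ)) *
      coeff (stair N) ((Equiv.Perm.sign w : ℤ) • expTerm (∑ i, C (x (w i)) * X i) d) =
      if ((stair N).degree : ℤ) = d then (Equiv.Perm.sign w : ℤ) • ∏ i, x (w i) ^ (i : ℕ)
        else 0 := by
    intro w
    rw [coeff_smul, mul_smul_comm]
    have := prod_factorial_mul_coeff_expTerm (fun i => x (w i)) (stair N) d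
    simp only [stair_apply] at this
    rw [this, smul_ite, smul_zero]
  rw [Finset.sum_congr rfl fun w _ => h w]
  split_ifs
  · rw [Matrix.det_apply]
    refine Finset.sum_congr rfl fun w _ => ?_
    simp [Units.smul_def, Matrix.vandermonde_apply]
  · simp

end Alternant

section RadialPart

variable {N : ℕ}

lemma diagRes_trace_pow (k : ℕ) :
    diagRes (mvPolynomialX (Fin N) (Fin N) ℂ ^ k).trace = ∑ i, X i ^ k := by
  have h : (diagRes (R := ℂ)).mapMatrix (mvPolynomialX (Fin N) (Fin N) ℂ) =
      Matrix.diagonal X := by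
    ext1 i j
    simp [diagRes_X, Matrix.diagonal_apply]
  rw [AddMonoidHom.map_trace, ← AlgHom.mapMatrix_apply, map_pow, h, Matrix.diagonal_pow,
    Matrix.trace_diagonal]
  rfl

lemma vandPoly_mul_diagRes_helm_pow {c : ℂ} {W : ℤ → MvPolynomial (Fin N × Fin N) ℂ}
    (hW : ∀ i j d, adDer i j (W d) = 0) (k : ℕ) :
    (∀ i j d, adDer i j ((helm Prod.swap c ^ k) W d) = 0) ∧
    (fun d => vandPoly N * diagRes ((helm Prod.swap c ^ k) W d)) =
      (helm id c ^ k) fun d => vandPoly N * diagRes (W d) := by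
  induction k with
  | zero => exact ⟨hW, rfl⟩
  | succ k ih =>
    simp only [pow_succ', Module.End.mul_apply]
    rw [← ih.2]
    refine ⟨fun i j d => ?_, ?_⟩
    · rw [helm_apply, map_sub, adDer_lap (ih.1 i j d), Derivation.map_smul, ih.1, smul_zero,
        sub_zero]
    · ext1 d
      rw [helm_apply, helm_apply, map_sub, mul_sub,
        vandPoly_mul_diagRes_lap fun i j => ih.1 i j d, map_smul, mul_smul_comm]

lemma sum_pderiv_vandPoly_mul_diagRes {x : Fin N → ℂ}
    {I : ℤ → MvPolynomial (Fin N × Fin N) ℂ} (hI : ∀ i j d, adDer i j (I d) = 0)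
    (hhelm : helm Prod.swap (∑ i, x i ^ 2) I = 0)
    (htrace : ∀ k : ℕ, (helm Prod.swap (∑ i, x i ^ 2) ^ k)
      (fun d => (mvPolynomialX (Fin N) (Fin N) ℂ ^ k).trace * I d) =
        (2 ^ k * k.factorial : ℂ) • fun d => C (∑ i, x i ^ k) * I (d - k)) (d : ℤ) (k : ℕ) :
    ∑ i, (pderiv i)^[k] (vandPoly N * diagRes (I d)) =
      C (∑ i, x i ^ k) * (vandPoly N * diagRes (I (d - k))) := by
  have h0 : helm id (∑ i, x i ^ 2) (fun d => vandPoly N * diagRes (I d)) = 0 := by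
    have := (vandPoly_mul_diagRes_helm_pow (c := ∑ i, x i ^ 2) hI 1).2
    rw [pow_one, pow_one, hhelm] at this
    rw [← this]
    ext1 d
    simp
  have h1 := (vandPoly_mul_diagRes_helm_pow (c := ∑ i, x i ^ 2)
    (W := fun d => (mvPolynomialX (Fin N) (Fin N) ℂ ^ k).trace * I d)
    (fun i j d => by rw [Derivation.leibniz, hI, adDer_trace_pow]; simp) k).2
  have h2 : (fun d => vandPoly N *
      diagRes ((mvPolynomialX (Fin N) (Fin N) ℂ ^ k).trace * I d)) =
      ∑ i, fun d => X i ^ k * (vandPoly N * diagRes (I d)) := by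
    ext1 d
    rw [Finset.sum_apply, map_mul, diagRes_trace_pow, Finset.sum_mul, Finset.mul_sum]
    exact Finset.sum_congr rfl fun i _ => by ring
  rw [htrace, h2, map_sum (helm id _ ^ k),
    Finset.sum_congr rfl fun i _ => (helm_pow_X_pow h0 i k).2,
    ← Finset.smul_sum] at h1
  have h3 := congrFun h1 d
  have hne : (2 ^ k * k.factorial : ℂ) ≠ 0 :=
    mul_ne_zero (pow_ne_zero _ two_ne_zero) (by exact_mod_cast k.factorial_ne_zero)
  simp only [Pi.smul_apply, Finset.sum_apply, map_smul, mul_smul_comm] at h3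
  rw [← smul_right_injective _ hne h3, map_mul, mul_left_comm]
  congr 1
  simp [diagRes]

/-- The Harish-Chandra formula, degree by degree. -/
lemma vandPoly_mul_diagRes_eq_alternant {x : Fin N → ℂ}
    {I : ℤ → MvPolynomial (Fin N × Fin N) ℂ} (hI : ∀ i j d, adDer i j (I d) = 0)
    (hsymm : ∀ d (w : Equiv.Perm (Fin N)), rename w (diagRes (I d)) = diagRes (I d))
    (hhelm : helm Prod.swap (∑ i, x i ^ 2) I = 0)
    (htrace : ∀ k : ℕ, (helm Prod.swap (∑ i, x i ^ 2) ^ k)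
      (fun d => (mvPolynomialX (Fin N) (Fin N) ℂ ^ k).trace * I d) =
        (2 ^ k * k.factorial : ℂ) • fun d => C (∑ i, x i ^ k) * I (d - k))
    (hneg : ∀ d < 0, I d = 0) (hone : I 0 = 1) (hhom : ∀ n : ℕ, (I n).IsHomogeneous n) (d : ℤ) :
    C (Matrix.vandermonde x).det * (vandPoly N * diagRes (I (d - (stair N).degree))) =
      C (∏ i : Fin N, ((i : ℕ).factorial : ℂ)) * alternant x d := by
  refine sub_eq_zero.mp (eq_zero_of_sum_pderiv (x := x) (F := fun d =>
    C (Matrix.vandermonde x).det * (vandPoly N * diagRes (I (d - (stair N).degree))) -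
      C (∏ i : Fin N, ((i : ℕ).factorial : ℂ)) * alternant x d) ?_ ?_ ?_ ?_ d)
  · exact fun d => ((isAntisymm_vandPoly.mul (hsymm _)).C_mul _).sub
      ((isAntisymm_alternant x d).C_mul _)
  · intro d hd
    rw [hneg _ (by omega), alternant_of_neg x hd]
    simp
  · intro d k _
    clear * - hI hhelm htrace
    have hiter : ∀ (i : Fin N) (a b : ℂ) (p q : MvPolynomial (Fin N) ℂ),
        (pderiv i)^[k] (C a * p - C b * q) =
          C a * (pderiv i)^[k] p - C b * (pderiv i)^[k] q := by
      intro i a b p q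
      induction k with
      | zero => rfl
      | succ k ih =>
        simp only [Function.iterate_succ_apply', ih, map_sub, pderiv_C_mul]
    simp only [hiter, Finset.sum_sub_distrib, ← Finset.mul_sum]
    rw [sum_pderiv_vandPoly_mul_diagRes hI hhelm htrace, sum_pderiv_alternant,
      show d - ((stair N).degree : ℤ) - k = d - k - ((stair N).degree : ℤ) by ring]
    ring
  · intro d
    rw [coeff_sub, coeff_C_mul, coeff_C_mul, coeff_stair_alternant, sub_eq_zero]
    rcases lt_trichotomy d (stair N).degree with h | h | h
    · rw [hneg _ (by omega), if_neg h.ne']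
      simp
    · rw [if_pos h.symm, h, sub_self, hone, map_one, mul_one, coeff_stair_vandPoly, mul_one]
    · rw [if_neg h.ne]
      obtain ⟨n, hn⟩ := Int.eq_ofNat_of_zero_le (sub_nonneg.mpr h.le)
      have hv : (vandPoly N).IsHomogeneous (stair N).degree := by
        rw [vandPoly_eq_sum]
        refine IsHomogeneous.sum _ _ _ fun w _ => ?_
        rw [← Int.cast_smul_eq_zsmul ℂ, MvPolynomial.smul_monomial]
        refine isHomogeneous_monomial _ ?_
        rw [Finsupp.degree_eq_sum, Finsupp.degree_eq_sum, ← Equiv.sum_comp w]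
        exact Finset.sum_congr rfl fun i _ => Finsupp.mapDomain_apply w.injective _ _
      have hd : (diagRes (I n)).IsHomogeneous n := by
        have := (hhom n).aeval (fun p : Fin N × Fin N =>
          (if p.1 = p.2 then X p.1 else 0 : MvPolynomial (Fin N) ℂ)) (n := 1) fun p => by
            split_ifs
            · exact isHomogeneous_X _ _
            · exact isHomogeneous_zero _ _ _
        rwa [one_mul] at this
      rw [hn, (hv.mul hd).coeff_eq_zero (by omega), mul_zero]

end RadialPart

section Conjugation

variable {N : ℕ}

lemma hasDerivAt_eval {ι : Type*} [Fintype ι] {γ : ℝ → ι → ℂ} {γ' : ι → ℂ} {t : ℝ}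
    (hγ : ∀ s, HasDerivAt (fun t => γ t s) (γ' s) t) (p : MvPolynomial ι ℂ) :
    HasDerivAt (fun t => eval (γ t) p) (∑ s, γ' s * eval (γ t) (pderiv s p)) t := by
  classical
  induction p using MvPolynomial.induction_on with
  | C r => simpa using hasDerivAt_const t r
  | add p q hp hq =>
    simp only [map_add, mul_add, Finset.sum_add_distrib]
    exact hp.add hq
  | mul_X p k hp =>
    simp only [map_mul, eval_X]
    refine (hp.mul (hγ k)).congr_deriv ?_
    simp only [Derivation.leibniz, map_add, smul_eq_mul, map_mul, eval_X, pderiv_X, mul_add,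
      Finset.sum_add_distrib, Finset.sum_mul]
    rw [add_comm]
    congr 1
    · simp [Pi.single_apply, apply_ite, mul_comm]
    · exact Finset.sum_congr rfl fun _ _ => by ring

open scoped Matrix.Norms.Operator in
lemma exists_unitary_curve {S : Matrix (Fin N) (Fin N) ℂ} (hS : Sᴴ = -S)
    (A : Matrix (Fin N) (Fin N) ℂ) :
    ∃ V : ℝ → unitaryGroup (Fin N) ℂ, V 0 = 1 ∧ ∀ i j,
      HasDerivAt (fun t => ((V t : Matrix (Fin N) (Fin N) ℂ) * A *
        (V t : Matrix (Fin N) (Fin N) ℂ)ᴴ) i j) ((S * A - A * S) i j) 0 := by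
  have hstar : ∀ t : ℝ, (NormedSpace.exp (t • S))ᴴ = NormedSpace.exp (t • -S) := by
    intro t
    rw [← Matrix.exp_conjTranspose, conjTranspose_smul, hS]
    simp
  have hmem : ∀ t : ℝ, NormedSpace.exp (t • S) ∈ unitaryGroup (Fin N) ℂ := by
    intro t
    rw [mem_unitaryGroup_iff, star_eq_conjTranspose, hstar, ← Matrix.exp_add_of_commute]
    · simp
    · exact ((Commute.refl S).neg_right).smul_left t |>.smul_right t
  refine ⟨fun t => ⟨_, hmem t⟩, by ext1; simp, fun i j => ?_⟩
  simp only [hstar]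
  have h := ((hasDerivAt_exp_smul_const S (0 : ℝ)).mul_const A).mul
    (hasDerivAt_exp_smul_const (-S) (0 : ℝ))
  have h2 := ((Matrix.entryLinearMap ℝ ℂ i j).toContinuousLinearMap.hasFDerivAt).comp_hasDerivAt
    (0 : ℝ) h
  refine h2.congr_deriv ?_
  simp only [zero_smul, NormedSpace.exp_zero, one_mul, mul_one, mul_neg, sub_eq_add_neg]
  rfl

lemma sum_commutator_mul_pderiv_eq_zero {f : MvPolynomial (Fin N × Fin N) ℂ}
    (hf : ∀ (V : unitaryGroup (Fin N) ℂ) (A : Matrix (Fin N) (Fin N) ℂ),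
      eval (fun s => ((V : Matrix (Fin N) (Fin N) ℂ) * A *
        (V : Matrix (Fin N) (Fin N) ℂ)ᴴ) s.1 s.2) f = eval (fun s => A s.1 s.2) f)
    (A : Matrix (Fin N) (Fin N) ℂ) {S : Matrix (Fin N) (Fin N) ℂ} (hS : Sᴴ = -S) :
    ∑ s : Fin N × Fin N, (S * A - A * S) s.1 s.2 * eval (fun s => A s.1 s.2) (pderiv s f) = 0 := by
  obtain ⟨V, hV0, hV⟩ := exists_unitary_curve hS A
  have h1 := fun hh => hasDerivAt_eval (t := 0) (γ' := fun s => (S * A - A * S) s.1 s.2)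
    (γ := fun t s => ((V t : Matrix (Fin N) (Fin N) ℂ) * A *
      (V t : Matrix (Fin N) (Fin N) ℂ)ᴴ) s.1 s.2) hh f
  have h2 : ∀ s : Fin N × Fin N, HasDerivAt (fun t => ((V t : Matrix (Fin N) (Fin N) ℂ) * A *
      (V t : Matrix (Fin N) (Fin N) ℂ)ᴴ) s.1 s.2) ((S * A - A * S) s.1 s.2) 0 :=
    fun s => hV s.1 s.2
  specialize h1 h2
  have h0 : (V 0 : Matrix (Fin N) (Fin N) ℂ) * A * (V 0 : Matrix (Fin N) (Fin N) ℂ)ᴴ = A := by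
    rw [hV0]
    simp
  simp only [hf, h0] at h1
  exact h1.unique (hasDerivAt_const _ _)

/-- A polynomial function of matrices invariant under unitary conjugation is killed by the
infinitesimal conjugations. -/
lemma adDer_eq_zero_of_eval_conj {f : MvPolynomial (Fin N × Fin N) ℂ}
    (hf : ∀ (V : unitaryGroup (Fin N) ℂ) (A : Matrix (Fin N) (Fin N) ℂ),
      eval (fun s => ((V : Matrix (Fin N) (Fin N) ℂ) * A *
        (V : Matrix (Fin N) (Fin N) ℂ)ᴴ) s.1 s.2) f = eval (fun s => A s.1 s.2) f)
    (i j : Fin N) : adDer i j f = 0 := by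
  refine MvPolynomial.funext fun a => ?_
  obtain ⟨A, rfl⟩ : ∃ A : Matrix (Fin N) (Fin N) ℂ, a = fun s => A s.1 s.2 :=
    ⟨Matrix.of fun p q => a (p, q), rfl⟩
  let T : Matrix (Fin N) (Fin N) ℂ →ₗ[ℂ] ℂ :=
    { toFun S := ∑ s : Fin N × Fin N,
        (S * A - A * S) s.1 s.2 * eval (fun s => A s.1 s.2) (pderiv s f)
      map_add' S T := by
        rw [← Finset.sum_add_distrib]
        refine Finset.sum_congr rfl fun s _ => ?_
        simp only [add_mul, mul_add, Matrix.add_apply, Matrix.sub_apply]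
        ring
      map_smul' c S := by
        rw [Finset.smul_sum]
        refine Finset.sum_congr rfl fun s _ => ?_
        simp only [smul_mul_assoc, mul_smul_comm, Matrix.smul_apply, Matrix.sub_apply,
          smul_eq_mul, RingHom.id_apply]
        ring }
  have hskew : ∀ S, Sᴴ = -S → T S = 0 := fun S hS => sum_commutator_mul_pderiv_eq_zero hf A hS
  have hall : ∀ S, T S = 0 := by
    intro S
    have h1 := hskew (S - Sᴴ) (by simp)
    have h2 := hskew (Complex.I • (S + Sᴴ)) (by
      rw [conjTranspose_smul, conjTranspose_add, conjTranspose_conjTranspose]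
      simp [add_comm])
    rw [map_smul, map_add, smul_eq_mul] at h2
    rw [map_sub] at h1
    have h3 := (mul_eq_zero.mp h2).resolve_left Complex.I_ne_zero
    linear_combination (h1 + h3) / 2
  have h : ∑ s : Fin N × Fin N,
      (Matrix.single i j 1 * A - A * Matrix.single i j 1 : Matrix (Fin N) (Fin N) ℂ) s.1 s.2 *
      eval (fun s => A s.1 s.2) (pderiv s f) = 0 := hall (Matrix.single i j 1)
  rw [Fintype.sum_prod_type] at h
  simp only [Matrix.sub_apply, sub_mul, Finset.sum_sub_distrib] at h
  rw [adDer_apply, map_sub, map_sum, map_sum, map_zero]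
  have e1 : ∑ p, ∑ q, (Matrix.single i j 1 * A : Matrix (Fin N) (Fin N) ℂ) p q *
      eval (fun s => A s.1 s.2) (pderiv (p, q) f) =
      ∑ l, eval (fun s => A s.1 s.2) (X (j, l) * pderiv (i, l) f) := by
    rw [Finset.sum_eq_single i]
    · simp
    · intro p _ hp
      simp [hp]
    · simp
  have e2 : ∑ p, ∑ q, (A * Matrix.single i j 1 : Matrix (Fin N) (Fin N) ℂ) p q *
      eval (fun s => A s.1 s.2) (pderiv (p, q) f) =
      ∑ k, eval (fun s => A s.1 s.2) (X (k, i) * pderiv (k, j) f) := by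
    refine Finset.sum_congr rfl fun p _ => ?_
    rw [Finset.sum_eq_single j]
    · simp
    · intro q _ hq
      simp [hq]
    · simp
  rw [e1, e2] at h
  linear_combination -h

lemma eval_diagRes (a : Fin N → ℂ) (f : MvPolynomial (Fin N × Fin N) ℂ) :
    eval a (diagRes f) = eval (fun s => Matrix.diagonal a s.1 s.2) f := by
  induction f using MvPolynomial.induction_on with
  | C r => simp [diagRes]
  | add p q hp hq => simp only [map_add, hp, hq]
  | mul_X p s hp =>
    obtain ⟨i, j⟩ := s
    simp only [map_mul, hp, eval_X, diagRes_X, Matrix.diagonal_apply]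
    split_ifs <;> simp

lemma rename_diagRes_of_eval_conj {f : MvPolynomial (Fin N × Fin N) ℂ}
    (hf : ∀ (V : unitaryGroup (Fin N) ℂ) (A : Matrix (Fin N) (Fin N) ℂ),
      eval (fun s => ((V : Matrix (Fin N) (Fin N) ℂ) * A *
        (V : Matrix (Fin N) (Fin N) ℂ)ᴴ) s.1 s.2) f = eval (fun s => A s.1 s.2) f)
    (w : Equiv.Perm (Fin N)) : rename w (diagRes f) = diagRes f := by
  refine MvPolynomial.funext fun a => ?_
  have hmem : w.permMatrix ℂ ∈ unitaryGroup (Fin N) ℂ := by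
    rw [mem_unitaryGroup_iff, star_eq_conjTranspose, conjTranspose_permMatrix, ← permMatrix_mul]
    simp
  have hconj : w.permMatrix ℂ * Matrix.diagonal a * (w.permMatrix ℂ)ᴴ =
      Matrix.diagonal (a ∘ w) := by
    ext i j
    rw [conjTranspose_permMatrix, Equiv.Perm.permMatrix, Equiv.Perm.permMatrix,
      PEquiv.toMatrix_toPEquiv_mul, PEquiv.mul_toMatrix_toPEquiv]
    change (if w i = w j then a (w i) else 0) = if i = j then a (w i) else 0
    simp only [w.injective.eq_iff]
  rw [eval_rename, eval_diagRes, eval_diagRes, ← hf ⟨_, hmem⟩ (Matrix.diagonal a), ← hconj]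

end Conjugation

section Orbit

variable {N : ℕ}

instance : BorelSpace (unitaryGroup (Fin N) ℂ) := ⟨rfl⟩

instance : CompactSpace (unitaryGroup (Fin N) ℂ) := by
  refine isCompact_iff_compactSpace.mp (IsCompact.of_isClosed_subset
    (s := Set.univ.pi fun _ => Set.univ.pi fun _ => Metric.closedBall (0 : ℂ) 1)
    (isCompact_univ_pi fun _ => isCompact_univ_pi fun _ => isCompact_closedBall 0 1)
    (isClosed_unitary (R := Matrix (Fin N) (Fin N) ℂ)) ?_)
  intro U hU i _ j _
  simpa using entry_norm_bound_of_unitary hU i j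

/-- Integration of continuous functions on the unitary group as a linear functional. -/
noncomputable def integralLinearMap (μ : Measure (unitaryGroup (Fin N) ℂ)) [IsFiniteMeasure μ] :
    C(unitaryGroup (Fin N) ℂ, ℂ) →ₗ[ℂ] ℂ where
  toFun f := ∫ U, f U ∂μ
  map_add' f g := integral_add
    (f.continuous.integrable_of_hasCompactSupport (HasCompactSupport.of_compactSpace _))
    (g.continuous.integrable_of_hasCompactSupport (HasCompactSupport.of_compactSpace _))
  map_smul' c _ := integral_const_mul c _

/-- The matrix `U * diagonal x * Uᴴ` as a matrix of continuous functions of `U`. -/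
noncomputable def orbit (x : Fin N → ℂ) : Matrix (Fin N) (Fin N) C(unitaryGroup (Fin N) ℂ, ℂ) :=
  Matrix.of fun i j => ⟨fun U => ((U : Matrix (Fin N) (Fin N) ℂ) * diagonal x *
    (U : Matrix (Fin N) (Fin N) ℂ)ᴴ) i j, by fun_prop⟩

lemma conj_diagonal_pow (x : Fin N → ℂ) (U : unitaryGroup (Fin N) ℂ) (k : ℕ) :
    ((U : Matrix (Fin N) (Fin N) ℂ) * diagonal x * (U : Matrix (Fin N) (Fin N) ℂ)ᴴ) ^ k =
      (U : Matrix (Fin N) (Fin N) ℂ) * diagonal (fun i => x i ^ k) *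
        (U : Matrix (Fin N) (Fin N) ℂ)ᴴ := by
  have hU : (U : Matrix (Fin N) (Fin N) ℂ)ᴴ * U = 1 := mem_unitaryGroup_iff'.mp U.2
  have hU' : (U : Matrix (Fin N) (Fin N) ℂ) * (U : Matrix (Fin N) (Fin N) ℂ)ᴴ = 1 :=
    mem_unitaryGroup_iff.mp U.2
  induction k with
  | zero => simp [hU']
  | succ k ih =>
    have h : diagonal (fun i => x i ^ (k + 1)) = diagonal (fun i => x i ^ k) * diagonal x := by
      simp [pow_succ]
    rw [pow_succ, ih, h]
    simp only [Matrix.mul_assoc]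
    rw [← Matrix.mul_assoc _ᴴ, hU, Matrix.one_mul]

lemma trace_orbit_pow (x : Fin N → ℂ) (k : ℕ) :
    (orbit x ^ k).trace = algebraMap ℂ _ (∑ i, x i ^ k) := by
  ext U
  let e := ContinuousMap.evalAlgHom ℂ ℂ U
  have h1 : e.mapMatrix (orbit x) = (U : Matrix (Fin N) (Fin N) ℂ) * diagonal x *
      (U : Matrix (Fin N) (Fin N) ℂ)ᴴ := rfl
  have h2 : (orbit x ^ k).trace U = (e.mapMatrix (orbit x ^ k)).trace :=
    AddMonoidHom.map_trace e _
  have hU : (U : Matrix (Fin N) (Fin N) ℂ)ᴴ * U = 1 := mem_unitaryGroup_iff'.mp U.2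
  rw [h2, map_pow, h1, conj_diagonal_pow, Matrix.trace_mul_comm, ← Matrix.mul_assoc, hU,
    Matrix.one_mul, trace_diagonal]
  rfl

lemma eval_coeffMap {ι R : Type*} [CommRing R] [Algebra ℂ R] (φ : R →ₗ[ℂ] ℂ) (a : ι → ℂ)
    (p : MvPolynomial ι R) :
    eval a (coeffMap φ p) = φ (eval (fun s => algebraMap ℂ R (a s)) p) := by
  induction p using MvPolynomial.induction_on' with
  | monomial d r =>
    rw [coeffMap_monomial, eval_monomial, eval_monomial]
    simp only [← map_pow, Finsupp.prod, ← map_prod]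
    rw [mul_comm r, ← Algebra.smul_def, map_smul, smul_eq_mul, mul_comm]
  | add p q hp hq => simp only [map_add, hp, hq]

variable (μ : Measure (unitaryGroup (Fin N) ℂ)) [IsProbabilityMeasure μ]

/-- The homogeneous components of the Fourier transform of an orbital measure, as polynomials
in the entries of a matrix. -/
noncomputable def orbitalPoly (x : Fin N → ℂ) (d : ℤ) : MvPolynomial (Fin N × Fin N) ℂ :=
  coeffMap (integralLinearMap μ) (expTerm (∑ s, C (orbit x s.2 s.1) * X s) d)

lemma eval_orbitalPoly (x : Fin N → ℂ) (n : ℕ) (A : Matrix (Fin N) (Fin N) ℂ) :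
    eval (fun s => A s.1 s.2) (orbitalPoly μ x n) =
      ∫ U : unitaryGroup (Fin N) ℂ, (n.factorial : ℂ)⁻¹ *
        (A * ((U : Matrix (Fin N) (Fin N) ℂ) * diagonal x *
          (U : Matrix (Fin N) (Fin N) ℂ)ᴴ)).trace ^ n ∂μ := by
  rw [orbitalPoly, eval_coeffMap, expTerm_natCast]
  change ∫ U, _ ∂μ = _
  congr 1
  ext U
  let e := ContinuousMap.evalAlgHom ℂ ℂ U
  change e _ = _
  have htr : (A * ((U : Matrix (Fin N) (Fin N) ℂ) * diagonal x *
      (U : Matrix (Fin N) (Fin N) ℂ)ᴴ)).trace = ∑ s : Fin N × Fin N, e (orbit x s.2 s.1) *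
        A s.1 s.2 := by
    simp only [Matrix.trace, Matrix.diag_apply, Matrix.mul_apply (M := A), Fintype.sum_prod_type]
    exact Finset.sum_congr rfl fun i _ => Finset.sum_congr rfl fun j _ => mul_comm _ _
  rw [htr, Algebra.smul_def, MvPolynomial.algebraMap_apply]
  simp only [map_mul, map_pow, map_sum, eval_C, eval_X, AlgHom.commutes, Algebra.algebraMap_self,
    RingHom.id_apply]

lemma eval_orbitalPoly_conj
    (hinv : ∀ V : unitaryGroup (Fin N) ℂ, Measure.map (fun U => V * U) μ = μ)
    (x : Fin N → ℂ) (d : ℤ) (V : unitaryGroup (Fin N) ℂ) (A : Matrix (Fin N) (Fin N) ℂ) :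
    eval (fun s => ((V : Matrix (Fin N) (Fin N) ℂ) * A *
        (V : Matrix (Fin N) (Fin N) ℂ)ᴴ) s.1 s.2) (orbitalPoly μ x d) =
      eval (fun s => A s.1 s.2) (orbitalPoly μ x d) := by
  obtain hd | hd := lt_or_ge d 0
  · simp [orbitalPoly, expTerm_of_neg _ hd]
  lift d to ℕ using hd
  rw [eval_orbitalPoly, eval_orbitalPoly]
  conv_rhs => rw [← hinv V⁻¹]
  rw [integral_map (by fun_prop) (Continuous.aestronglyMeasurable (by fun_prop))]
  refine integral_congr_ae (.of_forall fun U => ?_)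
  have hmul : ((V⁻¹ * U : unitaryGroup (Fin N) ℂ) : Matrix (Fin N) (Fin N) ℂ) =
    (V : Matrix (Fin N) (Fin N) ℂ)ᴴ * U := rfl
  simp only [hmul, conjTranspose_mul, conjTranspose_conjTranspose]
  congr 2
  rw [Matrix.mul_assoc, Matrix.mul_assoc, Matrix.trace_mul_comm]
  simp only [Matrix.mul_assoc]

end Orbit

section OrbitalPoly

variable {N : ℕ} (μ : Measure (unitaryGroup (Fin N) ℂ)) [IsProbabilityMeasure μ]

lemma pderiv_expTerm_orbit (x : Fin N → ℂ) (i j : Fin N) (m : ℤ) :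
    pderiv (i, j) (expTerm (∑ s : Fin N × Fin N, C (orbit x s.2 s.1) * X s) m) =
      C (orbit x j i) * expTerm (∑ s : Fin N × Fin N, C (orbit x s.2 s.1) * X s) (m - 1) := by
  refine pderiv_expTerm ?_ m
  simp [Derivation.leibniz, pderiv_X, Pi.single_apply]

lemma helm_orbitalPoly (x : Fin N → ℂ) :
    helm Prod.swap (∑ i, x i ^ 2) (orbitalPoly μ x) = 0 := by
  funext m
  have h := helm_exp (B := orbit x) (c := algebraMap ℂ _ (∑ i, x i ^ 2))
    (by rw [← pow_two, trace_orbit_pow]) (pderiv_expTerm_orbit x)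
  have h2 := congrArg (coeffMap (integralLinearMap μ)) (congrFun h m)
  rw [coeffMap_helm] at h2
  exact h2.trans (map_zero _)

lemma helm_pow_trace_orbitalPoly (x : Fin N → ℂ) (k : ℕ) :
    (helm Prod.swap (∑ i, x i ^ 2) ^ k)
        (fun d => (mvPolynomialX (Fin N) (Fin N) ℂ ^ k).trace * orbitalPoly μ x d) =
      (2 ^ k * k.factorial : ℂ) • fun d => C (∑ i, x i ^ k) * orbitalPoly μ x (d - k) := by
  funext m
  have h := helm_pow_trace (B := orbit x) (c := algebraMap ℂ _ (∑ i, x i ^ 2))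
    (by rw [← pow_two, trace_orbit_pow]) (pderiv_expTerm_orbit x) k
  have h2 := congrArg (coeffMap (integralLinearMap μ)) (congrFun h m)
  have hX : (mvPolynomialX (Fin N) (Fin N) C(unitaryGroup (Fin N) ℂ, ℂ) ^ k).trace =
      MvPolynomial.map (algebraMap ℂ _) (mvPolynomialX (Fin N) (Fin N) ℂ ^ k).trace := by
    have e : mvPolynomialX (Fin N) (Fin N) C(unitaryGroup (Fin N) ℂ, ℂ) =
        (MvPolynomial.map (algebraMap ℂ C(unitaryGroup (Fin N) ℂ, ℂ))).mapMatrix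
          (mvPolynomialX (Fin N) (Fin N) ℂ) := by
      ext1 i j
      simp
    rw [e, ← map_pow]
    exact (AddMonoidHom.map_trace (MvPolynomial.map (algebraMap ℂ _)) _).symm
  have hc : (2 ^ k * k.factorial : C(unitaryGroup (Fin N) ℂ, ℂ)) =
      algebraMap ℂ _ (2 ^ k * k.factorial : ℂ) := by
    rw [map_mul, map_pow, map_natCast, map_ofNat]
  rw [coeffMap_helm_pow, hX, trace_orbit_pow] at h2
  simp only [coeffMap_map_mul] at h2
  refine h2.trans ?_
  rw [Pi.smul_apply, Pi.smul_apply, hc, algebraMap_smul, map_smul, coeffMap_C_algebraMap_mul]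
  rfl

lemma orbitalPoly_of_neg (x : Fin N → ℂ) {d : ℤ} (hd : d < 0) : orbitalPoly μ x d = 0 := by
  rw [orbitalPoly, expTerm_of_neg _ hd, map_zero]

lemma orbitalPoly_zero (x : Fin N → ℂ) : orbitalPoly μ x 0 = 1 := by
  have h := expTerm_natCast (∑ s : Fin N × Fin N, C (orbit x s.2 s.1) * X s) 0
  have h1 : (1 : MvPolynomial (Fin N × Fin N) C(unitaryGroup (Fin N) ℂ, ℂ)) =
    monomial 0 1 := rfl
  have h2 : integralLinearMap μ 1 = 1 := by
    change ∫ _, (1 : ℂ) ∂μ = 1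
    simp
  simp only [Nat.cast_zero, Nat.factorial_zero, Nat.cast_one, inv_one, pow_zero, one_smul] at h
  rw [orbitalPoly, h, h1, coeffMap_monomial, h2]
  rfl

lemma orbitalPoly_isHomogeneous (x : Fin N → ℂ) (n : ℕ) :
    (orbitalPoly μ x n).IsHomogeneous n := by
  intro d hd
  have hL : (∑ s : Fin N × Fin N, C (orbit x s.2 s.1) * X s).IsHomogeneous 1 :=
    IsHomogeneous.sum _ _ _ fun s _ => isHomogeneous_C_mul_X _ _
  have hLn := hL.pow n
  rw [one_mul] at hLn
  refine hLn fun h => hd ?_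
  rw [orbitalPoly, expTerm_natCast, coeff_coeffMap, coeff_smul, h, smul_zero, map_zero]

variable {μ} in
lemma vandermonde_mul_eval_orbitalPoly
    (hinv : ∀ V : unitaryGroup (Fin N) ℂ, Measure.map (fun U => V * U) μ = μ)
    (x y : Fin N → ℂ) (d : ℤ) :
    (Matrix.vandermonde x).det * ((Matrix.vandermonde y).det *
      eval (fun s => diagonal y s.1 s.2) (orbitalPoly μ x (d - (stair N).degree))) =
    (∏ i : Fin N, ((i : ℕ).factorial : ℂ)) * eval y (alternant x d) := by
  have hconj := fun d => eval_orbitalPoly_conj μ hinv x d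
  have h := vandPoly_mul_diagRes_eq_alternant (x := x) (I := orbitalPoly μ x)
    (fun i j d => adDer_eq_zero_of_eval_conj (hconj d) i j)
    (fun d w => rename_diagRes_of_eval_conj (hconj d) w)
    (helm_orbitalPoly μ x) (helm_pow_trace_orbitalPoly μ x)
    (fun d hd => orbitalPoly_of_neg μ x hd) (orbitalPoly_zero μ x)
    (orbitalPoly_isHomogeneous μ x) d
  have h2 := congrArg (eval y) h
  have hv : eval y (vandPoly N) = (Matrix.vandermonde y).det := by
    rw [vandPoly, RingHom.map_det]
    congr 1
    ext i j
    simp [Matrix.vandermonde_apply]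
  simpa only [map_mul, eval_C, hv, eval_diagRes] using h2

end OrbitalPoly

section Summation

lemma hasSum_integral_cexp {X : Type*} [TopologicalSpace X] [CompactSpace X] [MeasurableSpace X]
    [OpensMeasurableSpace X] (μ : Measure X) [IsFiniteMeasure μ] {f : X → ℂ} (hf : Continuous f) :
    HasSum (fun n : ℕ => ∫ u, (n.factorial : ℂ)⁻¹ * f u ^ n ∂μ) (∫ u, Complex.exp (f u) ∂μ) := by
  obtain ⟨M, hM⟩ := isCompact_univ.exists_bound_of_continuousOn hf.continuousOn
  have h_int : ∀ n : ℕ, Integrable (fun u => (n.factorial : ℂ)⁻¹ * f u ^ n) μ := fun n =>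
    (by fun_prop : Continuous fun u => (n.factorial : ℂ)⁻¹ * f u ^ n)
      |>.integrable_of_hasCompactSupport (HasCompactSupport.of_compactSpace _)
  have hexp : ∀ u, Complex.exp (f u) = ∑' n : ℕ, (n.factorial : ℂ)⁻¹ * f u ^ n := by
    intro u
    rw [Complex.exp_eq_exp_ℂ, NormedSpace.exp_eq_tsum_div]
    exact tsum_congr fun n => div_eq_inv_mul _ _
  simp only [hexp]
  refine hasSum_integral_of_summable_integral_norm h_int ?_
  refine Summable.of_nonneg_of_le (fun n => integral_nonneg fun u => norm_nonneg _) (fun n => ?_)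
    ((Real.summable_pow_div_factorial M).mul_left (μ.real Set.univ))
  have h := norm_integral_le_of_norm_le_const (μ := μ)
    (f := fun u => ‖(n.factorial : ℂ)⁻¹ * f u ^ n‖) (C := M ^ n / n.factorial)
    (.of_forall fun u => ?_)
  · exact (le_abs_self _).trans (h.trans_eq (mul_comm _ _))
  · rw [norm_norm, norm_mul, norm_inv, norm_pow, Complex.norm_natCast, ← div_eq_inv_mul]
    gcongr
    exact hM u trivial

variable {N : ℕ}

lemma hasSum_eval_alternant (x y : Fin N → ℂ) :
    HasSum (fun d : ℕ => eval y (alternant x d))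
      (Matrix.of fun i j => Complex.exp (x i * y j)).det := by
  have h : ∀ w : Equiv.Perm (Fin N), HasSum
      (fun d : ℕ => (Equiv.Perm.sign w : ℤ) • eval y (expTerm (∑ i, C (x (w i)) * X i) d))
      ((Equiv.Perm.sign w : ℤ) • ∏ i, Complex.exp (x (w i) * y i)) := by
    intro w
    refine HasSum.const_smul _ ?_
    rw [← Complex.exp_sum, Complex.exp_eq_exp_ℂ]
    refine (NormedSpace.expSeries_div_hasSum_exp (∑ i, x (w i) * y i)).congr_fun fun d => ?_
    rw [expTerm_natCast, smul_eval, map_pow, div_eq_inv_mul]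
    simp
  rw [Matrix.det_apply]
  refine (hasSum_sum fun w _ => h w).congr_fun fun d => ?_
  simp only [alternant, map_sum, map_zsmul]

/-- The Harish-Chandra integral formula, with complex parameters. -/
lemma vandermonde_mul_integral_cexp_trace {μ : Measure (unitaryGroup (Fin N) ℂ)}
    [IsProbabilityMeasure μ]
    (hinv : ∀ V : unitaryGroup (Fin N) ℂ, Measure.map (fun U => V * U) μ = μ)
    (x y : Fin N → ℂ) :
    (Matrix.vandermonde x).det * ((Matrix.vandermonde y).det *
      ∫ U : unitaryGroup (Fin N) ℂ, Complex.exp (diagonal y *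
        ((U : Matrix (Fin N) (Fin N) ℂ) * diagonal x *
          (U : Matrix (Fin N) (Fin N) ℂ)ᴴ)).trace ∂μ) =
    (∏ i : Fin N, ((i : ℕ).factorial : ℂ)) *
      (Matrix.of fun i j => Complex.exp (x i * y j)).det := by
  set m := (stair N).degree
  have h1 := (((hasSum_integral_cexp μ (f := fun U : unitaryGroup (Fin N) ℂ => (diagonal y *
        ((U : Matrix (Fin N) (Fin N) ℂ) * diagonal x *
          (U : Matrix (Fin N) (Fin N) ℂ)ᴴ)).trace) (by fun_prop)).mul_left
    (Matrix.vandermonde y).det).mul_left (Matrix.vandermonde x).det)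
  have h2 := (hasSum_eval_alternant x y).mul_left (∏ i : Fin N, ((i : ℕ).factorial : ℂ))
  have hlow : ∑ d ∈ Finset.range m,
      (∏ i : Fin N, ((i : ℕ).factorial : ℂ)) * eval y (alternant x d) = 0 := by
    refine Finset.sum_eq_zero fun d hd => ?_
    have hd' := Finset.mem_range.mp hd
    rw [← vandermonde_mul_eval_orbitalPoly hinv x y d, orbitalPoly_of_neg μ x (by omega)]
    simp
  rw [← hasSum_nat_add_iff' m, hlow, sub_zero] at h2
  refine h1.unique (h2.congr_fun fun n => ?_)
  rw [← eval_orbitalPoly, ← vandermonde_mul_eval_orbitalPoly hinv x y]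
  simp [m]

end Summation

section Real

variable {N : ℕ}

lemma vandermonde_mul_integral_exp_trace_re {μ : Measure (unitaryGroup (Fin N) ℂ)}
    [IsProbabilityMeasure μ]
    (hinv : ∀ V : unitaryGroup (Fin N) ℂ, Measure.map (fun U => V * U) μ = μ)
    (x y : Fin N → ℝ) :
    _root_.vandermonde N x * (_root_.vandermonde N y *
      ∫ U : unitaryGroup (Fin N) ℂ, Real.exp (diagonal (fun i => (y i : ℂ)) *
        ((U : Matrix (Fin N) (Fin N) ℂ) * diagonal (fun i => (x i : ℂ)) *
          (U : Matrix (Fin N) (Fin N) ℂ)ᴴ)).trace.re ∂μ) =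
    (∏ i : Fin N, ((i : ℕ).factorial : ℝ)) *
      (Matrix.of fun i j => Real.exp (x i * y j)).det := by
  have h := vandermonde_mul_integral_cexp_trace hinv (fun i => (x i : ℂ)) (fun i => (y i : ℂ))
  have hv : ∀ z : Fin N → ℝ, (Matrix.vandermonde fun i => (z i : ℂ)).det =
      (_root_.vandermonde N z : ℝ) := by
    intro z
    rw [← prod_lt_sub_eq_det, _root_.vandermonde]
    push_cast
    rfl
  have hdet : (Matrix.of fun i j => Complex.exp (x i * y j)).det =
      ((Matrix.of fun i j => Real.exp (x i * y j)).det : ℝ) := by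
    rw [← Complex.ofRealHom_eq_coe, RingHom.map_det]
    congr 1
    ext i j
    simp
  have hreal : ∀ U : unitaryGroup (Fin N) ℂ, (diagonal (fun i => (y i : ℂ)) *
        ((U : Matrix (Fin N) (Fin N) ℂ) * diagonal (fun i => (x i : ℂ)) *
          (U : Matrix (Fin N) (Fin N) ℂ)ᴴ)).trace = ((diagonal (fun i => (y i : ℂ)) *
        ((U : Matrix (Fin N) (Fin N) ℂ) * diagonal (fun i => (x i : ℂ)) *
          (U : Matrix (Fin N) (Fin N) ℂ)ᴴ)).trace.re : ℝ) := by
    intro U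
    refine (Complex.conj_eq_iff_re.mp ?_).symm
    rw [starRingEnd_apply, ← trace_conjTranspose]
    have hd : ∀ z : Fin N → ℝ, (diagonal fun i => (z i : ℂ))ᴴ = diagonal fun i => (z i : ℂ) := by
      intro z
      rw [diagonal_conjTranspose]
      congr 1
      ext i
      simp
    simp only [conjTranspose_mul, conjTranspose_conjTranspose, hd]
    rw [Matrix.trace_mul_comm]
    simp only [Matrix.mul_assoc]
  have h_int : ∫ U : unitaryGroup (Fin N) ℂ, Complex.exp (diagonal (fun i => (y i : ℂ)) *
        ((U : Matrix (Fin N) (Fin N) ℂ) * diagonal (fun i => (x i : ℂ)) *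
          (U : Matrix (Fin N) (Fin N) ℂ)ᴴ)).trace ∂μ =
      (∫ U : unitaryGroup (Fin N) ℂ, Real.exp (diagonal (fun i => (y i : ℂ)) *
        ((U : Matrix (Fin N) (Fin N) ℂ) * diagonal (fun i => (x i : ℂ)) *
          (U : Matrix (Fin N) (Fin N) ℂ)ᴴ)).trace.re ∂μ : ℝ) := by
    rw [← integral_complex_ofReal]
    refine integral_congr_ae (.of_forall fun U => ?_)
    change Complex.exp _ = ((Real.exp _ : ℝ) : ℂ)
    rw [Complex.ofReal_exp, ← hreal U]
  rw [hv, hv, hdet, h_int] at h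
  exact_mod_cast h

lemma vandermonde_eq_det (x : Fin N → ℝ) :
    _root_.vandermonde N x = (Matrix.vandermonde x).det := by
  rw [← prod_lt_sub_eq_det, _root_.vandermonde]

lemma vandermonde_const_mul (c : ℝ) (x : Fin N → ℝ) :
    _root_.vandermonde N (fun i => c * x i) =
      c ^ (∑ i ∈ Finset.range N, i) * _root_.vandermonde N x := by
  have h : Matrix.vandermonde (fun i => c * x i) =
      Matrix.of fun i j : Fin N => c ^ (j : ℕ) * Matrix.vandermonde x i j := by
    ext i j
    simp [Matrix.vandermonde_apply, mul_pow]
  rw [vandermonde_eq_det, h, det_mul_row, ← vandermonde_eq_det, Finset.prod_pow_eq_pow_sum,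
    ← Fin.sum_univ_eq_sum_range fun i => i]

lemma vandermonde_pos {x : Fin N → ℝ} (hx : ∀ i j : Fin N, i < j → x i < x j) :
    0 < _root_.vandermonde N x :=
  Finset.prod_pos fun _ hp => sub_pos.mpr (hx _ _ (Finset.mem_filter.mp hp).2)

lemma trace_sub_conj_sq (x y : Fin N → ℂ) (U : unitaryGroup (Fin N) ℂ) :
    ((diagonal x - (U : Matrix (Fin N) (Fin N) ℂ)ᴴ * diagonal y *
      (U : Matrix (Fin N) (Fin N) ℂ)) ^ 2).trace =
    ∑ i, x i ^ 2 + ∑ i, y i ^ 2 - 2 * (diagonal y *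
      ((U : Matrix (Fin N) (Fin N) ℂ) * diagonal x * (U : Matrix (Fin N) (Fin N) ℂ)ᴴ)).trace := by
  have hU : (U : Matrix (Fin N) (Fin N) ℂ) * (U : Matrix (Fin N) (Fin N) ℂ)ᴴ = 1 :=
    mem_unitaryGroup_iff.mp U.2
  have hy := conj_diagonal_pow y U⁻¹ 2
  have hinv : ((U⁻¹ : unitaryGroup (Fin N) ℂ) : Matrix (Fin N) (Fin N) ℂ) =
    (U : Matrix (Fin N) (Fin N) ℂ)ᴴ := rfl
  rw [hinv, conjTranspose_conjTranspose] at hy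
  have h1 : (diagonal x * ((U : Matrix (Fin N) (Fin N) ℂ)ᴴ * diagonal y *
      (U : Matrix (Fin N) (Fin N) ℂ))).trace = (diagonal y *
      ((U : Matrix (Fin N) (Fin N) ℂ) * diagonal x *
        (U : Matrix (Fin N) (Fin N) ℂ)ᴴ)).trace := by
    rw [← Matrix.mul_assoc, Matrix.trace_mul_comm, ← Matrix.mul_assoc, ← Matrix.mul_assoc,
      Matrix.trace_mul_comm]
  have h2 : ((U : Matrix (Fin N) (Fin N) ℂ)ᴴ * diagonal (fun i => y i ^ 2) *
      (U : Matrix (Fin N) (Fin N) ℂ)).trace = ∑ i, y i ^ 2 := by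
    rw [Matrix.trace_mul_comm, ← Matrix.mul_assoc, hU, Matrix.one_mul, trace_diagonal]
  have h3 : (diagonal x * diagonal x).trace = ∑ i, x i ^ 2 := by
    rw [diagonal_mul_diagonal, trace_diagonal]
    simp only [pow_two]
  rw [pow_two, sub_mul, mul_sub, mul_sub, trace_sub, trace_sub, trace_sub, ← pow_two (_ * _ * _),
    hy, h2, h3, Matrix.trace_mul_comm (_ * _ * _), h1]
  ring

lemma two_pi_rpow_mul_gaussian_const_pow (N : ℕ) {σ : ℝ} (hσ : 0 < σ) :
    (2 * Real.pi) ^ ((N : ℝ) / 2) * ((2 * Real.pi * σ ^ 2) ^ (-(1 : ℝ) / 2)) ^ N * σ ^ N = 1 := by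
  have hpi : 0 < 2 * Real.pi := by positivity
  have h1 : (2 * Real.pi) ^ ((N : ℝ) / 2) = √(2 * Real.pi) ^ N := by
    rw [Real.sqrt_eq_rpow, ← Real.rpow_natCast, ← Real.rpow_mul hpi.le]
    congr 1
    ring
  have h2 : (2 * Real.pi * σ ^ 2) ^ (-(1 : ℝ) / 2) = (√(2 * Real.pi) * σ)⁻¹ := by
    rw [neg_div, Real.rpow_neg (by positivity), ← Real.sqrt_eq_rpow, Real.sqrt_mul hpi.le,
      Real.sqrt_sq hσ.le]
  have h3 : √(2 * Real.pi) ≠ 0 := (Real.sqrt_pos.mpr hpi).ne'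
  rw [h1, h2, ← mul_pow, ← mul_pow]
  have h4 : √(2 * Real.pi) * (√(2 * Real.pi) * σ)⁻¹ * σ = 1 := by
    field_simp
  rw [h4, one_pow]

lemma det_gaussian (x y : Fin N → ℝ) (g σ : ℝ) :
    (Matrix.of fun i j : Fin N => g * Real.exp (-(x i - y j) ^ 2 / (2 * σ ^ 2))).det =
      g ^ N * Real.exp (-(∑ i, x i ^ 2 + ∑ i, y i ^ 2) / (2 * σ ^ 2)) *
        (Matrix.of fun i j : Fin N => Real.exp (x i * ((σ ^ 2)⁻¹ * y j))).det := by
  have h : (Matrix.of fun i j : Fin N => g * Real.exp (-(x i - y j) ^ 2 / (2 * σ ^ 2))) =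
      Matrix.of fun i j : Fin N => (g * Real.exp (-x i ^ 2 / (2 * σ ^ 2))) *
        (Matrix.of fun i j : Fin N => Real.exp (-y j ^ 2 / (2 * σ ^ 2)) *
          (Matrix.of fun i j : Fin N => Real.exp (x i * ((σ ^ 2)⁻¹ * y j))) i j) i j := by
    ext i j
    simp only [Matrix.of_apply]
    rw [mul_assoc, ← Real.exp_add, ← Real.exp_add]
    congr 2
    ring
  rw [h, det_mul_column, det_mul_row, Finset.prod_mul_distrib, ← Real.exp_sum, ← Real.exp_sum,
    Finset.prod_const, Finset.card_univ, Fintype.card_fin, neg_add, add_div, Real.exp_add,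
    ← Finset.sum_neg_distrib, ← Finset.sum_neg_distrib, Finset.sum_div, Finset.sum_div]
  ring

end Real

end HarishChandra

/-- The Harish-Chandra integral formula, with `dU` the normalized (left-invariant)
Haar probability measure on `U(N)` and `C₁(N) = (2π)^{N/2} ∏_{j=1}^N Γ(j)`. -/
theorem harish_chandra (N : ℕ)
    (μ : Measure (Matrix.unitaryGroup (Fin N) ℂ)) [IsProbabilityMeasure μ]
    (hinv : ∀ V : Matrix.unitaryGroup (Fin N) ℂ, Measure.map (fun U => V * U) μ = μ)
    (x y : Fin N → ℝ) (hx : ∀ i j : Fin N, i < j → x i < x j)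
    (hy : ∀ i j : Fin N, i < j → y i < y j) (σ : ℝ) (hσ : 0 < σ) :
    (∫ U : Matrix.unitaryGroup (Fin N) ℂ,
        Real.exp (-(1 / (2 * σ^2)) *
          (((Matrix.diagonal (fun i => (x i : ℂ)) -
              (U : Matrix (Fin N) (Fin N) ℂ)ᴴ * Matrix.diagonal (fun i => (y i : ℂ)) *
                (U : Matrix (Fin N) (Fin N) ℂ))^2).trace).re) ∂μ)
      = ((2 * Real.pi) ^ ((N:ℝ)/2) * ∏ j ∈ Finset.range N, Real.Gamma (j + 1)) *
          σ ^ (N^2 : ℕ) / (vandermonde N x * vandermonde N y) *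
          Matrix.det (Matrix.of fun i j : Fin N =>
            (2 * Real.pi * σ^2) ^ (-(1:ℝ)/2) * Real.exp (-(x i - y j)^2 / (2 * σ^2))) := by
  have hmain := HarishChandra.vandermonde_mul_integral_exp_trace_re hinv x
    (fun i => (σ ^ 2)⁻¹ * y i)
  have h_int : ∀ U : Matrix.unitaryGroup (Fin N) ℂ,
      Real.exp (-(1 / (2 * σ^2)) *
          (((Matrix.diagonal (fun i => (x i : ℂ)) -
              (U : Matrix (Fin N) (Fin N) ℂ)ᴴ * Matrix.diagonal (fun i => (y i : ℂ)) *
                (U : Matrix (Fin N) (Fin N) ℂ))^2).trace).re) =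
      Real.exp (-(∑ i, x i ^ 2 + ∑ i, y i ^ 2) / (2 * σ ^ 2)) *
        Real.exp (Matrix.diagonal (fun i => (((σ ^ 2)⁻¹ * y i : ℝ) : ℂ)) *
          ((U : Matrix (Fin N) (Fin N) ℂ) * Matrix.diagonal (fun i => (x i : ℂ)) *
            (U : Matrix (Fin N) (Fin N) ℂ)ᴴ)).trace.re := by
    intro U
    have hd : Matrix.diagonal (fun i => (((σ ^ 2)⁻¹ * y i : ℝ) : ℂ)) =
        (((σ ^ 2)⁻¹ : ℝ) : ℂ) • Matrix.diagonal (fun i => (y i : ℂ)) := by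
      rw [← Matrix.diagonal_smul]
      congr 1
      ext i
      simp
    have hsq : ∀ z : Fin N → ℝ, (∑ i, (z i : ℂ) ^ 2).re = ∑ i, z i ^ 2 := by
      intro z
      rw [← Complex.ofReal_re (∑ i, z i ^ 2)]
      push_cast
      rfl
    have hre : ∀ z : ℂ, (2 * z).re = 2 * z.re := by simp
    rw [← Real.exp_add, HarishChandra.trace_sub_conj_sq, hd, Matrix.smul_mul, Matrix.trace_smul,
      smul_eq_mul, Complex.re_ofReal_mul, Complex.sub_re, Complex.add_re, hsq, hsq,
      hre]
    congr 1
    field_simp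
    ring
  have hGamma : ∏ j ∈ Finset.range N, Real.Gamma (j + 1) =
      ∏ i : Fin N, ((i : ℕ).factorial : ℝ) := by
    rw [← Fin.prod_univ_eq_prod_range fun j => Real.Gamma ((j : ℝ) + 1)]
    exact Finset.prod_congr rfl fun i _ => Real.Gamma_nat_eq_factorial i
  have hpow : σ ^ (N ^ 2) * ((σ ^ 2)⁻¹) ^ (∑ i ∈ Finset.range N, i) = σ ^ N := by
    have hN : N ^ 2 = 2 * (∑ i ∈ Finset.range N, i) + N := by
      rw [mul_comm, Finset.sum_range_id_mul_two]
      cases N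
      · rfl
      · simp only [Nat.add_sub_cancel]
        ring
    rw [inv_pow, ← pow_mul, hN, pow_add]
    field_simp
  have hconst := HarishChandra.two_pi_rpow_mul_gaussian_const_pow N hσ
  have hvx := (HarishChandra.vandermonde_pos hx).ne'
  have hvy := (HarishChandra.vandermonde_pos hy).ne'
  simp only [h_int]
  rw [integral_const_mul, HarishChandra.det_gaussian, hGamma]
  rw [HarishChandra.vandermonde_const_mul] at hmain
  rw [div_mul_eq_mul_div, eq_div_iff (mul_ne_zero hvx hvy)]
  rw [← hpow] at hconst
  set J := ∫ U : Matrix.unitaryGroup (Fin N) ℂ,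
    Real.exp (Matrix.diagonal (fun i => (((σ ^ 2)⁻¹ * y i : ℝ) : ℂ)) *
      ((U : Matrix (Fin N) (Fin N) ℂ) * Matrix.diagonal (fun i => (x i : ℂ)) *
        (U : Matrix (Fin N) (Fin N) ℂ)ᴴ)).trace.re ∂μ
  set E := Real.exp (-(∑ i, x i ^ 2 + ∑ i, y i ^ 2) / (2 * σ ^ 2))
  linear_combination E * (2 * Real.pi) ^ ((N : ℝ) / 2) *
    ((2 * Real.pi * σ ^ 2) ^ (-(1 : ℝ) / 2)) ^ N * σ ^ (N ^ 2) * hmain -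
    E * J * vandermonde N x * vandermonde N y * hconst
end
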